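/- There exist absolute constants c₁ > 0 and C > 0 such that the following holds for all sufficiently large primes q. Let d ≥ 2 be squarefree with d | (q−1), let χ be a primitive Dirichlet character modulo q of order d, and set δ := max{ (log log(ed) / (c₁ log d))^{1/2}, (log q)^{−c₁} }. Then for every x > q^δ and every d-th root of unity α, the number of positive integers n ≤ x with χ(n) = α is at most C·x/(log log d)^{1/25}. -/

import Mathlib

section
open ArithmeticFunction

/-- Dirichlet hyperbola-type rearrangement. -/
lemma LO_hyp {M : Type*} [AddCommMonoid M] (N : ℕ) (h : ℕ → ℕ → M) :
    ∑ n ∈ Finset.Ioc 0 N, ∑ m ∈ Finset.Ioc 0 (N / n), h n (n * m) =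
      ∑ k ∈ Finset.Ioc 0 N, ∑ n ∈ k.divisors, h n k := by
  rw [Finset.sum_sigma', Finset.sum_sigma']
  refine Finset.sum_bij' (fun a _ => ⟨a.1 * a.2, a.1⟩) (fun b _ => ⟨b.2, b.1 / b.2⟩) ?_ ?_ ?_ ?_ ?_
  · rintro ⟨n, m⟩ hx
    simp only [Finset.mem_sigma, Finset.mem_Ioc, Nat.mem_divisors] at hx ⊢
    obtain ⟨⟨h1, h2⟩, h3, h4⟩ := hx
    have := (Nat.le_div_iff_mul_le h1).1 h4
    refine ⟨⟨Nat.mul_pos h1 h3, by rw [mul_comm]; exact this⟩, Dvd.intro _ rfl, (Nat.mul_pos h1 h3).ne'⟩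
  · rintro ⟨k, n⟩ hx
    simp only [Finset.mem_sigma, Finset.mem_Ioc, Nat.mem_divisors] at hx ⊢
    obtain ⟨⟨h1, h2⟩, h3, h4⟩ := hx
    have hn := Nat.pos_of_dvd_of_pos h3 h1
    exact ⟨⟨hn, (Nat.le_of_dvd h1 h3).trans h2⟩, Nat.div_pos (Nat.le_of_dvd h1 h3) hn,
      Nat.div_le_div_right h2⟩
  · rintro ⟨n, m⟩ hx
    simp only [Finset.mem_sigma, Finset.mem_Ioc] at hx ⊢
    simp [Nat.mul_div_cancel_left _ hx.1.1]
  · rintro ⟨k, n⟩ hx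
    simp only [Finset.mem_sigma, Finset.mem_Ioc, Nat.mem_divisors] at hx ⊢
    simp [Nat.mul_div_cancel' hx.2.1]
  · rintro ⟨n, m⟩ hx
    rfl

lemma LO_psi_le {x : ℝ} (hx : 0 ≤ x) : Chebyshev.psi x ≤ 6 * x := by
  refine (Chebyshev.psi_le_const_mul_self hx).trans ?_
  have : Real.log 4 ≤ 2 := by
    rw [show (4:ℝ) = 2 ^ 2 by norm_num, Real.log_pow]
    have := Real.log_two_lt_d9
    push_cast; linarith
  nlinarith

lemma LO_log_fact (N : ℕ) : (N : ℝ) * Real.log N - N ≤ Real.log (N.factorial) ∧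
    (1 ≤ N → Real.log (N.factorial) ≤ (N : ℝ) * Real.log N - N + 1 + Real.log N) := by
  induction N with
  | zero => simp
  | succ n ih =>
    rcases Nat.eq_zero_or_pos n with rfl | hn
    · simp
    have hn' : (0:ℝ) < n := by exact_mod_cast hn
    have e1 : Real.log ((n+1).factorial) = Real.log (n+1) + Real.log (n.factorial) := by
      rw [Nat.factorial_succ]; push_cast
      rw [Real.log_mul (by positivity) (by positivity)]
    have l1 : Real.log (n+1) - Real.log n ≤ 1 / n := by
      rw [← Real.log_div (by positivity) (by positivity)]
      refine (Real.log_le_sub_one_of_pos (by positivity)).trans (le_of_eq ?_)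
      field_simp; ring
    have l2 : 1 / (n+1 : ℝ) ≤ Real.log (n+1) - Real.log n := by
      rw [← Real.log_div (by positivity) (by positivity)]
      have := Real.one_sub_inv_le_log_of_pos (x := ((n:ℝ)+1)/n) (by positivity)
      refine le_trans (le_of_eq ?_) this
      field_simp; ring
    have l1' : n * (Real.log (n+1) - Real.log n) ≤ 1 := by
      calc _ ≤ n * (1 / (n:ℝ)) := by gcongr
        _ = 1 := by field_simp
    have l2' : 1 ≤ (n+1) * (Real.log (n+1) - Real.log n) := by
      calc (1:ℝ) = (n+1) * (1/(n+1:ℝ)) := by field_simp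
        _ ≤ _ := by gcongr
    rw [e1]; push_cast
    refine ⟨by nlinarith [ih.1], fun _ => by nlinarith [ih.2 hn]⟩

lemma LO_log_fact_real {y : ℝ} (hy : 1 ≤ y) :
    |Real.log (⌊y⌋₊.factorial) - (y * Real.log y - y)| ≤ 1 + Real.log y := by
  have hN : 1 ≤ ⌊y⌋₊ := Nat.one_le_floor_iff y |>.2 hy
  obtain ⟨h1, h2⟩ := LO_log_fact ⌊y⌋₊
  have h2 := h2 hN
  have a1 : (⌊y⌋₊ : ℝ) ≤ y := Nat.floor_le (by linarith)
  have a2 : y < ⌊y⌋₊ + 1 := Nat.lt_floor_add_one y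
  have hN' : (1:ℝ) ≤ ⌊y⌋₊ := by exact_mod_cast hN
  set N : ℝ := (⌊y⌋₊ : ℝ)
  have hlN : 0 ≤ Real.log N := Real.log_nonneg hN'
  have hly : 0 ≤ Real.log y := Real.log_nonneg hy
  have hNy : Real.log N ≤ Real.log y := Real.log_le_log (by linarith) a1
  have u1 : N * (Real.log y - Real.log N) ≤ y - N := by
    rw [← Real.log_div (by linarith) (by linarith)]
    have := Real.log_le_sub_one_of_pos (x := y / N) (by positivity)
    calc _ ≤ N * (y / N - 1) := by gcongr
      _ = _ := by field_simp
  have u2 : y - N ≤ y * (Real.log y - Real.log N) := by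
    rw [← Real.log_div (by linarith) (by linarith)]
    have := Real.one_sub_inv_le_log_of_pos (x := y / N) (by positivity)
    calc _ = y * (1 - (y/N)⁻¹) := by field_simp
      _ ≤ _ := by gcongr
  rw [abs_le]
  constructor <;> nlinarith

lemma LO_psi_sum (x : ℝ) :
    ∑ n ∈ Finset.Ioc 0 ⌊x⌋₊, Chebyshev.psi (x / n) = Real.log (⌊x⌋₊.factorial) := by
  have := LO_hyp ⌊x⌋₊ (fun n k => Λ (k / n))
  have h1 : ∀ n ∈ Finset.Ioc 0 ⌊x⌋₊, Chebyshev.psi (x / n) =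
      ∑ m ∈ Finset.Ioc 0 (⌊x⌋₊ / n), Λ ((n * m) / n) := by
    intro n hn
    rw [Chebyshev.psi, Nat.floor_div_natCast]
    refine Finset.sum_congr rfl fun m _ => ?_
    rw [Nat.mul_div_cancel_left _ (Finset.mem_Ioc.1 hn).1]
  rw [Finset.sum_congr rfl h1, this]
  have h2 : ∀ k ∈ Finset.Ioc 0 ⌊x⌋₊, ∑ n ∈ k.divisors, Λ (k / n) = Real.log k := by
    intro k _
    rw [Nat.sum_div_divisors k (fun n => Λ n), vonMangoldt_sum]
  rw [Finset.sum_congr rfl h2]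
  clear this h1 h2
  induction ⌊x⌋₊ with
  | zero => simp
  | succ n ih =>
    rw [Finset.sum_Ioc_succ_top (by omega), ih, Nat.factorial_succ]
    push_cast
    rw [Real.log_mul (by positivity) (by positivity), add_comm]

lemma LO_lambda_sum (x : ℝ) :
    ∑ n ∈ Finset.Ioc 0 ⌊x⌋₊, Λ n * (⌊x⌋₊ / n : ℕ) = Real.log (⌊x⌋₊.factorial) := by
  rw [← LO_psi_sum]
  have a := LO_hyp ⌊x⌋₊ (fun n k => Λ (k / n))
  have b := LO_hyp ⌊x⌋₊ (fun n k => Λ n)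
  have h1 : ∀ n ∈ Finset.Ioc 0 ⌊x⌋₊, Chebyshev.psi (x / n) =
      ∑ m ∈ Finset.Ioc 0 (⌊x⌋₊ / n), Λ ((n * m) / n) := by
    intro n hn
    rw [Chebyshev.psi, Nat.floor_div_natCast]
    refine Finset.sum_congr rfl fun m _ => ?_
    rw [Nat.mul_div_cancel_left _ (Finset.mem_Ioc.1 hn).1]
  rw [Finset.sum_congr rfl h1, a]
  simp only [Finset.sum_const, Nat.card_Ioc, tsub_zero, nsmul_eq_mul] at b
  calc _ = ∑ x_1 ∈ Finset.Ioc 0 ⌊x⌋₊, ((⌊x⌋₊ / x_1 : ℕ) : ℝ) * Λ x_1 :=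
        Finset.sum_congr rfl fun _ _ => mul_comm _ _
    _ = _ := by
      rw [b]
      refine Finset.sum_congr rfl fun k _ => ?_
      rw [Nat.sum_div_divisors k (fun n => Λ n)]

/-- Mertens first theorem. -/
lemma LO_mertens1 {x : ℝ} (hx : 1 ≤ x) :
    |∑ n ∈ Finset.Ioc 0 ⌊x⌋₊, Λ n / n - Real.log x| ≤ 9 := by
  have h1 := LO_lambda_sum x
  have h2 := LO_log_fact_real hx
  have h3 := LO_psi_le (x := x) (by linarith)
  have hl : Real.log x ≤ x := (Real.log_le_sub_one_of_pos (by linarith)).trans (by linarith)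
  have up : ∑ n ∈ Finset.Ioc 0 ⌊x⌋₊, Λ n * (⌊x⌋₊ / n : ℕ) ≤
      x * ∑ n ∈ Finset.Ioc 0 ⌊x⌋₊, Λ n / n := by
    rw [Finset.mul_sum]
    refine Finset.sum_le_sum fun n hn => ?_
    have : ((⌊x⌋₊ / n : ℕ) : ℝ) ≤ x / n := by
      rw [← Nat.floor_div_natCast]; exact Nat.floor_le (by positivity)
    calc _ ≤ Λ n * (x / n) := by gcongr
      _ = _ := by ring
  have lo : x * ∑ n ∈ Finset.Ioc 0 ⌊x⌋₊, Λ n / n ≤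
      ∑ n ∈ Finset.Ioc 0 ⌊x⌋₊, Λ n * (⌊x⌋₊ / n : ℕ) + Chebyshev.psi x := by
    rw [Finset.mul_sum, Chebyshev.psi, ← Finset.sum_add_distrib]
    refine Finset.sum_le_sum fun n hn => ?_
    have : x / n ≤ ((⌊x⌋₊ / n : ℕ) : ℝ) + 1 := by
      rw [← Nat.floor_div_natCast]; exact (Nat.lt_floor_add_one _).le
    calc _ = Λ n * (x / n) := by ring
      _ ≤ Λ n * (((⌊x⌋₊ / n : ℕ) : ℝ) + 1) := by gcongr
      _ = _ := by ring
  rw [h1] at up lo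
  set S := ∑ n ∈ Finset.Ioc 0 ⌊x⌋₊, Λ n / n
  rw [abs_le] at h2 ⊢
  have hx0 : 0 < x := by linarith
  constructor
  · by_contra hc
    push Not at hc
    have : x * (S - Real.log x) < x * (-9) := mul_lt_mul_of_pos_left hc hx0
    nlinarith
  · by_contra hc
    push Not at hc
    have : x * 9 < x * (S - Real.log x) := mul_lt_mul_of_pos_left hc hx0
    nlinarith

end

section
open ArithmeticFunction

/-- The auxiliary function in the Tatuzawa-Iseki proof. -/
noncomputable def LO_F (y : ℝ) : ℝ := Chebyshev.psi y - y + Real.eulerMascheroniConstant + 1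

lemma LO_F_sum {y : ℝ} (hy : 1 ≤ y) :
    |∑ n ∈ Finset.Ioc 0 ⌊y⌋₊, LO_F (y / n)| ≤ 5 + Real.log y := by
  have h2 := LO_log_fact_real hy
  have hg1 := Real.one_half_lt_eulerMascheroniConstant
  have hg2 := Real.eulerMascheroniConstant_lt_two_thirds
  have hN : 1 ≤ ⌊y⌋₊ := Nat.one_le_floor_iff y |>.2 hy
  have a1 : (⌊y⌋₊ : ℝ) ≤ y := Nat.floor_le (by linarith)
  have a2 : y < ⌊y⌋₊ + 1 := Nat.lt_floor_add_one y
  have hN' : (1:ℝ) ≤ ⌊y⌋₊ := by exact_mod_cast hN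
  have k1 := Real.eulerMascheroniConstant_lt_eulerMascheroniSeq' ⌊y⌋₊
  have k2 := Real.eulerMascheroniSeq_lt_eulerMascheroniConstant ⌊y⌋₊
  rw [Real.eulerMascheroniSeq', if_neg (show ⌊y⌋₊ ≠ 0 by omega)] at k1
  rw [Real.eulerMascheroniSeq] at k2
  have e : ∑ n ∈ Finset.Ioc 0 ⌊y⌋₊, LO_F (y / n) = Real.log (⌊y⌋₊.factorial)
      - y * (harmonic ⌊y⌋₊ : ℝ) + (Real.eulerMascheroniConstant + 1) * ⌊y⌋₊ := by
    unfold LO_F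
    rw [← LO_psi_sum, harmonic_eq_sum_Icc]
    simp only [Finset.sum_add_distrib, Finset.sum_sub_distrib, Finset.sum_const, Nat.card_Ioc,
      nsmul_eq_mul, tsub_zero, Rat.cast_sum, Finset.mul_sum]
    have : Finset.Icc 1 ⌊y⌋₊ = Finset.Ioc 0 ⌊y⌋₊ := by ext; simp [Nat.succ_le_iff, Nat.pos_iff_ne_zero]
    rw [this]
    simp only [div_eq_mul_inv, Rat.cast_inv, Rat.cast_natCast]
    ring
  rw [e]
  set N : ℝ := (⌊y⌋₊ : ℝ)
  set H : ℝ := (harmonic ⌊y⌋₊ : ℝ)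
  set g := Real.eulerMascheroniConstant
  have b1 : y * (Real.log y - Real.log N) ≤ 2 := by
    rw [← Real.log_div (by linarith) (by linarith)]
    have := Real.log_le_sub_one_of_pos (x := y / N) (by positivity)
    calc _ ≤ y * (y / N - 1) := by gcongr
      _ = y / N * (y - N) := by field_simp
      _ ≤ 2 * 1 := by
        have : y / N ≤ 2 := by rw [div_le_iff₀ (by linarith)]; linarith
        apply mul_le_mul this (by linarith) (by linarith) (by norm_num)
      _ = 2 := by norm_num
  have b2 : y * (Real.log (N + 1) - Real.log y) ≤ 1 := by
    rw [← Real.log_div (by linarith) (by linarith)]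
    have := Real.log_le_sub_one_of_pos (x := (N+1) / y) (by positivity)
    calc _ ≤ y * ((N+1) / y - 1) := by gcongr
      _ = N + 1 - y := by field_simp
      _ ≤ 1 := by linarith
  have c1 : y * (g + Real.log N) ≤ y * H := by gcongr; linarith
  have c2 : y * H ≤ y * (g + Real.log (N+1)) := by gcongr; linarith
  rw [abs_le] at h2 ⊢
  constructor <;> nlinarith

lemma LO_sum_inv_sqrt (N : ℕ) : ∑ n ∈ Finset.Ioc 0 N, 1 / Real.sqrt n ≤ 2 * Real.sqrt N := by
  induction N with
  | zero => simp
  | succ n ih =>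
    rw [Finset.sum_Ioc_succ_top (by omega)]
    have h1 : 0 < Real.sqrt ((n+1 : ℕ) : ℝ) := Real.sqrt_pos.2 (by positivity)
    have h2 : 0 ≤ Real.sqrt (n : ℝ) := Real.sqrt_nonneg _
    have e1 : Real.sqrt ((n+1 : ℕ) : ℝ) ^ 2 = n + 1 := by rw [Real.sq_sqrt (by positivity)]; push_cast; rfl
    have e2 : Real.sqrt (n : ℝ) ^ 2 = n := Real.sq_sqrt (by positivity)
    set a := Real.sqrt ((n+1 : ℕ) : ℝ)
    set b := Real.sqrt (n : ℝ)
    have : 1 / a ≤ 2 * a - 2 * b := by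
      rw [div_le_iff₀ h1]; nlinarith [sq_nonneg (a - b)]
    linarith

lemma LO_G_bound {y : ℝ} (hy : 1 ≤ y) :
    |Real.log y * ∑ n ∈ Finset.Ioc 0 ⌊y⌋₊, LO_F (y / n)| ≤ 26 * Real.sqrt y := by
  have hl : 0 ≤ Real.log y := Real.log_nonneg hy
  rw [abs_mul, abs_of_nonneg hl]
  have h1 := LO_F_sum hy
  have l1 : Real.log y ≤ 4 * Real.sqrt (Real.sqrt y) := by
    have := Real.log_le_rpow_div (x := y) (by linarith) (ε := 1/4) (by norm_num)
    rw [Real.sqrt_eq_rpow, Real.sqrt_eq_rpow, ← Real.rpow_mul (by linarith)]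
    norm_num at this ⊢; linarith
  have l2 : Real.log y ≤ 2 * Real.sqrt y := by
    have := Real.log_le_rpow_div (x := y) (by linarith) (ε := 1/2) (by norm_num)
    rw [Real.sqrt_eq_rpow]
    norm_num at this ⊢; linarith
  have e1 := Real.sq_sqrt (Real.sqrt_nonneg y)
  have l3 : Real.log y * Real.log y ≤ 16 * Real.sqrt y := by
    calc _ ≤ (4 * Real.sqrt (Real.sqrt y)) * (4 * Real.sqrt (Real.sqrt y)) := by gcongr
      _ = 16 * Real.sqrt (Real.sqrt y) ^ 2 := by ring
      _ = _ := by rw [e1]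
  calc _ ≤ Real.log y * (5 + Real.log y) := by gcongr
    _ ≤ _ := by nlinarith

/-- Left-hand side of Selberg formula. -/
noncomputable def LO_S (x : ℝ) : ℝ := Chebyshev.psi x * Real.log x +
  ∑ n ∈ Finset.Ioc 0 ⌊x⌋₊, Λ n * Chebyshev.psi (x / n)

lemma LO_TI {x : ℝ} (hx : 1 ≤ x) :
    ∑ n ∈ Finset.Ioc 0 ⌊x⌋₊, (moebius n : ℝ) * (Real.log (x / n) *
      ∑ m ∈ Finset.Ioc 0 ⌊x / n⌋₊, LO_F (x / n / m)) =
    LO_F x * Real.log x + ∑ n ∈ Finset.Ioc 0 ⌊x⌋₊, Λ n * LO_F (x / n) := by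
  have h := LO_hyp ⌊x⌋₊ (fun n k => (moebius n : ℝ) * Real.log (x / n) * LO_F (x / k))
  have h1 : ∀ n ∈ Finset.Ioc 0 ⌊x⌋₊, (moebius n : ℝ) * (Real.log (x / n) *
      ∑ m ∈ Finset.Ioc 0 ⌊x / n⌋₊, LO_F (x / n / m)) =
      ∑ m ∈ Finset.Ioc 0 (⌊x⌋₊ / n), (moebius n : ℝ) * Real.log (x / n) * LO_F (x / (n * m : ℕ)) := by
    intro n hn
    rw [Nat.floor_div_natCast, ← mul_assoc, Finset.mul_sum]
    refine Finset.sum_congr rfl fun m _ => ?_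
    rw [Nat.cast_mul, div_div]
  rw [Finset.sum_congr rfl h1, h]
  have h2 : ∀ k ∈ Finset.Ioc 0 ⌊x⌋₊, ∑ n ∈ k.divisors,
      (moebius n : ℝ) * Real.log (x / n) * LO_F (x / k) =
      (if k = 1 then Real.log x * LO_F x else 0) + Λ k * LO_F (x / k) := by
    intro k hk
    rw [← Finset.sum_mul]
    have e1 : ∑ n ∈ k.divisors, (moebius n : ℝ) * Real.log (x / n) =
        Real.log x * (∑ n ∈ k.divisors, (moebius n : ℝ)) - ∑ n ∈ k.divisors, (moebius n : ℝ) * log n := by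
      rw [Finset.mul_sum, ← Finset.sum_sub_distrib]
      refine Finset.sum_congr rfl fun n hn => ?_
      have : n ≠ 0 := by
        rintro rfl; simp at hn
      rw [Real.log_div (by linarith) (by positivity), log_apply]; ring
    rw [e1, sum_moebius_mul_log_eq]
    have e2 : ∑ n ∈ k.divisors, (moebius n : ℝ) = if k = 1 then 1 else 0 := by
      have := congrArg (fun f => f k) moebius_mul_coe_zeta
      simp only [coe_mul_zeta_apply, one_apply] at this
      exact_mod_cast this
    rw [e2]
    split_ifs with hk1
    · subst hk1; simp
    · ring
  rw [Finset.sum_congr rfl h2, Finset.sum_add_distrib, Finset.sum_ite_eq']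
  have : 1 ∈ Finset.Ioc 0 ⌊x⌋₊ := by
    simp; exact hx
  rw [if_pos this, mul_comm]

/-- Selberg symmetry formula. -/
lemma LO_selberg {x : ℝ} (hx : 1 ≤ x) : |LO_S x - 2 * x * Real.log x| ≤ 80 * x := by
  have h1 : |∑ n ∈ Finset.Ioc 0 ⌊x⌋₊, (moebius n : ℝ) * (Real.log (x / n) *
      ∑ m ∈ Finset.Ioc 0 ⌊x / n⌋₊, LO_F (x / n / m))| ≤ 52 * x := by
    refine (Finset.abs_sum_le_sum_abs _ _).trans ?_
    calc _ ≤ ∑ n ∈ Finset.Ioc 0 ⌊x⌋₊, 26 * Real.sqrt x * (1 / Real.sqrt n) := by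
          refine Finset.sum_le_sum fun n hn => ?_
          rw [abs_mul]
          have hn' := Finset.mem_Ioc.1 hn
          have hn0 : (0:ℝ) < n := by exact_mod_cast hn'.1
          have hxn : 1 ≤ x / n := by
            rw [le_div_iff₀ hn0, one_mul]
            exact (Nat.le_floor_iff (by linarith)).1 hn'.2
          have hm : |(moebius n : ℝ)| ≤ 1 := by exact_mod_cast abs_moebius_le_one
          calc _ ≤ 1 * (26 * Real.sqrt (x / n)) := by
                gcongr; exact LO_G_bound hxn
            _ = _ := by rw [Real.sqrt_div (by linarith)]; ring
      _ ≤ 26 * Real.sqrt x * (2 * Real.sqrt ⌊x⌋₊) := by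
          rw [← Finset.mul_sum]; gcongr; exact LO_sum_inv_sqrt _
      _ ≤ 26 * Real.sqrt x * (2 * Real.sqrt x) := by
          gcongr; exact Nat.floor_le (by linarith)
      _ = 52 * x := by
          have := Real.mul_self_sqrt (show 0 ≤ x by linarith)
          linear_combination 52 * this
  rw [LO_TI hx] at h1
  have hm := LO_mertens1 hx
  have hp := LO_psi_le (x := x) (by linarith)
  have hp0 := Chebyshev.psi_nonneg x
  have hl : Real.log x ≤ x := (Real.log_le_sub_one_of_pos (by linarith)).trans (by linarith)
  have hl0 : 0 ≤ Real.log x := Real.log_nonneg hx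
  have hg1 := Real.one_half_lt_eulerMascheroniConstant
  have hg2 := Real.eulerMascheroniConstant_lt_two_thirds
  have e : LO_F x * Real.log x + ∑ n ∈ Finset.Ioc 0 ⌊x⌋₊, Λ n * LO_F (x / n) =
      LO_S x - (x - (Real.eulerMascheroniConstant + 1)) * Real.log x
       - x * (∑ n ∈ Finset.Ioc 0 ⌊x⌋₊, Λ n / n)
       + (Real.eulerMascheroniConstant + 1) * Chebyshev.psi x := by
    unfold LO_S LO_F
    have : ∀ n : ℕ, Λ n * (Chebyshev.psi (x / n) - x / n + Real.eulerMascheroniConstant + 1) =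
      Λ n * Chebyshev.psi (x / n) - x * (Λ n / n) + (Real.eulerMascheroniConstant + 1) * Λ n := by
      intro n; ring
    simp only [this, Finset.sum_add_distrib, Finset.sum_sub_distrib, ← Finset.mul_sum]
    rw [Chebyshev.psi]; ring
  rw [e] at h1
  set g := Real.eulerMascheroniConstant
  set M := ∑ n ∈ Finset.Ioc 0 ⌊x⌋₊, Λ n / n
  have hm' : |x * M - x * Real.log x| ≤ 9 * x := by
    rw [← mul_sub, abs_mul, abs_of_nonneg (by linarith : (0:ℝ) ≤ x)]
    nlinarith
  have t1 : (g+1) * Real.log x ≤ 2 * x := by nlinarith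
  have t1' : 0 ≤ (g+1) * Real.log x := by positivity
  have t2 : (g+1) * Chebyshev.psi x ≤ 12 * x := by nlinarith
  have t2' : 0 ≤ (g+1) * Chebyshev.psi x := by positivity
  rw [abs_le] at h1 hm' ⊢
  constructor <;> nlinarith

/-- Brun-Titchmarsh for fixed-ratio intervals, from Selberg formula. -/
lemma LO_BT {y y' : ℝ} (hy : 2 ≤ y) (hyy : y ≤ y') (hy2 : y' ≤ 3 * y) :
    Chebyshev.psi y' - Chebyshev.psi y ≤ 6 * (y' - y) + 400 * y / Real.log y := by
  have h1 := (abs_le.1 (LO_selberg (x := y) (by linarith))).1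
  have h2 := (abs_le.1 (LO_selberg (x := y') (by linarith))).2
  have hl : 0 < Real.log y := Real.log_pos (by linarith)
  have hll : Real.log y ≤ Real.log y' := Real.log_le_log (by linarith) hyy
  have mono : (Chebyshev.psi y' - Chebyshev.psi y) * Real.log y ≤ LO_S y' - LO_S y := by
    unfold LO_S
    have s1 : ∑ n ∈ Finset.Ioc 0 ⌊y⌋₊, Λ n * Chebyshev.psi (y / n) ≤
        ∑ n ∈ Finset.Ioc 0 ⌊y'⌋₊, Λ n * Chebyshev.psi (y' / n) := by
      calc _ ≤ ∑ n ∈ Finset.Ioc 0 ⌊y⌋₊, Λ n * Chebyshev.psi (y' / n) := by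
            refine Finset.sum_le_sum fun n _ => ?_
            refine mul_le_mul_of_nonneg_left (Chebyshev.psi_mono (by gcongr)) vonMangoldt_nonneg
        _ ≤ _ := by
            refine Finset.sum_le_sum_of_subset_of_nonneg ?_ ?_
            · exact Finset.Ioc_subset_Ioc_right (Nat.floor_mono hyy)
            · intro n _ _
              exact mul_nonneg vonMangoldt_nonneg (Chebyshev.psi_nonneg _)
    have := Chebyshev.psi_nonneg y'
    nlinarith
  have hy0 : 0 < y := by linarith
  have hy'0 : 0 < y' := by linarith
  have hlog : y' * (Real.log y' - Real.log y) ≤ 3 * (y' - y) := by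
    rw [← Real.log_div (by linarith) (by linarith)]
    have := Real.log_le_sub_one_of_pos (x := y' / y) (by positivity)
    calc _ ≤ y' * (y' / y - 1) := by gcongr
      _ = y' / y * (y' - y) := by field_simp
      _ ≤ 3 * (y' - y) := by
        have : y' / y ≤ 3 := by rw [div_le_iff₀ (by linarith)]; linarith
        apply mul_le_mul_of_nonneg_right this (by linarith)
  have key : (Chebyshev.psi y' - Chebyshev.psi y) * Real.log y ≤
      6 * (y' - y) * Real.log y + 400 * y := by
    nlinarith
  calc _ = (Chebyshev.psi y' - Chebyshev.psi y) * Real.log y / Real.log y := by field_simp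
    _ ≤ (6 * (y' - y) * Real.log y + 400 * y) / Real.log y := by gcongr
    _ = _ := by field_simp

end

section
open MeasureTheory FourierTransform SchwartzMap in
/-- Plancherel for integrable and square integrable functions. -/
lemma LO_plancherel (f : ℝ → ℂ) (h1 : Integrable f) (h2 : MemLp f 2) :
    Integrable (fun x => ‖𝓕 f x‖ ^ 2) ∧ ∫ x, ‖𝓕 f x‖ ^ 2 = ∫ x, ‖f x‖ ^ 2 := by
  set F : Lp ℂ 2 (volume : Measure ℝ) := h2.toLp f with hF
  have hcont : Continuous (𝓕 f) :=
    VectorFourier.fourierIntegral_continuous Real.continuous_fourierChar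
      (by exact continuous_inner) h1
  have hae : ∀ᵐ x, 𝓕 f x = (𝓕 F : Lp ℂ 2 (volume : Measure ℝ)) x := by
    apply ae_eq_of_integral_contDiff_smul_eq
    · exact hcont.locallyIntegrable
    · exact (Lp.memLp _).locallyIntegrable (by norm_num)
    · intro g g_smooth g_cpt
      have hg₁ : HasCompactSupport (Complex.ofRealCLM ∘ g) := g_cpt.comp_left rfl
      have hg₂ : ContDiff ℝ ((⊤ : ℕ∞) : WithTop ℕ∞) (Complex.ofRealCLM ∘ g) := by fun_prop
      set G := hg₁.toSchwartzMap hg₂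
      have e1 := congrArg (fun T => T G) (Lp.fourier_toTemperedDistribution_eq F)
      simp only [TemperedDistribution.fourier_apply, Lp.toTemperedDistribution_apply] at e1
      have e2 : ∫ x, g x • (𝓕 F : Lp ℂ 2 (volume : Measure ℝ)) x = ∫ x, G x • (𝓕 F : Lp ℂ 2 (volume : Measure ℝ)) x := by
        refine integral_congr_ae (Filter.Eventually.of_forall fun x => ?_)
        simp [G]
      rw [e2, ← e1]
      have e3 := VectorFourier.integral_fourierIntegral_smul_eq_flip (L := innerₗ ℝ) (f := f) (g := G)
        Real.continuous_fourierChar (by exact continuous_inner) h1 G.integrable (μ := volume) (ν := volume)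
      rw [flip_innerₗ] at e3
      have e4 : ∫ x, g x • 𝓕 f x = ∫ x, 𝓕 f x • G x := by
        refine integral_congr_ae (Filter.Eventually.of_forall fun x => ?_)
        simp [G, mul_comm]
      rw [e4]
      refine Eq.trans e3 ?_
      refine integral_congr_ae ?_
      filter_upwards [h2.coeFn_toLp] with x hx
      rw [hx, smul_eq_mul, smul_eq_mul, mul_comm, fourier_coe]
      rfl
  have hm : MemLp (𝓕 f) 2 := (memLp_congr_ae hae).2 (Lp.memLp _)
  refine ⟨by simpa using hm.integrable_norm_pow (p := 2) (by norm_num), ?_⟩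
  have n1 := Lp.norm_fourier_eq F
  have n2 : ‖F‖ ^ 2 = ∫ x, ‖f x‖ ^ 2 := by
    rw [hF, Lp.norm_toLp, h2.eLpNorm_eq_integral_rpow_norm (by norm_num) (by norm_num)]
    rw [ENNReal.toReal_ofReal (by positivity)]
    simp
    rw [← Real.rpow_natCast, ← Real.rpow_mul (by positivity)]; norm_num
  have n3 : ‖(𝓕 F : Lp ℂ 2 (volume : Measure ℝ))‖ ^ 2 = ∫ x, ‖𝓕 f x‖ ^ 2 := by
    have hh : (𝓕 F : Lp ℂ 2 (volume : Measure ℝ)) = hm.toLp _ := by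
      apply Lp.ext
      filter_upwards [hae, hm.coeFn_toLp] with x a b
      rw [b, a]
    rw [hh, Lp.norm_toLp, hm.eLpNorm_eq_integral_rpow_norm (by norm_num) (by norm_num)]
    rw [ENNReal.toReal_ofReal (by positivity)]
    simp
    rw [← Real.rpow_natCast, ← Real.rpow_mul (by positivity)]; norm_num
  rw [← n2, ← n3, n1]

end

section
open MeasureTheory FourierTransform

lemma LO_sub_exp (S : ℝ → ℂ) (s : ℂ) :
    ∫ t in Set.Ioi (1 : ℝ), S t * (t : ℂ) ^ (-(s + 1)) =
    ∫ u in Set.Ioi (0:ℝ), S (Real.exp u) * Complex.exp (-(u * s)) := by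
  have him : Real.exp '' Set.Ioi 0 = Set.Ioi 1 := by
    ext y; constructor
    · rintro ⟨u, hu, rfl⟩; exact Real.one_lt_exp_iff.2 hu
    · intro hy
      exact ⟨Real.log y, Real.log_pos hy, Real.exp_log (by linarith [Set.mem_Ioi.1 hy])⟩
  rw [← him, integral_image_eq_integral_abs_deriv_smul measurableSet_Ioi
    (fun x _ => (Real.hasDerivAt_exp x).hasDerivWithinAt) Real.exp_injective.injOn]
  refine setIntegral_congr_fun measurableSet_Ioi fun u _ => ?_
  have h0 : (Real.exp u : ℂ) ≠ 0 := by exact_mod_cast (Real.exp_pos u).ne'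
  rw [Complex.cpow_def_of_ne_zero h0, abs_of_pos (Real.exp_pos u), Complex.real_smul,
    ← Complex.ofReal_log (Real.exp_pos u).le, Real.log_exp]
  have : Complex.exp (-(u * s)) = (Real.exp u : ℂ) * Complex.exp (u * -(s+1)) := by
    rw [Complex.ofReal_exp, ← Complex.exp_add]; ring_nf
  rw [this]; ring

/-- Plancherel for Dirichlet series. -/
lemma LO_planch_L (a : ℕ → ℂ) {κ r M : ℝ} (hr : 0 ≤ r) (hrk : r < 1 + κ)
    (ha : ∀ n : ℕ, 1 ≤ n → ∑ k ∈ Finset.Icc 1 n, ‖a k‖ ≤ M * (n : ℝ) ^ r) :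
    Integrable (fun t : ℝ => ‖LSeries a (1 + κ + t * Complex.I) / (1 + κ + t * Complex.I)‖ ^ 2) ∧
    ∫ t : ℝ, ‖LSeries a (1 + κ + t * Complex.I) / (1 + κ + t * Complex.I)‖ ^ 2 = 
      2 * Real.pi * ∫ u in Set.Ioi (0:ℝ), ‖∑ k ∈ Finset.Icc 1 ⌊Real.exp u⌋₊, a k‖ ^ 2 *
        Real.exp (-(2 * (1 + κ)) * u) ∧
    IntegrableOn (fun u => ‖∑ k ∈ Finset.Icc 1 ⌊Real.exp u⌋₊, a k‖ ^ 2 *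
        Real.exp (-(2 * (1 + κ)) * u)) (Set.Ioi (0:ℝ)) := by
  have hM : 0 ≤ M := by
    have := ha 1 le_rfl; simp at this; exact (norm_nonneg _).trans this
  set A : ℝ → ℂ := fun u => ∑ k ∈ Finset.Icc 1 ⌊Real.exp u⌋₊, a k with hA
  have hAm : Measurable A := by
    have : Measurable (fun n : ℕ => ∑ k ∈ Finset.Icc 1 n, a k) := measurable_from_nat
    exact this.comp (Nat.measurable_floor.comp Real.measurable_exp)
  have hAb : ∀ u, 0 < u → ‖A u‖ ≤ M * Real.exp (r * u) := by
    intro u hu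
    have h1 : 1 ≤ Real.exp u := Real.one_le_exp hu.le
    refine (norm_sum_le _ _).trans ((ha _ (Nat.one_le_floor_iff _ |>.2 h1)).trans ?_)
    have : (⌊Real.exp u⌋₊ : ℝ) ^ r ≤ (Real.exp u) ^ r := by
      gcongr; exact Nat.floor_le (Real.exp_pos u).le
    rw [← Real.exp_mul, mul_comm u r] at this
    gcongr
  set f : ℝ → ℂ := (Set.Ioi (0:ℝ)).indicator (fun u => A u * Complex.exp (-(u * (1 + κ)))) with hf
  have hfm : Measurable f := by
    refine Measurable.indicator ?_ measurableSet_Ioi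
    refine hAm.mul ?_
    fun_prop
  have hnorm : ∀ u : ℝ, ‖Complex.exp (-(u * (1 + κ)))‖ = Real.exp (-(u * (1+κ))) := by
    intro u; rw [Complex.norm_exp]; simp
  have hfb : ∀ u, ‖f u‖ ≤ (Set.Ioi (0:ℝ)).indicator (fun u => M * Real.exp (-(1+κ-r) * u)) u := by
    intro u
    rw [hf, norm_indicator_eq_indicator_norm]
    refine Set.indicator_le_indicator' fun hu => ?_
    rw [norm_mul, hnorm]
    calc _ ≤ M * Real.exp (r * u) * Real.exp (-(u * (1+κ))) := by gcongr; exact hAb u hu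
      _ = _ := by rw [mul_assoc, ← Real.exp_add]; ring_nf
  have i1 : Integrable ((Set.Ioi (0:ℝ)).indicator (fun u => M * Real.exp (-(1+κ-r) * u))) := by
    rw [integrable_indicator_iff measurableSet_Ioi]
    exact (integrableOn_exp_mul_Ioi (by linarith) 0).const_mul M
  have i2 : Integrable ((Set.Ioi (0:ℝ)).indicator (fun u => M ^ 2 * Real.exp ((2 * -(1+κ-r)) * u))) := by
    rw [integrable_indicator_iff measurableSet_Ioi]
    exact (integrableOn_exp_mul_Ioi (by linarith) 0).const_mul (M ^ 2)
  have hf1 : Integrable f := i1.mono' hfm.aestronglyMeasurable (Filter.Eventually.of_forall hfb)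
  have hf2' : Integrable (fun u => ‖f u‖ ^ 2) := by
    refine i2.mono' (hfm.norm.pow_const 2).aestronglyMeasurable (Filter.Eventually.of_forall fun u => ?_)
    rw [norm_pow, norm_norm]
    have := hfb u
    by_cases hu : u ∈ Set.Ioi (0:ℝ)
    · simp only [Set.indicator_of_mem hu] at this ⊢
      calc _ ≤ (M * Real.exp (-(1 + κ - r) * u)) ^ 2 := by gcongr
        _ = _ := by rw [mul_pow, ← Real.exp_nat_mul]; push_cast; ring_nf
    · simp only [Set.indicator_of_notMem hu] at this ⊢
      have : ‖f u‖ = 0 := le_antisymm this (norm_nonneg _)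
      rw [this]; simp
  have hf2 : MemLp f 2 := (memLp_two_iff_integrable_sq_norm hfm.aestronglyMeasurable).2 hf2'
  obtain ⟨p1, p2⟩ := LO_plancherel f hf1 hf2
  have hO : (fun n : ℕ => ∑ k ∈ Finset.Icc 1 n, ‖a k‖) =O[Filter.atTop] fun n => (n : ℝ) ^ r := by
    refine Asymptotics.IsBigO.of_bound M ?_
    filter_upwards [Filter.eventually_ge_atTop 1] with n hn
    rw [Real.norm_of_nonneg (Finset.sum_nonneg fun _ _ => norm_nonneg _), Real.norm_of_nonneg (by positivity)]
    exact ha n hn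
  have hft : ∀ ξ : ℝ, 𝓕 f ξ = LSeries a (1 + κ + (2 * Real.pi * ξ : ℝ) * Complex.I) /
      (1 + κ + (2 * Real.pi * ξ : ℝ) * Complex.I) := by
    intro ξ
    have hre : (1 + κ + (2 * Real.pi * ξ : ℝ) * Complex.I : ℂ).re = 1 + κ := by simp
    have hs0 : (1 + κ + (2 * Real.pi * ξ : ℝ) * Complex.I : ℂ) ≠ 0 := by
      intro h; rw [h] at hre; simp at hre; linarith
    rw [LSeries_eq_mul_integral' a hr (by rw [hre]; exact hrk) hO, mul_div_cancel_left₀ _ hs0]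
    rw [LO_sub_exp (fun t => ∑ k ∈ Finset.Icc 1 ⌊t⌋₊, a k), Real.fourier_eq', ← integral_indicator measurableSet_Ioi]
    refine integral_congr_ae (Filter.Eventually.of_forall fun u => ?_)
    simp only [hf]
    by_cases hu : u ∈ Set.Ioi (0:ℝ)
    · simp only [Set.indicator_of_mem hu]
      rw [smul_eq_mul, mul_left_comm, ← Complex.exp_add]
      simp only [hA]
      congr 2
      simp
      ring
    · simp only [Set.indicator_of_notMem hu, smul_zero]
  set g : ℝ → ℝ := fun t : ℝ => ‖LSeries a (1 + κ + t * Complex.I) / (1 + κ + t * Complex.I)‖ ^ 2 with hg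
  have hpg : (fun x => ‖𝓕 f x‖ ^ 2) = fun x => g (2 * Real.pi * x) := by
    funext x; rw [hft x]
  rw [hpg] at p1 
  have p2' : ∫ x, g (2 * Real.pi * x) = ∫ x, ‖f x‖ ^ 2 := by rw [← p2, ← hpg]
  have hpi : (2 * Real.pi) ≠ 0 := by positivity
  have hsq : (fun u => ‖f u‖ ^ 2) = (Set.Ioi (0:ℝ)).indicator (fun u => ‖A u‖ ^ 2 * Real.exp (-(2 * (1 + κ)) * u)) := by
    funext u
    by_cases hu : u ∈ Set.Ioi (0:ℝ)
    · simp only [hf, Set.indicator_of_mem hu]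
      rw [norm_mul, hnorm, mul_pow, ← Real.exp_nat_mul]; push_cast; ring_nf
    · simp only [hf, Set.indicator_of_notMem hu]; simp
  refine ⟨(integrable_comp_mul_left_iff g hpi).1 p1, ?_, ?_⟩
  · rw [Measure.integral_comp_mul_left, hsq, integral_indicator measurableSet_Ioi, smul_eq_mul, abs_of_pos (by positivity)] at p2'
    rw [← p2']; field_simp
  · rw [hsq] at hf2'
    exact (integrable_indicator_iff measurableSet_Ioi).1 hf2'

end

section
open MeasureTheory ArithmeticFunction

/-- partial sums -/
noncomputable def LO_A (f : ℕ → ℂ) (y : ℝ) : ℂ := ∑ n ∈ Finset.Ioc 0 ⌊y⌋₊, f n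

lemma LO_A_meas (f : ℕ → ℂ) : Measurable (LO_A f) := by
  have : Measurable (fun n : ℕ => ∑ k ∈ Finset.Ioc 0 n, f k) := measurable_from_nat
  exact this.comp Nat.measurable_floor

lemma LO_A_le {f : ℕ → ℂ} (hb : ∀ n, ‖f n‖ ≤ 1) {y : ℝ} (hy : 0 ≤ y) : ‖LO_A f y‖ ≤ y := by
  refine (norm_sum_le _ _).trans ?_
  calc _ ≤ ∑ n ∈ Finset.Ioc 0 ⌊y⌋₊, (1:ℝ) := Finset.sum_le_sum fun n _ => hb n
    _ = ⌊y⌋₊ := by simp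
    _ ≤ y := Nat.floor_le hy

lemma LO_A_zero {f : ℕ → ℂ} {y : ℝ} (hy : y < 1) : LO_A f y = 0 := by
  unfold LO_A; rw [Nat.floor_eq_zero.2 hy]; simp

lemma LO_A_sub {f : ℕ → ℂ} (hb : ∀ n, ‖f n‖ ≤ 1) {y z : ℝ} (hy : 0 ≤ y) (hyz : y ≤ z) :
    ‖LO_A f z‖ ≤ ‖LO_A f y‖ + (z - y) + 1 := by
  have h1 : LO_A f z = LO_A f y + ∑ n ∈ Finset.Ioc ⌊y⌋₊ ⌊z⌋₊, f n := by
    unfold LO_A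
    rw [Finset.sum_Ioc_consecutive _ (Nat.zero_le _) (Nat.floor_mono hyz)]
  rw [h1]
  refine (norm_add_le _ _).trans ?_
  have : ‖∑ n ∈ Finset.Ioc ⌊y⌋₊ ⌊z⌋₊, f n‖ ≤ (z - y) + 1 := by
    refine (norm_sum_le _ _).trans ?_
    calc _ ≤ ∑ n ∈ Finset.Ioc ⌊y⌋₊ ⌊z⌋₊, (1:ℝ) := Finset.sum_le_sum fun n _ => hb n
      _ = (⌊z⌋₊ : ℝ) - ⌊y⌋₊ := by simp [Nat.cast_sub (Nat.floor_mono hyz)]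
      _ ≤ _ := by
        have := Nat.floor_le (hy.trans hyz)
        have := Nat.lt_floor_add_one y
        linarith
  linarith

lemma LO_conv {f : ℕ → ℂ} (hmul : ∀ m n, f (m * n) = f m * f n) (y : ℝ) :
    LO_A (fun n => f n * Real.log n) y =
      ∑ d ∈ Finset.Ioc 0 ⌊y⌋₊, (Λ d : ℂ) * f d * LO_A f (y / d) := by
  have h := LO_hyp ⌊y⌋₊ (fun d k => (Λ d : ℂ) * f k)
  have e1 : ∀ d ∈ Finset.Ioc 0 ⌊y⌋₊, (Λ d : ℂ) * f d * LO_A f (y / d) =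
      ∑ m ∈ Finset.Ioc 0 (⌊y⌋₊ / d), (Λ d : ℂ) * f (d * m) := by
    intro d _
    unfold LO_A
    rw [Nat.floor_div_natCast, Finset.mul_sum]
    exact Finset.sum_congr rfl fun m _ => by rw [hmul]; ring
  rw [Finset.sum_congr rfl e1, h]
  unfold LO_A
  refine Finset.sum_congr rfl fun k _ => ?_
  rw [← Finset.sum_mul, ← Complex.ofReal_sum, vonMangoldt_sum]; ring

lemma LO_sum_log_fact (N : ℕ) : ∑ n ∈ Finset.Ioc 0 N, Real.log n = Real.log (N.factorial) := by
  induction N with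
  | zero => simp
  | succ n ih =>
    rw [Finset.sum_Ioc_succ_top (by omega), ih, Nat.factorial_succ, Nat.cast_mul,
      Real.log_mul (by positivity) (by positivity)]; ring

lemma LO_A_log {f : ℕ → ℂ} (hb : ∀ n, ‖f n‖ ≤ 1) {y : ℝ} (hy : 1 ≤ y) :
    ‖LO_A f y‖ * Real.log y ≤ ‖LO_A (fun n => f n * Real.log n) y‖ + y := by
  have e : LO_A f y * Real.log y = LO_A (fun n => f n * Real.log n) y +
      ∑ n ∈ Finset.Ioc 0 ⌊y⌋₊, f n * ((Real.log y - Real.log n : ℝ) : ℂ) := by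
    unfold LO_A
    rw [← Finset.sum_add_distrib, Finset.sum_mul]
    refine Finset.sum_congr rfl fun n _ => ?_
    push_cast; ring
  have hl := Real.log_nonneg hy
  have h1 : ‖LO_A f y‖ * Real.log y = ‖LO_A f y * Real.log y‖ := by
    rw [norm_mul, Complex.norm_real, Real.norm_of_nonneg hl]
  rw [h1, e]
  refine (norm_add_le _ _).trans ?_
  gcongr
  refine (norm_sum_le _ _).trans ?_
  have hfl := Nat.floor_le (by linarith : 0 ≤ y)
  have hN : 1 ≤ ⌊y⌋₊ := Nat.one_le_floor_iff y |>.2 hy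
  have hN' : (1:ℝ) ≤ ⌊y⌋₊ := by exact_mod_cast hN
  calc _ ≤ ∑ n ∈ Finset.Ioc 0 ⌊y⌋₊, (Real.log y - Real.log n) := by
        refine Finset.sum_le_sum fun n hn => ?_
        have hn' := Finset.mem_Ioc.1 hn
        have h3 : Real.log n ≤ Real.log y := by
          apply Real.log_le_log (by exact_mod_cast hn'.1)
          exact (Nat.cast_le.2 hn'.2).trans hfl
        rw [norm_mul, Complex.norm_real, Real.norm_of_nonneg (by linarith)]
        calc _ ≤ 1 * (Real.log y - Real.log n) := mul_le_mul_of_nonneg_right (hb n) (by linarith)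
          _ = _ := one_mul _
    _ = ⌊y⌋₊ * Real.log y - Real.log (⌊y⌋₊.factorial) := by
        rw [Finset.sum_sub_distrib]
        simp only [Finset.sum_const, Nat.card_Ioc, nsmul_eq_mul, tsub_zero]
        congr 1
        exact LO_sum_log_fact _
    _ ≤ ⌊y⌋₊ * (Real.log y - Real.log ⌊y⌋₊) + ⌊y⌋₊ := by
        have := (LO_log_fact ⌊y⌋₊).1
        linarith
    _ ≤ y := by
        rw [← Real.log_div (by linarith) (by linarith)]
        have := Real.log_le_sub_one_of_pos (x := y / ⌊y⌋₊) (by positivity)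
        calc _ ≤ (⌊y⌋₊:ℝ) * (y / ⌊y⌋₊ - 1) + ⌊y⌋₊ := by gcongr
          _ = y := by field_simp; ring

end

section
open MeasureTheory ArithmeticFunction

lemma LO_ii_of_bdd {h : ℝ → ℝ} (hm : Measurable h) {a b C : ℝ}
    (hC : ∀ x ∈ Set.uIoc a b, |h x| ≤ C) : IntervalIntegrable h volume a b := by
  rw [intervalIntegrable_iff]
  refine Measure.integrableOn_of_bounded (M := C) (by simp [Set.uIoc]) hm.aestronglyMeasurable ?_
  exact (ae_restrict_mem measurableSet_uIoc).mono fun x hx => hC x hx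

noncomputable def LO_g (f : ℕ → ℂ) (v : ℝ) : ℝ := ‖LO_A f (Real.exp v)‖

lemma LO_g_meas (f : ℕ → ℂ) : Measurable (LO_g f) :=
  ((LO_A_meas f).comp Real.measurable_exp).norm

lemma LO_g_le {f : ℕ → ℂ} (hb : ∀ n, ‖f n‖ ≤ 1) (v : ℝ) : LO_g f v ≤ Real.exp v :=
  LO_A_le hb (Real.exp_pos v).le

lemma LO_g_nonneg (f : ℕ → ℂ) (v : ℝ) : 0 ≤ LO_g f v := norm_nonneg _

lemma LO_g_neg (f : ℕ → ℂ) {v : ℝ} (hv : v < 0) : LO_g f v = 0 := by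
  unfold LO_g; rw [LO_A_zero (by rw [← Real.exp_zero]; exact Real.exp_lt_exp.2 hv)]; simp

lemma LO_D_eq {U η v : ℝ} (hη : 0 ≤ η) (hv : 0 ≤ v) :
    ∑ d ∈ Finset.Ioc 0 ⌊Real.exp U⌋₊, (if U - η - v < Real.log d ∧ Real.log d ≤ U - v then Λ d else 0) =
      Chebyshev.psi (Real.exp (U - v)) - Chebyshev.psi (Real.exp (U - η - v)) := by
  rw [← Finset.sum_filter]
  have hle : ⌊Real.exp (U - η - v)⌋₊ ≤ ⌊Real.exp (U - v)⌋₊ :=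
    Nat.floor_mono (Real.exp_le_exp.2 (by linarith))
  have : Finset.filter (fun d : ℕ => U - η - v < Real.log d ∧ Real.log d ≤ U - v)
      (Finset.Ioc 0 ⌊Real.exp U⌋₊) = Finset.Ioc ⌊Real.exp (U - η - v)⌋₊ ⌊Real.exp (U - v)⌋₊ := by
    ext d
    simp only [Finset.mem_filter, Finset.mem_Ioc]
    rcases Nat.eq_zero_or_pos d with rfl | hd
    · simp
    have hd' : (0:ℝ) < d := by exact_mod_cast hd
    rw [Nat.floor_lt (Real.exp_pos _).le, Nat.le_floor_iff (Real.exp_pos _).le,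
      Nat.le_floor_iff (Real.exp_pos _).le, Real.lt_log_iff_exp_lt hd', Real.log_le_iff_le_exp hd']
    constructor
    · rintro ⟨_, h⟩; exact h
    · intro h
      exact ⟨⟨hd, h.2.trans (Real.exp_le_exp.2 (by linarith))⟩, h⟩
  rw [this, Chebyshev.psi, Chebyshev.psi, ← Finset.sum_Ioc_consecutive _ (Nat.zero_le _) hle]
  ring

lemma LO_halasz_avg {f : ℕ → ℂ} (hb : ∀ n, ‖f n‖ ≤ 1) (hmul : ∀ m n, f (m * n) = f m * f n)
    {U η : ℝ} (hη : 0 < η) (hU : η ≤ U) :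
    ∫ w in (U - η)..U, LO_g (fun n => f n * Real.log n) w ≤
      ∫ v in (0:ℝ)..U, LO_g f v *
        (Chebyshev.psi (Real.exp (U - v)) - Chebyshev.psi (Real.exp (U - η - v))) := by
  set N := ⌊Real.exp U⌋₊
  have hgm := LO_g_meas f
  have hpt : ∀ w, w ≤ U → LO_g (fun n => f n * Real.log n) w ≤
      ∑ d ∈ Finset.Ioc 0 N, Λ d * LO_g f (w - Real.log d) := by
    intro w hw
    unfold LO_g
    rw [LO_conv hmul]
    refine (norm_sum_le _ _).trans ?_
    refine (Finset.sum_le_sum (g := fun d : ℕ => Λ d * ‖LO_A f (Real.exp (w - Real.log d))‖) ?_).trans ?_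
    · intro d hd
      have hd0 : (0:ℝ) < d := by exact_mod_cast (Finset.mem_Ioc.1 hd).1
      rw [norm_mul, norm_mul, Complex.norm_real, Real.norm_of_nonneg vonMangoldt_nonneg,
        Real.exp_sub, Real.exp_log hd0]
      calc _ ≤ Λ d * 1 * ‖LO_A f (Real.exp w / d)‖ := by
            gcongr
            exact hb d
        _ = _ := by ring
    · refine Finset.sum_le_sum_of_subset_of_nonneg ?_ ?_
      · exact Finset.Ioc_subset_Ioc_right (Nat.floor_mono (Real.exp_le_exp.2 hw))
      · intro d _ _
        exact mul_nonneg vonMangoldt_nonneg (norm_nonneg _)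
  have hii : ∀ d : ℕ, ∀ a b : ℝ, IntervalIntegrable (fun w => Λ d * LO_g f (w - Real.log d)) volume a b := by
    intro d a b
    apply IntervalIntegrable.const_mul
    refine LO_ii_of_bdd (C := Real.exp (max a b - Real.log d)) (hgm.comp (measurable_id.sub_const _)) ?_
    intro x hx
    show |LO_g f (x - Real.log d)| ≤ _
    rw [abs_of_nonneg (LO_g_nonneg _ _)]
    refine (LO_g_le hb _).trans (Real.exp_le_exp.2 ?_)
    have := hx.2
    linarith
  have hterm : ∀ d ∈ Finset.Ioc 0 N, ∫ w in (U-η)..U, Λ d * LO_g f (w - Real.log d) ≤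
      ∫ v in Set.Icc 0 U, LO_g f v *
        (if U - η - v < Real.log d ∧ Real.log d ≤ U - v then Λ d else 0) := by
    intro d hd
    have hd1 : (1:ℝ) ≤ d := by exact_mod_cast (Finset.mem_Ioc.1 hd).1
    have hlog : 0 ≤ Real.log d := Real.log_nonneg hd1
    rw [intervalIntegral.integral_const_mul, intervalIntegral.integral_comp_sub_right (fun v => LO_g f v),
      intervalIntegral.integral_of_le (by linarith), ← integral_const_mul,
      ← integral_indicator measurableSet_Ioc, ← integral_indicator measurableSet_Icc]
    apply le_of_eq
    congr 1
    funext v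
    by_cases hv : v ∈ Set.Ioc (U - η - Real.log d) (U - Real.log d)
    · rw [Set.indicator_of_mem hv]
      by_cases hv0 : v < 0
      · rw [LO_g_neg f hv0, Set.indicator_of_notMem (by simp [hv0])]; simp
      · rw [Set.indicator_of_mem (show v ∈ Set.Icc 0 U from ⟨not_lt.1 hv0, by linarith [hv.2]⟩),
          if_pos ⟨by linarith [hv.1], by linarith [hv.2]⟩]; ring
    · rw [Set.indicator_of_notMem hv]
      have : ¬ (U - η - v < Real.log d ∧ Real.log d ≤ U - v) := by
        rintro ⟨h1, h2⟩
        exact hv ⟨by linarith, by linarith⟩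
      by_cases hv' : v ∈ Set.Icc 0 U
      · rw [Set.indicator_of_mem hv', if_neg this, mul_zero]
      · rw [Set.indicator_of_notMem hv']
  have hint2 : ∀ d ∈ Finset.Ioc 0 N, IntegrableOn (fun v => LO_g f v *
        (if U - η - v < Real.log d ∧ Real.log d ≤ U - v then Λ d else 0)) (Set.Icc 0 U) := by
    intro d _
    have hm : Measurable (fun v : ℝ => (if U - η - v < Real.log d ∧ Real.log d ≤ U - v then Λ d else 0)) := by
      refine Measurable.ite ?_ measurable_const measurable_const
      have m1 : MeasurableSet {v : ℝ | U - η - v < Real.log d} := measurableSet_lt (by fun_prop) (by fun_prop)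
      have m2 : MeasurableSet {v : ℝ | Real.log d ≤ U - v} := measurableSet_le (by fun_prop) (by fun_prop)
      exact m1.inter m2
    refine Measure.integrableOn_of_bounded (M := Real.exp U * Λ d) (by simp) (hgm.mul hm).aestronglyMeasurable ?_
    refine (ae_restrict_mem measurableSet_Icc).mono fun v hv => ?_
    rw [norm_mul, Real.norm_of_nonneg (LO_g_nonneg _ _)]
    gcongr
    · exact (LO_g_le hb v).trans (Real.exp_le_exp.2 hv.2)
    · split_ifs
      · rw [Real.norm_of_nonneg vonMangoldt_nonneg]
      · simp [vonMangoldt_nonneg]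
  have hlm := LO_g_meas (fun n => f n * Real.log n)
  calc _ ≤ ∫ w in (U - η)..U, ∑ d ∈ Finset.Ioc 0 N, Λ d * LO_g f (w - Real.log d) := by
        refine intervalIntegral.integral_mono_on (by linarith) ?_ ?_ (fun w hw => hpt w hw.2)
        · refine LO_ii_of_bdd (C := ∑ d ∈ Finset.Ioc 0 N, Λ d * Real.exp U) hlm ?_
          intro x hx
          rw [Set.uIoc_of_le (by linarith)] at hx
          rw [abs_of_nonneg (LO_g_nonneg _ _)]
          refine (hpt x hx.2).trans (Finset.sum_le_sum fun d hd => ?_)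
          have hd1 : (1:ℝ) ≤ d := by exact_mod_cast (Finset.mem_Ioc.1 hd).1
          have hlog : 0 ≤ Real.log d := Real.log_nonneg hd1
          refine mul_le_mul_of_nonneg_left ((LO_g_le hb _).trans (Real.exp_le_exp.2 ?_)) vonMangoldt_nonneg
          linarith [hx.2]
        · have := IntervalIntegrable.sum (Finset.Ioc 0 N) (f := fun (d : ℕ) w => Λ d * LO_g f (w - Real.log d))
            (μ := volume) (a := U - η) (b := U) fun d _ => hii d _ _
          have e : (fun w => ∑ d ∈ Finset.Ioc 0 N, Λ d * LO_g f (w - Real.log d)) =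
              ∑ d ∈ Finset.Ioc 0 N, fun w => Λ d * LO_g f (w - Real.log d) := by funext w; simp
          rw [e]; exact this
    _ = ∑ d ∈ Finset.Ioc 0 N, ∫ w in (U - η)..U, Λ d * LO_g f (w - Real.log d) := by
        exact intervalIntegral.integral_finsetSum (fun d _ => hii d _ _)
    _ ≤ ∑ d ∈ Finset.Ioc 0 N, ∫ v in Set.Icc 0 U, LO_g f v *
        (if U - η - v < Real.log d ∧ Real.log d ≤ U - v then Λ d else 0) := Finset.sum_le_sum hterm
    _ = ∫ v in Set.Icc 0 U, ∑ d ∈ Finset.Ioc 0 N, LO_g f v *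
        (if U - η - v < Real.log d ∧ Real.log d ≤ U - v then Λ d else 0) :=
        (integral_finsetSum _ hint2).symm
    _ = ∫ v in Set.Icc 0 U, LO_g f v *
        (Chebyshev.psi (Real.exp (U - v)) - Chebyshev.psi (Real.exp (U - η - v))) := by
        refine setIntegral_congr_fun measurableSet_Icc fun v hv => ?_
        rw [← LO_D_eq hη.le hv.1, Finset.mul_sum]
    _ = _ := by
        rw [intervalIntegral.integral_of_le (by linarith), integral_Icc_eq_integral_Ioc]

end

section
open MeasureTheory ArithmeticFunction

lemma LO_Alog_le {f : ℕ → ℂ} (hb : ∀ n, ‖f n‖ ≤ 1) {w : ℝ} (hw : 0 ≤ w) :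
    LO_g (fun n => f n * Real.log n) w ≤ Real.exp w * w := by
  unfold LO_g LO_A
  refine (norm_sum_le _ _).trans ?_
  have hfl := Nat.floor_le (Real.exp_pos w).le
  calc _ ≤ ∑ n ∈ Finset.Ioc 0 ⌊Real.exp w⌋₊, w := by
        refine Finset.sum_le_sum fun n hn => ?_
        have hn' := Finset.mem_Ioc.1 hn
        have hn1 : (1:ℝ) ≤ n := by exact_mod_cast hn'.1
        have hl := Real.log_nonneg hn1
        have : Real.log n ≤ w := by
          rw [Real.log_le_iff_le_exp (by linarith)]
          exact (Nat.cast_le.2 hn'.2).trans hfl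
        rw [norm_mul, Complex.norm_real, Real.norm_of_nonneg hl]
        nlinarith [hb n, norm_nonneg (f n)]
    _ = ⌊Real.exp w⌋₊ * w := by simp
    _ ≤ _ := by gcongr

lemma LO_g_ii {f : ℕ → ℂ} (hb : ∀ n, ‖f n‖ ≤ 1) (a b : ℝ) :
    IntervalIntegrable (fun v => LO_g f v * Real.exp (-v)) volume a b := by
  refine LO_ii_of_bdd (C := 1) ((LO_g_meas f).mul (by fun_prop)) ?_
  intro x _
  rw [Pi.mul_apply, abs_of_nonneg (mul_nonneg (LO_g_nonneg _ _) (Real.exp_pos _).le)]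
  calc _ ≤ Real.exp x * Real.exp (-x) := by gcongr; exact LO_g_le hb x
    _ = 1 := by rw [← Real.exp_add]; simp

lemma LO_halasz1 {f : ℕ → ℂ} (hb : ∀ n, ‖f n‖ ≤ 1) (hmul : ∀ m n, f (m * n) = f m * f n)
    {U σ : ℝ} (hσ : 0 < σ) (hσ1 : σ ≤ 1) (hU : 2000 / σ ^ 3 ≤ U)
    (hA : σ * Real.exp U ≤ ‖LO_A f (Real.exp U)‖) :
    σ * U / 1000 ≤ ∫ v in (0:ℝ)..U, LO_g f v * Real.exp (-v) := by
  set η := σ / 4 with hη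
  have hη0 : 0 < η := by positivity
  have hU3 : 2000 ≤ U * σ ^ 3 := by rwa [div_le_iff₀ (by positivity)] at hU
  have hU0 : 0 < U := lt_of_lt_of_le (by positivity) hU
  have hUσ2 : 2000 ≤ U * σ ^ 2 := by
    refine hU3.trans ?_
    have : σ ^ 3 ≤ σ ^ 2 := pow_le_pow_of_le_one hσ.le hσ1 (by norm_num)
    gcongr
  have hUσ : 2000 ≤ U * σ := by
    refine hUσ2.trans ?_
    have : σ ^ 2 ≤ σ := by nlinarith
    gcongr
  have hU2000 : 2000 ≤ U := by nlinarith
  have hinv : 1 / η * σ = 4 := by rw [hη]; field_simp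
  have hinv' : 1 / η ≤ U / 500 := by
    rw [hη, div_le_iff₀ (by positivity)]; nlinarith
  set V := U - η - 1 / η with hV
  have hη1 : η ≤ 1 := by linarith
  have hV0 : 0 ≤ V := by rw [hV]; linarith
  have hVU : V ≤ U := by
    have : 0 < 1 / η := by positivity
    linarith
  have hE : 0 < Real.exp U := Real.exp_pos U
  have havg := LO_halasz_avg hb hmul hη0 (by linarith : η ≤ U)
  have hm := LO_g_meas f
  -- lower bound
  have hlow : η * (Real.exp U * (σ / 2 * (U - η) - 1)) ≤
      ∫ w in (U - η)..U, LO_g (fun n => f n * Real.log n) w := by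
    have : ∫ w in (U - η)..U, (Real.exp U * (σ / 2 * (U - η) - 1)) =
      η * (Real.exp U * (σ / 2 * (U - η) - 1)) := by
      rw [intervalIntegral.integral_const, smul_eq_mul]; ring
    rw [← this]
    refine intervalIntegral.integral_mono_on (by linarith) (by simp) ?_ ?_
    · refine LO_ii_of_bdd (C := Real.exp U * U) (LO_g_meas _) ?_
      intro x hx
      rw [Set.uIoc_of_le (by linarith)] at hx
      have hx0 : 0 ≤ x := by linarith [hx.1]
      rw [abs_of_nonneg (LO_g_nonneg _ _)]
      refine (LO_Alog_le hb hx0).trans ?_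
      have := Real.exp_le_exp.2 hx.2
      gcongr
      exact hx.2
    · intro w hw
      have hw0 : 0 ≤ w := by linarith [hw.1]
      have h1 := LO_A_log hb (y := Real.exp w) (Real.one_le_exp hw0)
      rw [Real.log_exp] at h1
      have h2 := LO_A_sub hb (y := Real.exp w) (z := Real.exp U) (Real.exp_pos w).le (Real.exp_le_exp.2 hw.2)
      have h3 : Real.exp U * (1 - η) ≤ Real.exp w := by
        have a1 : 1 - η ≤ Real.exp (-η) := by linarith [Real.add_one_le_exp (-η)]
        calc _ ≤ Real.exp U * Real.exp (-η) := by gcongr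
          _ = Real.exp (U - η) := by rw [← Real.exp_add]; ring_nf
          _ ≤ _ := Real.exp_le_exp.2 hw.1
      have h4 : 1 ≤ σ / 4 * Real.exp U := by
        have := Real.add_one_le_exp U
        nlinarith
      have h5 : σ / 2 * Real.exp U ≤ ‖LO_A f (Real.exp w)‖ := by
        nlinarith
      have h6 : Real.exp w ≤ Real.exp U := Real.exp_le_exp.2 hw.2
      have h7 : σ / 2 * Real.exp U * (U - η) ≤ ‖LO_A f (Real.exp w)‖ * w := by
        apply mul_le_mul h5 hw.1 (by linarith) (norm_nonneg _)
      unfold LO_g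
      linarith
  -- upper bound
  set D : ℝ → ℝ := fun v => Chebyshev.psi (Real.exp (U - v)) - Chebyshev.psi (Real.exp (U - η - v)) with hD
  have hDm : Measurable D := by
    have : Measurable Chebyshev.psi := Chebyshev.psi_mono.measurable
    exact (this.comp (by fun_prop)).sub (this.comp (by fun_prop))
  have hD0 : ∀ v, 0 ≤ D v := fun v => sub_nonneg.2 (Chebyshev.psi_mono (Real.exp_le_exp.2 (by linarith)))
  have hD6 : ∀ v, D v ≤ 6 * Real.exp (U - v) := by
    intro v
    have := LO_psi_le (Real.exp_pos (U - v)).le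
    have := Chebyshev.psi_nonneg (Real.exp (U - η - v))
    simp only [hD]; linarith
  have hDV : ∀ v, v ≤ V → D v ≤ 406 * η * Real.exp (U - v) := by
    intro v hv
    have hlog : 1 / η ≤ U - η - v := by linarith
    have h1 : 1 ≤ 1 / η := by rw [le_div_iff₀ hη0]; linarith
    have he1 : 2 ≤ Real.exp (U - η - v) := by linarith [Real.add_one_le_exp (U - η - v)]
    have he : Real.exp (U - η - v) = Real.exp (U - v) * Real.exp (-η) := by
      rw [← Real.exp_add]; ring_nf
    have heη : Real.exp η ≤ 3 := by
      have := Real.exp_le_exp.2 hη1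
      linarith [Real.exp_one_lt_d9]
    have he2 : Real.exp (U - v) = Real.exp η * Real.exp (U - η - v) := by
      rw [← Real.exp_add]; ring_nf
    have hbt := LO_BT (y := Real.exp (U - η - v)) (y' := Real.exp (U - v)) he1
      (Real.exp_le_exp.2 (by linarith)) (by rw [he2]; gcongr)
    rw [Real.log_exp] at hbt
    have a1 : 1 - η ≤ Real.exp (-η) := by linarith [Real.add_one_le_exp (-η)]
    have a2 : Real.exp (U - v) - Real.exp (U - η - v) ≤ η * Real.exp (U - v) := by
      rw [he]; nlinarith [Real.exp_pos (U - v)]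
    have a3 : 400 * Real.exp (U - η - v) / (U - η - v) ≤ 400 * η * Real.exp (U - v) := by
      rw [div_le_iff₀ (by linarith)]
      have b1 : 1 ≤ η * (U - η - v) := by
        rw [div_le_iff₀ hη0] at hlog; linarith
      have b2 : Real.exp (U - η - v) ≤ Real.exp (U - v) := Real.exp_le_exp.2 (by linarith)
      nlinarith [Real.exp_pos (U - v)]
    simp only [hD]
    linarith
  have hiiD : ∀ a b : ℝ, IntervalIntegrable (fun v => LO_g f v * D v) volume a b := by
    intro a b
    refine LO_ii_of_bdd (C := 6 * Real.exp U) (hm.mul hDm) ?_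
    intro x _
    rw [Pi.mul_apply, abs_of_nonneg (mul_nonneg (LO_g_nonneg _ _) (hD0 x))]
    calc _ ≤ Real.exp x * (6 * Real.exp (U - x)) :=
          mul_le_mul (LO_g_le hb x) (hD6 x) (hD0 x) (Real.exp_pos x).le
      _ = 6 * (Real.exp x * Real.exp (U - x)) := by ring
      _ = _ := by rw [← Real.exp_add]; ring_nf
  set I := ∫ v in (0:ℝ)..U, LO_g f v * Real.exp (-v)
  have hup : ∫ v in (0:ℝ)..U, LO_g f v * D v ≤ 406 * η * Real.exp U * I + 6 * Real.exp U * (η + 1 / η) := by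
    rw [← intervalIntegral.integral_add_adjacent_intervals (hiiD 0 V) (hiiD V U)]
    have u1 : ∫ v in (0:ℝ)..V, LO_g f v * D v ≤ 406 * η * Real.exp U * I := by
      calc _ ≤ ∫ v in (0:ℝ)..V, 406 * η * Real.exp U * (LO_g f v * Real.exp (-v)) := by
            refine intervalIntegral.integral_mono_on hV0 (hiiD _ _) ((LO_g_ii hb _ _).const_mul _) ?_
            intro v hv
            calc _ ≤ LO_g f v * (406 * η * Real.exp (U - v)) :=
                  mul_le_mul_of_nonneg_left (hDV v hv.2) (LO_g_nonneg _ _)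
              _ = _ := by rw [sub_eq_add_neg, Real.exp_add]; ring
        _ = 406 * η * Real.exp U * ∫ v in (0:ℝ)..V, LO_g f v * Real.exp (-v) :=
            intervalIntegral.integral_const_mul _ _
        _ ≤ _ := by
            gcongr
            refine intervalIntegral.integral_mono_interval le_rfl hV0 hVU ?_ (LO_g_ii hb _ _)
            exact Filter.Eventually.of_forall fun v => mul_nonneg (LO_g_nonneg _ _) (Real.exp_pos _).le
    have u2 : ∫ v in V..U, LO_g f v * D v ≤ 6 * Real.exp U * (η + 1 / η) := by
      have : ∫ v in V..U, 6 * Real.exp U = 6 * Real.exp U * (η + 1 / η) := by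
        rw [intervalIntegral.integral_const, smul_eq_mul, hV]; ring
      rw [← this]
      refine intervalIntegral.integral_mono_on hVU (hiiD _ _) (by simp) ?_
      intro x _
      calc _ ≤ Real.exp x * (6 * Real.exp (U - x)) :=
            mul_le_mul (LO_g_le hb x) (hD6 x) (hD0 x) (Real.exp_pos x).le
        _ = 6 * (Real.exp x * Real.exp (U - x)) := by ring
        _ = _ := by rw [← Real.exp_add]; ring_nf
    linarith
  have hfin := (hlow.trans havg).trans hup
  have hfin2 : η * (σ / 2 * (U - η) - 1) ≤ 406 * η * I + 6 * (η + 1 / η) := by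
    by_contra hcon
    push Not at hcon
    have := mul_lt_mul_of_pos_left hcon hE
    linarith
  have hfin3 : σ / 2 * (U - η) - 1 ≤ 406 * I + 6 * (1 + (1 / η) * (1 / η)) := by
    by_contra hcon
    push Not at hcon
    have := mul_lt_mul_of_pos_left hcon hη0
    have e : η * (1 / η * (1 / η)) = 1 / η := by field_simp
    linarith
  have hη2 : (1 / η) * (1 / η) ≤ σ * U / 125 := by
    have e : (1 / η) * (1 / η) = 16 / σ ^ 2 := by rw [hη]; field_simp; ring
    rw [e, div_le_iff₀ (by positivity)]
    nlinarith
  nlinarith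

end

section
open MeasureTheory ArithmeticFunction

lemma LO_zeta_part {κ : ℝ} (hκ : 0 < κ) (N : ℕ) :
    ∑ n ∈ Finset.range (N + 1), (n : ℝ) ^ (-(1 + κ)) ≤ 1 + 1 / κ - (if N = 0 then 0 else (N:ℝ) ^ (-κ) / κ) := by
  induction N with
  | zero =>
    simp
    rw [Real.zero_rpow (by linarith)]; positivity
  | succ n ih =>
    rw [Finset.sum_range_succ]
    rcases Nat.eq_zero_or_pos n with rfl | hn
    · simp
      rw [Real.zero_rpow (by linarith)]
    have hn0 : (0:ℝ) < n := by exact_mod_cast hn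
    rw [if_neg hn.ne'] at ih
    rw [if_neg (by omega)]
    have hs : (0:ℝ) < ((n + 1 : ℕ) : ℝ) := by positivity
    set m : ℝ := ((n + 1 : ℕ) : ℝ) with hm
    have hmn : (n:ℝ) = m - 1 := by rw [hm]; push_cast; ring
    have key : m ^ (-κ) * (1 + κ / m) ≤ (n:ℝ) ^ (-κ) := by
      have e1 : (n:ℝ) ^ (-κ) = m ^ (-κ) * ((n:ℝ) / m) ^ (-κ) := by
        rw [← Real.mul_rpow (by positivity) (by positivity)]; congr 1; field_simp
      rw [e1]
      gcongr
      rw [Real.rpow_def_of_pos (by positivity)]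
      have h1 := Real.log_le_sub_one_of_pos (x := (n:ℝ) / m) (by positivity)
      have h2 := Real.add_one_le_exp (Real.log ((n:ℝ) / m) * -κ)
      have h3 : (n:ℝ) / m - 1 = - (1 / m) := by rw [hmn]; field_simp; ring
      rw [h3] at h1
      have h4 : κ / m = κ * (1 / m) := by ring
      rw [h4]
      nlinarith
    have e2 : m ^ (-(1 + κ)) = m ^ (-κ) / m := by
      rw [show -(1 + κ) = -κ - 1 by ring, Real.rpow_sub_one hs.ne']
    rw [e2]
    have e3 : m ^ (-κ) / m + m ^ (-κ) / κ = m ^ (-κ) * (1 + κ / m) / κ := by field_simp; ring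
    have : m ^ (-κ) * (1 + κ / m) / κ ≤ (n:ℝ) ^ (-κ) / κ := by gcongr
    linarith

lemma LO_zeta_tsum {κ : ℝ} (hκ : 0 < κ) : Summable (fun n : ℕ => (n:ℝ) ^ (-(1 + κ))) ∧
    ∑' n : ℕ, (n:ℝ) ^ (-(1 + κ)) ≤ 1 + 1 / κ := by
  have h0 : ∀ n : ℕ, 0 ≤ (n:ℝ) ^ (-(1 + κ)) := fun n => by positivity
  refine ⟨Real.summable_nat_rpow.2 (by linarith), Real.tsum_le_of_sum_range_le h0 fun N => ?_⟩
  have h1 : ∑ n ∈ Finset.range N, (n:ℝ) ^ (-(1 + κ)) ≤ ∑ n ∈ Finset.range (N+1), (n:ℝ) ^ (-(1 + κ)) := by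
    rw [Finset.sum_range_succ]; linarith [h0 N]
  refine h1.trans ((LO_zeta_part hκ N).trans ?_)
  split_ifs
  · simp
  · have : 0 ≤ (N:ℝ) ^ (-κ) / κ := by positivity
    linarith

lemma LO_LS_bound {a : ℕ → ℂ} {M β κ : ℝ} (hM : 0 ≤ M) (hβ : β < κ)
    (ha : ∀ n : ℕ, 1 ≤ n → ‖a n‖ ≤ M * (n:ℝ) ^ β) {s : ℂ} (hs : s.re = 1 + κ) :
    LSeriesSummable a s ∧ ‖LSeries a s‖ ≤ M * (1 + 1 / (κ - β)) := by
  have hz := LO_zeta_tsum (κ := κ - β) (by linarith)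
  have hb : ∀ n : ℕ, ‖LSeries.term a s n‖ ≤ M * (n:ℝ) ^ (-(1 + (κ - β))) := by
    intro n
    rcases Nat.eq_zero_or_pos n with rfl | hn
    · rw [LSeries.term_zero, norm_zero]; positivity
    have hn0 : (0:ℝ) < n := by exact_mod_cast hn
    rw [LSeries.norm_term_eq, if_neg hn.ne', hs, div_le_iff₀ (by positivity), mul_assoc,
      ← Real.rpow_add hn0]
    rw [show -(1 + (κ - β)) + (1 + κ) = β by ring]; exact ha n hn
  have hsum : Summable (fun n : ℕ => M * (n:ℝ) ^ (-(1 + (κ - β)))) := hz.1.mul_left M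
  have hsn : Summable (fun n => ‖LSeries.term a s n‖) :=
    Summable.of_nonneg_of_le (fun _ => norm_nonneg _) hb hsum
  refine ⟨hsn.of_norm, ?_⟩
  calc _ ≤ ∑' n, ‖LSeries.term a s n‖ := norm_tsum_le_tsum_norm hsn
    _ ≤ ∑' n : ℕ, M * (n:ℝ) ^ (-(1 + (κ - β))) := hsn.tsum_le_tsum hb hsum
    _ = M * ∑' n : ℕ, (n:ℝ) ^ (-(1 + (κ - β))) := tsum_mul_left
    _ ≤ _ := by gcongr; exact hz.2

lemma LO_halasz2 {f : ℕ → ℂ} (hb : ∀ n, ‖f n‖ ≤ 1) (hmul : ∀ m n, f (m * n) = f m * f n)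
    {U σ : ℝ} (hσ : 0 < σ) (hσ1 : σ ≤ 1) (hU : 10 ^ 7 / σ ^ 3 ≤ U)
    (hA : σ * Real.exp U ≤ ‖LO_A f (Real.exp U)‖) :
    (σ * U / 1000) ^ 4 / (64 * U) ≤ 
      ∫ u in (0:ℝ)..U, (LO_g (fun n => f n * Real.log n) u * Real.exp (-u)) ^ 2 := by
  have hI := LO_halasz1 hb hmul hσ hσ1 (le_trans (by gcongr; norm_num) hU) hA
  set m := σ * U / 1000 with hm
  have hU3 : 10 ^ 7 ≤ U * σ ^ 3 := by rwa [div_le_iff₀ (by positivity)] at hU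
  have hU0 : 0 < U := lt_of_lt_of_le (by positivity) hU
  have hUσ2 : 10 ^ 7 ≤ U * σ ^ 2 := by
    refine hU3.trans ?_
    have : σ ^ 3 ≤ σ ^ 2 := pow_le_pow_of_le_one hσ.le hσ1 (by norm_num)
    gcongr
  have hm0 : 0 < m := by positivity
  have hmU : m ≤ U := by rw [hm]; nlinarith
  have hm2 : 8 * U ≤ m ^ 2 := by
    rw [hm]; nlinarith
  set h : ℝ → ℝ := fun u => LO_g (fun n => f n * Real.log n) u * Real.exp (-u) with hh
  have hhm : Measurable h := (LO_g_meas _).mul (by fun_prop)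
  have hh0 : ∀ u, 0 ≤ h u := fun u => mul_nonneg (LO_g_nonneg _ _) (Real.exp_pos _).le
  have hhU : ∀ u, 0 ≤ u → h u ≤ u := by
    intro u hu
    calc _ ≤ Real.exp u * u * Real.exp (-u) := by
          simp only [hh]; gcongr; exact LO_Alog_le hb hu
      _ = u * (Real.exp u * Real.exp (-u)) := by ring
      _ = u := by rw [← Real.exp_add]; simp
  have hih : IntervalIntegrable h volume 0 U := by
    refine LO_ii_of_bdd (C := U) hhm ?_
    intro x hx
    rw [Set.uIoc_of_le hU0.le] at hx
    rw [abs_of_nonneg (hh0 x)]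
    exact (hhU x hx.1.le).trans hx.2
  have hih2 : IntervalIntegrable (fun u => h u ^ 2) volume 0 U := by
    refine LO_ii_of_bdd (C := U ^ 2) (hhm.pow_const 2) ?_
    intro x hx
    rw [Set.uIoc_of_le hU0.le] at hx
    rw [abs_of_nonneg (by positivity)]
    have := (hhU x hx.1.le).trans hx.2
    have := hh0 x
    gcongr
  set M : ℝ → ℝ := fun u => LO_g f u * Real.exp (-u) with hMdef
  have hM0 : ∀ u, 0 ≤ M u := fun u => mul_nonneg (LO_g_nonneg _ _) (Real.exp_pos _).le
  have hM1 : ∀ u, M u ≤ 1 := by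
    intro u
    calc _ ≤ Real.exp u * Real.exp (-u) := by simp only [hMdef]; gcongr; exact LO_g_le hb u
      _ = 1 := by rw [← Real.exp_add]; simp
  have hMii := LO_g_ii hb
  have hMu : ∀ a b : ℝ, IntervalIntegrable (fun u => (u - m / 2) * M u) volume a b := by
    intro a b
    exact (hMii a b).continuousOn_mul (by fun_prop)
  have hpt : ∀ u, 0 ≤ u → u * M u - 1 ≤ h u := by
    intro u hu
    have h1 := LO_A_log hb (y := Real.exp u) (Real.one_le_exp hu)
    rw [Real.log_exp] at h1
    have h2 := mul_le_mul_of_nonneg_right h1 (Real.exp_pos (-u)).le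
    have e : Real.exp u * Real.exp (-u) = 1 := by rw [← Real.exp_add]; simp
    rw [add_mul, e] at h2
    simp only [hMdef, hh, LO_g]
    linarith
  have hneg : -(m / 2) * (m / 2) ≤ ∫ u in (0:ℝ)..U, (u - m / 2) * M u := by
    rw [← intervalIntegral.integral_add_adjacent_intervals (hMu 0 (m/2)) (hMu (m/2) U)]
    have u1 : -(m / 2) * (m / 2) ≤ ∫ u in (0:ℝ)..(m/2), (u - m / 2) * M u := by
      have : ∫ u in (0:ℝ)..(m/2), (-(m / 2)) = -(m / 2) * (m / 2) := by
        rw [intervalIntegral.integral_const, smul_eq_mul]; ring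
      rw [← this]
      refine intervalIntegral.integral_mono_on (by positivity) (by simp) (hMu _ _) ?_
      intro u hu
      nlinarith [hM0 u, hM1 u, hu.1, hu.2]
    have u2 : 0 ≤ ∫ u in (m/2)..U, (u - m / 2) * M u := by
      refine intervalIntegral.integral_nonneg (by linarith) ?_
      intro u hu
      exact mul_nonneg (by linarith [hu.1]) (hM0 u)
    linarith
  have hH : m ^ 2 / 8 ≤ ∫ u in (0:ℝ)..U, h u := by
    have h1 : ∫ u in (0:ℝ)..U, ((u - m / 2) * M u + (m / 2) * M u - 1) ≤ ∫ u in (0:ℝ)..U, h u := by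
      refine intervalIntegral.integral_mono_on hU0.le ?_ hih ?_
      · exact ((hMu _ _).add ((hMii _ _).const_mul _)).sub (by simp)
      · intro u hu
        have := hpt u hu.1
        linarith
    rw [intervalIntegral.integral_sub ((hMu _ _).add ((hMii _ _).const_mul _)) (by simp),
      intervalIntegral.integral_add (hMu _ _) ((hMii _ _).const_mul _),
      intervalIntegral.integral_const_mul, intervalIntegral.integral_const, smul_eq_mul] at h1
    nlinarith
  set l := m ^ 2 / 8 / U with hl
  have hl0 : 0 ≤ l := by positivity
  have hcs : ∫ u in (0:ℝ)..U, (2 * l * h u - l ^ 2) ≤ ∫ u in (0:ℝ)..U, h u ^ 2 := by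
    refine intervalIntegral.integral_mono_on hU0.le ((hih.const_mul _).sub (by simp)) hih2 ?_
    intro u _
    nlinarith [sq_nonneg (h u - l)]
  rw [intervalIntegral.integral_sub (hih.const_mul _) (by simp), intervalIntegral.integral_const_mul,
    intervalIntegral.integral_const, smul_eq_mul] at hcs
  refine le_trans ?_ hcs
  have e : m ^ 4 / (64 * U) = 2 * l * (m ^ 2 / 8) - U * l ^ 2 := by
    rw [hl]; field_simp; ring
  rw [e]
  have := mul_le_mul_of_nonneg_left hH (by positivity : 0 ≤ 2 * l)
  linarith

end

section
open MeasureTheory ArithmeticFunction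

lemma LO_factor {q : ℕ} (χ : DirichletCharacter ℂ q) {s : ℂ} (hs : 1 < s.re) :
    LSeries (fun n : ℕ => χ n * (Real.log n : ℂ)) s =
      LSeries (fun n : ℕ => χ n * (vonMangoldt n : ℂ)) s * LSeries (fun n : ℕ => χ n) s := by
  have h := DirichletCharacter.convolution_twist_vonMangoldt χ
  have h1 := LSeries_convolution' (DirichletCharacter.LSeriesSummable_twist_vonMangoldt χ hs) 
    (DirichletCharacter.LSeriesSummable_of_one_lt_re χ hs)
  rw [h] at h1
  have e1 : (fun n : ℕ => χ n * (Real.log n : ℂ)) = ((fun n : ℕ => χ n) * (fun n : ℕ => Complex.log n)) := by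
    ext n; simp [Complex.natCast_log]
  have e2 : (fun n : ℕ => χ n * (vonMangoldt n : ℂ)) = ((fun n : ℕ => χ n) * (fun n : ℕ => (vonMangoldt n : ℂ))) := by
    ext n; simp
  rw [e1, e2]; exact h1

lemma LO_cauchy {T : ℝ} (hT : 0 < T) : Integrable (fun t : ℝ => (T^2 + t^2)⁻¹) ∧
    ∫ t : ℝ, (T^2 + t^2)⁻¹ = Real.pi / T := by
  have e : (fun t : ℝ => (T^2 + t^2)⁻¹) = fun t : ℝ => (T^2)⁻¹ * (1 + (t/T)^2)⁻¹ := by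
    ext t; rw [← mul_inv]; congr 1; field_simp
  rw [e]
  constructor
  · exact (integrable_inv_one_add_sq.comp_div hT.ne').const_mul _
  · rw [integral_const_mul, Measure.integral_comp_div (fun t : ℝ => (1 + t^2)⁻¹) T,
      integral_univ_inv_one_add_sq, abs_of_pos hT, smul_eq_mul]
    field_simp

set_option maxHeartbeats 1600000 in
lemma LO_halasz {q : ℕ} (χ : DirichletCharacter ℂ q)
    {U σ : ℝ} (hσ : 0 < σ) (hσ1 : σ ≤ 1) (hU : 10 ^ 7 / σ ^ 3 ≤ U)
    (hA : σ * Real.exp U ≤ ‖LO_A (fun n => χ n) (Real.exp U)‖) :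
    ∃ t : ℝ, |t| ≤ 10^17 * U / σ^4 ∧ 
      σ^2 * U / 10^9 ≤ ‖LSeries (fun n : ℕ => χ n) (1 + (1/U : ℝ) + t * Complex.I)‖ := by
  have h2 := LO_halasz2 (f := fun n => χ n) (fun n => χ.norm_le_one _) (by intro m n; simp) hσ hσ1 hU hA
  have hU1 : 10^7 ≤ U := by
    refine le_trans ?_ hU
    rw [le_div_iff₀ (by positivity)]
    have : σ^3 ≤ 1 := pow_le_one₀ hσ.le hσ1
    nlinarith
  have hU0 : 0 < U := by linarith
  set κ : ℝ := 1/U with hκ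
  have hκ0 : 0 < κ := by positivity
  have hκU : κ * U = 1 := by rw [hκ]; field_simp
  by_contra! hcon
  set T := 10^17 * U / σ^4 with hT
  have hT0 : 0 < T := by positivity
  set a : ℕ → ℂ := fun n : ℕ => χ n * (Real.log n : ℂ) with ha
  set b : ℕ → ℂ := fun n : ℕ => χ n * (vonMangoldt n : ℂ) with hb
  have hlog : ∀ n : ℕ, 1 ≤ n → ‖a n‖ ≤ 2 * U * (n:ℝ)^(κ/2) := by
    intro n hn
    have h1 : (1:ℝ) ≤ n := by exact_mod_cast hn
    have h0 : 0 ≤ Real.log n := Real.log_nonneg h1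
    have h3 := Real.log_le_rpow_div (x := (n:ℝ)) (ε := κ/2) (by positivity) (by positivity)
    have h4 : (n:ℝ)^(κ/2) / (κ/2) = 2 * U * (n:ℝ)^(κ/2) := by
      rw [hκ]; field_simp
    rw [ha]; simp only [norm_mul, Complex.norm_real, Real.norm_eq_abs, abs_of_nonneg h0]
    have := χ.norm_le_one (n : ZMod q)
    nlinarith
  have pa := LO_planch_L a (κ := κ) (r := 1 + κ/2) (M := 2 * U) (by positivity) (by linarith) (by
    intro n hn
    have h1 : (0:ℝ) < n := by exact_mod_cast hn
    calc ∑ k ∈ Finset.Icc 1 n, ‖a k‖ ≤ ∑ k ∈ Finset.Icc 1 n, 2 * U * (n:ℝ)^(κ/2) := by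
          refine Finset.sum_le_sum fun k hk => ?_
          rw [Finset.mem_Icc] at hk
          refine (hlog k hk.1).trans ?_
          have : (k:ℝ) ≤ n := by exact_mod_cast hk.2
          gcongr
      _ = 2 * U * (n:ℝ)^(1+κ/2) := by
          rw [Finset.sum_const, Nat.card_Icc, nsmul_eq_mul, Real.rpow_add h1, Real.rpow_one]
          simp; ring)
  have hpsi : ∀ n : ℕ, ∑ k ∈ Finset.Icc 1 n, ‖b k‖ ≤ 6 * (n:ℝ) := by
    intro n
    have := LO_psi_le (x := (n:ℝ)) (by positivity)
    refine le_trans ?_ this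
    rw [Chebyshev.psi, Nat.floor_natCast]
    have : Finset.Icc 1 n = Finset.Ioc 0 n := rfl
    rw [this]
    refine Finset.sum_le_sum fun k hk => ?_
    rw [hb]; simp only [norm_mul, Complex.norm_real, Real.norm_eq_abs, abs_of_nonneg vonMangoldt_nonneg]
    exact mul_le_of_le_one_left vonMangoldt_nonneg (χ.norm_le_one _)
  have pb := LO_planch_L b (κ := κ) (r := 1) (M := 6) (by positivity) (by linarith) (by
    intro n hn; rw [Real.rpow_one]; exact hpsi n)
  obtain ⟨pai, pae, pau⟩ := pa
  obtain ⟨pbi, pbe, pbu⟩ := pb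
  -- upper bound for b
  have ub : ∫ u in Set.Ioi (0:ℝ), ‖∑ k ∈ Finset.Icc 1 ⌊Real.exp u⌋₊, b k‖ ^ 2 * Real.exp (-(2 * (1 + κ)) * u) ≤ 18 * U := by
    have hintg : IntegrableOn (fun u : ℝ => 36 * Real.exp (-(2*κ) * u)) (Set.Ioi 0) :=
      (exp_neg_integrableOn_Ioi 0 (by positivity)).const_mul 36
    refine (setIntegral_mono_on pbu hintg measurableSet_Ioi ?_).trans ?_
    · intro u hu
      have h1 : ‖∑ k ∈ Finset.Icc 1 ⌊Real.exp u⌋₊, b k‖ ≤ 6 * Real.exp u := by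
        refine (norm_sum_le _ _).trans ((hpsi _).trans ?_)
        gcongr; exact Nat.floor_le (Real.exp_pos _).le
      have h3 : 36 * Real.exp (-(2*κ)*u) = (6 * Real.exp u)^2 * Real.exp (-(2 * (1 + κ)) * u) := by
        rw [mul_pow, ← Real.exp_nat_mul, mul_assoc, ← Real.exp_add]; norm_num; ring
      rw [h3]; gcongr
    · rw [integral_const_mul, integral_exp_mul_Ioi (by linarith : -(2*κ) < 0)]
      simp only [mul_zero, Real.exp_zero]
      rw [hκ]; field_simp; norm_num
  -- lower bound for a
  have lb : σ^4 * U^3 / (512 * 10^12) ≤ ∫ u in Set.Ioi (0:ℝ), ‖∑ k ∈ Finset.Icc 1 ⌊Real.exp u⌋₊, a k‖ ^ 2 * Real.exp (-(2 * (1 + κ)) * u) := by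
    have hg : ∀ u : ℝ, LO_g (fun n => χ n * (Real.log n : ℂ)) u = ‖∑ k ∈ Finset.Icc 1 ⌊Real.exp u⌋₊, a k‖ := fun u => rfl
    have h1 : ∫ u in Set.Ioc (0:ℝ) U, ‖∑ k ∈ Finset.Icc 1 ⌊Real.exp u⌋₊, a k‖ ^ 2 * Real.exp (-(2 * (1 + κ)) * u) ≤ ∫ u in Set.Ioi (0:ℝ), ‖∑ k ∈ Finset.Icc 1 ⌊Real.exp u⌋₊, a k‖ ^ 2 * Real.exp (-(2 * (1 + κ)) * u) := by
      refine setIntegral_mono_set pau ?_ ?_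
      · filter_upwards with u; positivity
      · exact (Set.Ioc_subset_Ioi_self).eventuallyLE
    refine le_trans ?_ h1
    have hpau : IntegrableOn (fun u => ‖∑ k ∈ Finset.Icc 1 ⌊Real.exp u⌋₊, a k‖ ^ 2 * Real.exp (-(2 * (1 + κ)) * u)) (Set.Ioc 0 U) := pau.mono_set Set.Ioc_subset_Ioi_self
    have e8 : Real.exp 2 ≤ 8 := by
      have : Real.exp 2 = Real.exp 1 ^ 2 := by rw [← Real.exp_nat_mul]; norm_num
      rw [this]; have := Real.exp_one_lt_d9; have := Real.exp_pos 1; nlinarith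
    have h4 : ∫ u in Set.Ioc (0:ℝ) U, (LO_g (fun n => χ n * (Real.log n : ℂ)) u * Real.exp (-u)) ^ 2 ≤ 
       ∫ u in Set.Ioc (0:ℝ) U, 8 * (‖∑ k ∈ Finset.Icc 1 ⌊Real.exp u⌋₊, a k‖ ^ 2 * Real.exp (-(2 * (1 + κ)) * u)) := by
      refine integral_mono_of_nonneg ?_ (hpau.const_mul 8) ?_
      · filter_upwards with u; positivity
      · filter_upwards [ae_restrict_mem measurableSet_Ioc] with u hu
        rw [hg]
        have : (Real.exp (-u))^2 ≤ 8 * Real.exp (-(2 * (1 + κ)) * u) := by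
          have h5 : (Real.exp (-u))^2 = Real.exp (2 * (κ * u)) * Real.exp (-(2 * (1 + κ)) * u) := by
            rw [← Real.exp_nat_mul, ← Real.exp_add]; congr 1; push_cast; ring
          rw [h5]; gcongr
          refine le_trans (Real.exp_le_exp.2 ?_) e8
          have : κ * u ≤ κ * U := by have := hu.2; gcongr
          linarith
        calc _ = ‖∑ k ∈ Finset.Icc 1 ⌊Real.exp u⌋₊, a k‖ ^ 2 * (Real.exp (-u))^2 := by ring
          _ ≤ ‖∑ k ∈ Finset.Icc 1 ⌊Real.exp u⌋₊, a k‖ ^ 2 * (8 * Real.exp (-(2 * (1 + κ)) * u)) := by gcongr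
          _ = _ := by ring
    rw [integral_const_mul] at h4
    rw [intervalIntegral.integral_of_le hU0.le] at h2
    have h5 : (σ * U / 1000) ^ 4 / (64 * U) = 8 * (σ^4 * U^3 / (512 * 10^12)) := by field_simp; norm_num
    rw [h5] at h2
    linarith
  -- comparison
  obtain ⟨ci, ce⟩ := LO_cauchy hT0
  set B := σ^2 * U / 10^9 with hB
  have hB0 : 0 < B := by positivity
  have hcmp : ∫ t : ℝ, ‖LSeries a (1 + κ + t * Complex.I) / (1 + κ + t * Complex.I)‖ ^ 2 ≤
      ∫ t : ℝ, (B^2 * ‖LSeries b (1 + κ + t * Complex.I) / (1 + κ + t * Complex.I)‖ ^ 2 + 72 * U^4 * (T^2 + t^2)⁻¹) := by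
    refine integral_mono pai ((pbi.const_mul _).add (ci.const_mul _)) ?_
    intro t
    dsimp only
    set s : ℂ := 1 + κ + t * Complex.I with hs
    have hre : s.re = 1 + κ := by simp [hs]
    have him : s.im = t := by simp [hs]
    by_cases ht : |t| ≤ T
    · have h3 := hcon t ht
      rw [LO_factor χ (by rw [hre]; linarith)]
      have h6 : ‖LSeries b s * LSeries (fun n : ℕ => χ n) s / s‖ = ‖LSeries (fun n : ℕ => χ n) s‖ * ‖LSeries b s / s‖ := by
        rw [← norm_mul]; congr 1; ring
      rw [h6, mul_pow]
      have : 0 ≤ 72 * U^4 * (T^2 + t^2)⁻¹ := by positivity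
      have h7 : ‖LSeries (fun n : ℕ => χ n) s‖^2 ≤ B^2 := by gcongr
      nlinarith [sq_nonneg ‖LSeries b s / s‖]
    · push Not at ht
      have h3 := (LO_LS_bound (a := a) (M := 2*U) (β := κ/2) (κ := κ) (by positivity) (by linarith) hlog hre).2
      have h4 : 2 * U * (1 + 1/(κ - κ/2)) ≤ 6 * U^2 := by
        have : 1/(κ - κ/2) = 2 * U := by rw [hκ]; field_simp; norm_num
        rw [this]; nlinarith
      have h5 : ‖LSeries a s‖^2 ≤ 36 * U^4 := by
        calc _ ≤ (6*U^2)^2 := by gcongr; linarith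
          _ = _ := by ring
      have hns : t^2 ≤ ‖s‖^2 := by
        rw [← Complex.normSq_eq_norm_sq, Complex.normSq_apply, hre, him]; nlinarith
      have hTt : T^2 < t^2 := by rw [← sq_abs t]; gcongr
      have ht0 : 0 < t^2 := by nlinarith
      have h6 : ‖LSeries a s / s‖^2 ≤ 72 * U^4 * (T^2 + t^2)⁻¹ := by
        rw [norm_div, div_pow]
        calc _ ≤ 36 * U^4 / t^2 := by gcongr
          _ ≤ _ := by
            rw [← div_eq_mul_inv, div_le_div_iff₀ ht0 (by positivity)]
            nlinarith [pow_pos hU0 4]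
      have : 0 ≤ B^2 * ‖LSeries b s / s‖^2 := by positivity
      linarith
  rw [integral_add (pbi.const_mul _) (ci.const_mul _), integral_const_mul, integral_const_mul, ce, pae, pbe] at hcmp
  have hpi := Real.pi_pos
  have f1 : 2 * Real.pi * (σ^4 * U^3 / (512 * 10^12)) ≤ B^2 * (2 * Real.pi * (18 * U)) + 72 * U^4 * (Real.pi / T) := by
    refine le_trans ?_ (hcmp.trans ?_)
    · gcongr
    · gcongr
  have f2 : B^2 * (2 * Real.pi * (18 * U)) + 72 * U^4 * (Real.pi / T) = Real.pi * (σ^4 * U^3) * (36/10^18 + 72/10^17) := by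
    rw [hB, hT]; field_simp; norm_num
  rw [f2] at f1
  have : 0 < Real.pi * (σ^4 * U^3) := by positivity
  have f3 : 2 * Real.pi * (σ^4 * U^3 / (512 * 10^12)) = Real.pi * (σ^4 * U^3) * (2 / (512 * 10^12)) := by ring
  rw [f3] at f1
  have := le_of_mul_le_mul_left f1 this
  norm_num at this

end

section
noncomputable def LO_w (κ : ℝ) (p : ℕ) : ℝ := (p:ℝ) ^ (-(1 + κ))

noncomputable def LO_V (κ : ℝ) (f : ℕ → ℂ) (t : ℝ) : ℝ :=
  ∑' p : Nat.Primes, LO_w κ p * ‖f p - ((p:ℕ):ℂ) ^ (t * Complex.I)‖ ^ 2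

lemma LO_w_nonneg (κ : ℝ) (p : ℕ) : 0 ≤ LO_w κ p := by unfold LO_w; positivity

lemma LO_w_summable {κ : ℝ} (hκ : 0 < κ) : Summable (fun p : Nat.Primes => LO_w κ p) := by
  unfold LO_w
  exact Nat.Primes.summable_rpow.2 (by linarith)

lemma LO_primes_sq : Summable (fun p : Nat.Primes => ((p:ℕ):ℝ) ^ (-(1 + 1) : ℝ)) ∧
    ∑' p : Nat.Primes, ((p:ℕ):ℝ) ^ (-(1 + 1) : ℝ) ≤ 2 := by
  have h := LO_zeta_tsum (κ := 1) one_pos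
  refine ⟨Nat.Primes.summable_rpow.2 (by norm_num), ?_⟩
  have h1 := Summable.tsum_subtype_le (fun n : ℕ => (n:ℝ) ^ (-(1 + 1) : ℝ)) {p | Nat.Prime p}
    (fun n => by positivity) h.1
  refine le_trans h1 (h.2.trans (by norm_num))

lemma LO_cpow_split {κ t : ℝ} {p : ℕ} (hp : 0 < p) :
    (p:ℂ) ^ (-(1 + κ + t * Complex.I)) = (LO_w κ p : ℂ) * (starRingEnd ℂ) ((p:ℂ) ^ (t * Complex.I)) := by
  have hp0 : (p:ℂ) ≠ 0 := by exact_mod_cast hp.ne'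
  unfold LO_w
  rw [show (-(1 + κ + t * Complex.I) : ℂ) = ((-(1 + κ) : ℝ) : ℂ) + (-(t * Complex.I)) by push_cast; ring,
    Complex.cpow_add _ _ hp0]
  congr 1
  · rw [Complex.ofReal_cpow (by positivity)]; simp
  · rw [Complex.cpow_def_of_ne_zero hp0, Complex.cpow_def_of_ne_zero hp0, ← Complex.exp_conj]
    congr 1
    rw [Complex.natCast_log.symm, map_mul, map_mul, Complex.conj_I, Complex.conj_ofReal, Complex.conj_ofReal]
    ring

lemma LO_norm_pit {t : ℝ} {p : ℕ} (hp : 0 < p) : ‖(p:ℂ) ^ (t * Complex.I)‖ = 1 := by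
  rw [Complex.norm_natCast_cpow_of_pos hp]; simp

lemma LO_logL {N : ℕ} (χ : DirichletCharacter ℂ N) {κ : ℝ} (hκ : 0 < κ) (t : ℝ) :
    Summable (fun p : Nat.Primes => χ (p:ℕ) * ((p:ℕ):ℂ) ^ (-(1 + κ + t * Complex.I))) ∧
    |Real.log ‖LSeries (fun n : ℕ => χ n) (1 + κ + t * Complex.I)‖ -
      (∑' p : Nat.Primes, χ (p:ℕ) * ((p:ℕ):ℂ) ^ (-(1 + κ + t * Complex.I))).re| ≤ 2 := by
  set s : ℂ := 1 + κ + t * Complex.I with hs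
  have hre : s.re = 1 + κ := by simp [hs]
  have hs1 : 1 < s.re := by rw [hre]; linarith
  have hnorm : ∀ p : Nat.Primes, ‖χ (p:ℕ) * ((p:ℕ):ℂ) ^ (-s)‖ ≤ LO_w κ p := by
    intro p
    rw [norm_mul, Complex.norm_natCast_cpow_of_pos p.2.pos, Complex.neg_re, hre]
    exact mul_le_of_le_one_left (LO_w_nonneg κ p) (χ.norm_le_one _)
  have hsum : Summable (fun p : Nat.Primes => χ (p:ℕ) * ((p:ℕ):ℂ) ^ (-s)) :=
    Summable.of_norm_bounded (LO_w_summable hκ) hnorm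
  refine ⟨hsum, ?_⟩
  have hE := DirichletCharacter.LSeries_eulerProduct_exp_log χ hs1
  have hS := DirichletCharacter.summable_neg_log_one_sub_mul_prime_cpow χ hs1
  rw [← hE, Complex.norm_exp, Real.log_exp, ← Complex.sub_re, ← Summable.tsum_sub hS hsum]
  refine (Complex.abs_re_le_norm _).trans ?_
  have hb : ∀ p : Nat.Primes, ‖-Complex.log (1 - χ (p:ℕ) * ((p:ℕ):ℂ) ^ (-s)) - χ (p:ℕ) * ((p:ℕ):ℂ) ^ (-s)‖
      ≤ ((p:ℕ):ℝ) ^ (-(1 + 1) : ℝ) := by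
    intro p
    set z := χ (p:ℕ) * ((p:ℕ):ℂ) ^ (-s) with hz
    have hp2 : (2:ℝ) ≤ (p:ℕ) := by exact_mod_cast p.2.two_le
    have h1 : ‖z‖ ≤ ((p:ℕ):ℝ)⁻¹ := by
      refine (hnorm p).trans ?_
      unfold LO_w
      rw [← Real.rpow_neg_one]
      exact Real.rpow_le_rpow_of_exponent_le (by linarith) (by linarith)
    have h2 : ((p:ℕ):ℝ)⁻¹ ≤ 1/2 := by rw [inv_le_comm₀ (by linarith) (by norm_num)]; simpa using hp2
    have h3 := Complex.norm_log_one_add_sub_self_le (z := -z) (by rw [norm_neg]; linarith)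
    have e : -Complex.log (1 - z) - z = -(Complex.log (1 + -z) - -z) := by rw [← sub_eq_add_neg]; ring
    rw [e, norm_neg]
    rw [norm_neg] at h3
    refine h3.trans ?_
    have h4 : (1 - ‖z‖)⁻¹ ≤ 2 := by
      rw [inv_le_comm₀ (by linarith) (by norm_num)]; linarith
    have h5 : ((p:ℕ):ℝ) ^ (-(1 + 1) : ℝ) = (((p:ℕ):ℝ)⁻¹)^2 := by
      rw [show (-(1+1):ℝ) = ((-2 : ℤ) : ℝ) by norm_num, Real.rpow_intCast]
      rw [zpow_neg, inv_pow]; norm_cast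
    rw [h5]
    have h6 : ‖z‖^2 ≤ (((p:ℕ):ℝ)⁻¹)^2 := by gcongr
    nlinarith [sq_nonneg ‖z‖]
  exact (tsum_of_norm_bounded LO_primes_sq.1.hasSum hb).trans LO_primes_sq.2

/-- one as a character mod 1 -/
lemma LO_L_one : (fun n : ℕ => (1 : DirichletCharacter ℂ 1) n) = 1 := DirichletCharacter.modOne_eq_one

lemma LO_zeta_real {κ : ℝ} (hκ : 0 < κ) : ‖LSeries 1 (1 + κ + (0:ℝ) * Complex.I)‖ ≤ 1 + 1 / κ ∧
   1 / κ ≤ ‖LSeries 1 (1 + κ + (0:ℝ) * Complex.I)‖ := by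
  constructor
  · have := (LO_LS_bound (a := 1) (M := 1) (β := 0) (κ := κ) zero_le_one hκ (by intro n hn; simp)
      (s := 1 + κ + (0:ℝ) * Complex.I) (by simp)).2
    simpa using this
  · have h := LSeries_one_eq_riemannZeta (s := 1 + κ + (0:ℝ) * Complex.I) (by simp [hκ])
    rw [h, zeta_eq_tsum_one_div_nat_cpow (by simp [hκ])]
    have e : ∑' n : ℕ, 1 / (n:ℂ) ^ (1 + κ + (0:ℝ) * Complex.I : ℂ) = ((∑' n : ℕ, (n:ℝ) ^ (-(1 + κ)) : ℝ) : ℂ) := by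
      rw [Complex.ofReal_tsum]
      refine tsum_congr fun n => ?_
      rw [Complex.ofReal_cpow (by positivity)]
      rw [one_div, ← Complex.cpow_neg]; simp
    rw [e, Complex.norm_real]
    refine le_trans ?_ (le_abs_self _)
    have hz := (LO_zeta_tsum hκ).1
    -- lower bound by partial sums
    have hp : ∀ M : ℕ, 1/κ - ((M:ℝ)+1) ^ (-κ) / κ ≤ ∑ n ∈ Finset.range (M + 1), (n:ℝ) ^ (-(1 + κ)) := by
      intro M
      induction M with
      | zero => simp; rw [Real.zero_rpow (by linarith)]
      | succ n ih =>
        rw [Finset.sum_range_succ]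
        have hm : (0:ℝ) < (n:ℝ) + 1 := by positivity
        have key : ((n:ℝ)+1) ^ (-κ) * (1 - κ / (n+1)) ≤ ((n:ℝ) + 1 + 1) ^ (-κ) := by
          have e1 : ((n:ℝ) + 1 + 1) ^ (-κ) = ((n:ℝ)+1) ^ (-κ) * (1 + 1/((n:ℝ)+1)) ^ (-κ) := by
            rw [← Real.mul_rpow (by positivity) (by positivity)]; congr 1; field_simp
          rw [e1]; gcongr
          rw [Real.rpow_def_of_pos (by positivity)]
          have h1 := Real.log_le_sub_one_of_pos (x := 1 + 1/((n:ℝ)+1)) (by positivity)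
          have h2 := Real.add_one_le_exp (Real.log (1 + 1/((n:ℝ)+1)) * -κ)
          have h4 : κ / ((n:ℝ)+1) = κ * (1 / ((n:ℝ)+1)) := by ring
          rw [h4]; nlinarith
        have e2 : ((n:ℝ)+1) ^ (-(1 + κ)) = ((n:ℝ)+1) ^ (-κ) / (n+1) := by
          rw [show -(1 + κ) = -κ - 1 by ring, Real.rpow_sub_one hm.ne']
        push_cast
        rw [e2]
        have e3 : ((n:ℝ)+1) ^ (-κ) / κ - ((n:ℝ)+1) ^ (-κ) / (n+1) = ((n:ℝ)+1) ^ (-κ) * (1 - κ / (n+1)) / κ := by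
          field_simp
        have : ((n:ℝ)+1) ^ (-κ) * (1 - κ / (n+1)) / κ ≤ ((n:ℝ) + 1 + 1) ^ (-κ) / κ := by gcongr
        linarith
    have hlim : Filter.Tendsto (fun M : ℕ => 1/κ - ((M:ℝ)+1) ^ (-κ) / κ) Filter.atTop (nhds (1/κ - 0/κ)) := by
      refine tendsto_const_nhds.sub (Filter.Tendsto.div_const ?_ κ)
      refine (tendsto_rpow_neg_atTop hκ).comp ?_
      exact Filter.tendsto_atTop_add_const_right _ _ tendsto_natCast_atTop_atTop
    rw [zero_div, sub_zero] at hlim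
    refine le_of_tendsto' hlim fun M => (hp M).trans ?_
    exact hz.sum_le_tsum _ fun n _ => by positivity

lemma LO_wsum {κ : ℝ} (hκ : 0 < κ) : ∑' p : Nat.Primes, LO_w κ p ≤ Real.log (1 + 1/κ) + 2 ∧
    Real.log (1 / κ) - 2 ≤ ∑' p : Nat.Primes, LO_w κ p := by
  have h := LO_logL (1 : DirichletCharacter ℂ 1) hκ 0
  rw [LO_L_one] at h
  have e : ∑' p : Nat.Primes, (1 : DirichletCharacter ℂ 1) (p:ℕ) * ((p:ℕ):ℂ) ^ (-(1 + κ + (0:ℝ) * Complex.I))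
     = ((∑' p : Nat.Primes, LO_w κ p : ℝ) : ℂ) := by
    rw [Complex.ofReal_tsum]
    refine tsum_congr fun p => ?_
    rw [LO_cpow_split p.2.pos]
    rw [MulChar.one_apply (isUnit_of_subsingleton _)]
    simp
  rw [e, Complex.ofReal_re] at h
  have hz := LO_zeta_real hκ
  have h2 := abs_le.1 h.2
  have hpos : 0 < 1/κ := by positivity
  have l1 := Real.log_le_log (by linarith) hz.1
  have l2 := Real.log_le_log hpos hz.2
  constructor <;> linarith

lemma LO_V_bound {f : ℕ → ℂ} (hf : ∀ n, ‖f n‖ ≤ 1) (κ t : ℝ) (p : Nat.Primes) :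
    LO_w κ p * ‖f p - ((p:ℕ):ℂ) ^ (t * Complex.I)‖ ^ 2 ≤ 4 * LO_w κ p := by
  have h1 : ‖f p - ((p:ℕ):ℂ) ^ (t * Complex.I)‖ ≤ 2 := by
    refine (norm_sub_le _ _).trans ?_
    rw [LO_norm_pit p.2.pos]; linarith [hf p]
  have : ‖f p - ((p:ℕ):ℂ) ^ (t * Complex.I)‖ ^ 2 ≤ 2^2 := by gcongr
  nlinarith [LO_w_nonneg κ p]

lemma LO_V_summable {f : ℕ → ℂ} (hf : ∀ n, ‖f n‖ ≤ 1) {κ : ℝ} (hκ : 0 < κ) (t : ℝ) :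
    Summable (fun p : Nat.Primes => LO_w κ p * ‖f p - ((p:ℕ):ℂ) ^ (t * Complex.I)‖ ^ 2) :=
  Summable.of_nonneg_of_le (fun p => mul_nonneg (LO_w_nonneg κ p) (by positivity)) (LO_V_bound hf κ t)
    ((LO_w_summable hκ).mul_left 4)

lemma LO_V_nonneg (f : ℕ → ℂ) (κ t : ℝ) : 0 ≤ LO_V κ f t :=
  tsum_nonneg fun p => mul_nonneg (LO_w_nonneg κ p) (by positivity)

lemma LO_sq_expand (z u : ℂ) (hu : ‖u‖ = 1) : ‖z - u‖^2 = ‖z‖^2 + 1 - 2 * (z * (starRingEnd ℂ) u).re := by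
  have h : ‖u‖^2 = 1 := by rw [hu]; norm_num
  rw [← Complex.normSq_eq_norm_sq] at *
  rw [← Complex.normSq_eq_norm_sq, Complex.normSq_sub, h]

lemma LO_V_upper {N : ℕ} (χ : DirichletCharacter ℂ N) {κ : ℝ} (hκ : 0 < κ) (t : ℝ) :
    LO_V κ (fun n => χ n) t ≤ 2 * Real.log (1 + 1/κ) 
      - 2 * Real.log ‖LSeries (fun n : ℕ => χ n) (1 + κ + t * Complex.I)‖ + 8 := by
  have h := LO_logL χ hκ t
  have hw := (LO_wsum hκ).1
  have h2 := abs_le.1 h.2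
  rw [Complex.re_tsum h.1] at h2
  have hs := (Complex.hasSum_re h.1.hasSum).summable
  have : LO_V κ (fun n => χ n) t ≤ ∑' p : Nat.Primes, (2 * LO_w κ p - 2 * (χ (p:ℕ) * ((p:ℕ):ℂ) ^ (-(1 + κ + t * Complex.I))).re) := by
    refine Summable.tsum_le_tsum ?_ (LO_V_summable (fun n => χ.norm_le_one _) hκ t) 
      (((LO_w_summable hκ).mul_left 2).sub (hs.mul_left 2))
    intro p
    rw [LO_sq_expand _ _ (LO_norm_pit p.2.pos), LO_cpow_split p.2.pos]
    have e : (χ (p:ℕ) * ((LO_w κ p : ℂ) * (starRingEnd ℂ) (((p:ℕ):ℂ) ^ (t * Complex.I)))).re = 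
       LO_w κ p * (χ (p:ℕ) * (starRingEnd ℂ) (((p:ℕ):ℂ) ^ (t * Complex.I))).re := by
      rw [← Complex.re_ofReal_mul]; congr 1; ring
    rw [e]
    have h3 : ‖χ (p:ℕ)‖^2 ≤ 1 := pow_le_one₀ (norm_nonneg _) (χ.norm_le_one _)
    nlinarith [LO_w_nonneg κ p]
  rw [Summable.tsum_sub ((LO_w_summable hκ).mul_left 2) (hs.mul_left 2), tsum_mul_left, tsum_mul_left] at this
  linarith

lemma LO_V_lower {κ : ℝ} (hκ : 0 < κ) (t : ℝ) :
    2 * Real.log (1/κ) - 2 * Real.log ‖LSeries 1 (1 + κ + t * Complex.I)‖ - 8 ≤ LO_V κ 1 t := by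
  have h := LO_logL (1 : DirichletCharacter ℂ 1) hκ t
  rw [LO_L_one] at h
  have hw := (LO_wsum hκ).2
  have h2 := abs_le.1 h.2
  rw [Complex.re_tsum h.1] at h2
  have hs := (Complex.hasSum_re h.1.hasSum).summable
  have : LO_V κ 1 t = ∑' p : Nat.Primes, (2 * LO_w κ p - 2 * ((1 : DirichletCharacter ℂ 1) (p:ℕ) * ((p:ℕ):ℂ) ^ (-(1 + κ + t * Complex.I))).re) := by
    unfold LO_V
    refine tsum_congr fun p => ?_
    rw [LO_sq_expand _ _ (LO_norm_pit p.2.pos), LO_cpow_split p.2.pos, MulChar.one_apply (isUnit_of_subsingleton _)]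
    have e : (1 * ((LO_w κ p : ℂ) * (starRingEnd ℂ) (((p:ℕ):ℂ) ^ (t * Complex.I)))).re = 
       LO_w κ p * (1 * (starRingEnd ℂ) (((p:ℕ):ℂ) ^ (t * Complex.I))).re := by
      rw [← Complex.re_ofReal_mul]; congr 1; ring
    rw [e]
    simp only [Pi.one_apply, norm_one]
    ring
  rw [Summable.tsum_sub ((LO_w_summable hκ).mul_left 2) (hs.mul_left 2), tsum_mul_left, tsum_mul_left] at this
  linarith

end

section
lemma LO_V_mul {f g : ℕ → ℂ} (hf : ∀ n, ‖f n‖ ≤ 1) (hg : ∀ n, ‖g n‖ ≤ 1) {κ : ℝ} (hκ : 0 < κ) (t u : ℝ)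
    {k : ℝ} (hk : 0 < k) :
    LO_V κ (fun n => f n * g n) (t + u) ≤ (1 + 1/k) * LO_V κ f t + (1 + k) * LO_V κ g u := by
  unfold LO_V
  have hfg : ∀ n, ‖f n * g n‖ ≤ 1 := fun n => by
    rw [norm_mul]; exact mul_le_one₀ (hf n) (norm_nonneg _) (hg n)
  have s1 := LO_V_summable hf hκ t
  have s2 := LO_V_summable hg hκ u
  rw [← tsum_mul_left, ← tsum_mul_left, ← Summable.tsum_add (s1.mul_left _) (s2.mul_left _)]
  refine Summable.tsum_le_tsum ?_ (LO_V_summable hfg hκ _) ((s1.mul_left _).add (s2.mul_left _))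
  intro p
  have hp0 : ((p:ℕ):ℂ) ≠ 0 := by exact_mod_cast p.2.ne_zero
  set a := ((p:ℕ):ℂ) ^ (t * Complex.I) with ha
  set b := ((p:ℕ):ℂ) ^ (u * Complex.I) with hb
  have e : ((p:ℕ):ℂ) ^ (((t + u : ℝ):ℂ) * Complex.I) = a * b := by
    rw [ha, hb, ← Complex.cpow_add _ _ hp0]; congr 1; push_cast; ring
  rw [e]
  have h1 : ‖f p * g p - a * b‖ ≤ ‖f p - a‖ + ‖g p - b‖ := by
    have : f p * g p - a * b = (f p - a) * b + f p * (g p - b) := by ring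
    rw [this]
    refine (norm_add_le _ _).trans ?_
    rw [norm_mul, norm_mul, hb, LO_norm_pit p.2.pos, mul_one]
    have := hf p
    have := norm_nonneg (g p - b)
    rw [hb] at this
    nlinarith
  set x := ‖f p - a‖
  set y := ‖g p - b‖
  have h2 : ‖f p * g p - a * b‖^2 ≤ (1 + 1/k) * x^2 + (1 + k) * y^2 := by
    have h3 : ‖f p * g p - a * b‖^2 ≤ (x + y)^2 := by gcongr
    have h4 : (1 + 1/k) * x^2 + (1 + k) * y^2 - (x+y)^2 = (x - k*y)^2 / k := by field_simp; ring
    have : 0 ≤ (x - k*y)^2 / k := by positivity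
    linarith
  have := mul_le_mul_of_nonneg_left h2 (LO_w_nonneg κ p)
  linarith

lemma LO_V_inv {q : ℕ} [NeZero q] (χ : DirichletCharacter ℂ q) (κ t : ℝ) :
    LO_V κ (fun n => χ⁻¹ n) (-t) = LO_V κ (fun n => χ n) t := by
  unfold LO_V
  refine tsum_congr fun p => ?_
  congr 2
  have hp0 : ((p:ℕ):ℂ) ≠ 0 := by exact_mod_cast p.2.ne_zero
  have e1 : χ⁻¹ ((p:ℕ) : ZMod q) = (starRingEnd ℂ) (χ ((p:ℕ) : ZMod q)) := by
    rw [← MulChar.star_apply']; rfl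
  have e2 : ((p:ℕ):ℂ) ^ (((-t : ℝ):ℂ) * Complex.I) = (starRingEnd ℂ) (((p:ℕ):ℂ) ^ (t * Complex.I)) := by
    rw [Complex.cpow_def_of_ne_zero hp0, Complex.cpow_def_of_ne_zero hp0, ← Complex.exp_conj]
    congr 1
    rw [Complex.natCast_log.symm, map_mul, map_mul, Complex.conj_I, Complex.conj_ofReal, Complex.conj_ofReal]
    push_cast; ring
  dsimp only
  rw [e1, e2, ← map_sub, Complex.norm_conj]

lemma LO_V_one_le {q : ℕ} {κ : ℝ} (hκ : 0 < κ) (t : ℝ) :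
    LO_V κ 1 t ≤ 4 * LO_V κ (fun n => (1 : DirichletCharacter ℂ q) n) t := by
  unfold LO_V
  have s1 := LO_V_summable (f := fun n => (1 : DirichletCharacter ℂ q) n) (fun n => DirichletCharacter.norm_le_one _ _) hκ t
  rw [← tsum_mul_left]
  refine Summable.tsum_le_tsum ?_ (LO_V_summable (fun n => by simp) hκ _) (s1.mul_left _)
  intro p
  show LO_w κ p * ‖(1:ℂ) - ((p:ℕ):ℂ) ^ (t * Complex.I)‖ ^ 2 ≤ 4 * (LO_w κ p * ‖(1 : DirichletCharacter ℂ q) ((p:ℕ) : ZMod q) - ((p:ℕ):ℂ) ^ (t * Complex.I)‖ ^ 2)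
  by_cases h : IsUnit ((p:ℕ) : ZMod q)
  · rw [MulChar.one_apply h]
    have : 0 ≤ LO_w κ p * ‖(1:ℂ) - ((p:ℕ):ℂ) ^ (t * Complex.I)‖ ^ 2 := mul_nonneg (LO_w_nonneg κ p) (by positivity)
    linarith
  · rw [MulChar.map_nonunit _ h, zero_sub, norm_neg, LO_norm_pit p.2.pos]
    have := LO_V_bound (f := 1) (fun n => by simp) κ t p
    simp only [Pi.one_apply] at this
    linarith

lemma LO_zeta_step {κ : ℝ} (hκ : 0 < κ) {s : ℂ} (hs : s.re = 1 + κ) {n : ℕ} (hn : 1 ≤ n) :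
    ‖(n:ℂ) ^ (-s) - ((n:ℂ) ^ (1 - s) / (s - 1) - ((n+1:ℕ):ℂ) ^ (1 - s) / (s - 1))‖ ≤ ‖s‖ * (2/n - 2/(n+1)) := by
  have hn1 : (1:ℝ) ≤ n := by exact_mod_cast hn
  have hn0 : (0:ℝ) < n := by linarith
  have hs0 : s ≠ 0 := by intro h; rw [h] at hs; simp at hs; linarith
  have hs1 : s - 1 ≠ 0 := by
    intro h; have := congrArg Complex.re h; rw [Complex.sub_re, hs] at this; simp at this; linarith
  have hd : ∀ u : ℝ, 0 < u → ∀ r : ℂ, r ≠ 0 → HasDerivAt (fun y : ℝ => (y:ℂ) ^ r) (r * (u:ℂ)^(r - 1)) u := by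
    intro u hu r hr
    exact hasDerivAt_ofReal_cpow_const hu.ne' hr
  have h1 : ∀ u ∈ Set.Icc (n:ℝ) (n+1), ‖(u:ℂ)^(-s) - ((n:ℝ):ℂ)^(-s)‖ ≤ ‖s‖/n^2 := by
    intro u hu
    have := norm_image_sub_le_of_norm_deriv_le_segment' (f := fun y : ℝ => (y:ℂ)^(-s)) 
      (f' := fun y : ℝ => (-s) * (y:ℂ)^(-s-1)) (a := n) (b := n+1) (C := ‖s‖/n^2) ?_ ?_ u hu
    · refine this.trans ?_
      have : 0 ≤ ‖s‖/n^2 := by positivity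
      have h3 := hu.2
      nlinarith
    · intro y hy
      exact (hd y (by linarith [hy.1]) (-s) (by simpa using hs0)).hasDerivWithinAt
    · intro y hy
      have hy0 : 0 < y := by linarith [hy.1]
      rw [norm_mul, norm_neg, Complex.norm_cpow_eq_rpow_re_of_pos hy0]
      rw [div_eq_mul_inv]; gcongr
      simp only [Complex.sub_re, Complex.neg_re, hs, Complex.one_re]
      calc y ^ (-(1+κ) - 1) ≤ (n:ℝ) ^ (-(1+κ) - 1) := 
            Real.rpow_le_rpow_of_nonpos hn0 hy.1 (by linarith)
        _ ≤ (n:ℝ) ^ (-2 : ℝ) := Real.rpow_le_rpow_of_exponent_le hn1 (by linarith)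
        _ = ((n:ℝ)^2)⁻¹ := by rw [Real.rpow_neg hn0.le]; norm_cast
  have h2 := norm_image_sub_le_of_norm_deriv_le_segment' 
      (f := fun y : ℝ => (y:ℂ) * ((n:ℝ):ℂ)^(-s) + (y:ℂ)^(1-s)/(s-1)) 
      (f' := fun y : ℝ => ((n:ℝ):ℂ)^(-s) - (y:ℂ)^(-s)) (a := n) (b := n+1) (C := ‖s‖/n^2) ?_ ?_ (n+1) ⟨by linarith, le_refl _⟩
  · have e : (((n + 1 : ℝ) : ℂ) * ((n:ℝ):ℂ)^(-s) + ((n + 1 : ℝ):ℂ)^(1-s)/(s-1)) - (((n:ℝ):ℂ) * ((n:ℝ):ℂ)^(-s) + ((n:ℝ):ℂ)^(1-s)/(s-1)) = (n:ℂ) ^ (-s) - ((n:ℂ) ^ (1 - s) / (s - 1) - ((n+1:ℕ):ℂ) ^ (1 - s) / (s - 1)) := by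
      push_cast; ring
    rw [e] at h2
    refine h2.trans ?_
    have e2 : (2:ℝ)/n - 2/(n+1) = 2/(n*(n+1)) := by field_simp; ring
    rw [e2, add_sub_cancel_left, mul_one, div_eq_mul_inv]
    gcongr
    rw [inv_eq_one_div, div_le_div_iff₀ (by positivity) (by positivity)]
    nlinarith
  · intro y hy
    have hy0 : 0 < y := by linarith [hy.1]
    have a1 := hd y hy0 (1 - s) (by intro h; apply hs1; linear_combination -h)
    have a2 : HasDerivAt (fun y : ℝ => (y:ℂ) * ((n:ℝ):ℂ)^(-s)) (((n:ℝ):ℂ)^(-s)) y := by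
      simpa using (HasDerivAt.ofReal_comp (hasDerivAt_id y)).mul_const (((n:ℝ):ℂ)^(-s))
    have a3 := a2.add (a1.div_const (s-1))
    refine (a3.congr_deriv ?_).hasDerivWithinAt
    rw [show (1 - s - 1) = -s by ring]
    field_simp
    ring
  · intro y hy
    rw [norm_sub_rev]
    exact h1 y ⟨hy.1, hy.2.le⟩

lemma LO_zeta_approx {κ : ℝ} (hκ : 0 < κ) {s : ℂ} (hs : s.re = 1 + κ) (N : ℕ) :
    ‖LSeries 1 s - ∑ n ∈ Finset.Ioc 0 N, (n:ℂ) ^ (-s) - ((N+1:ℕ):ℂ) ^ (1 - s) / (s - 1)‖ ≤ 2 * ‖s‖ / (N+1) := by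
  have hs1 : 1 < s.re := by rw [hs]; linarith
  set F : ℕ → ℂ := fun n => (n:ℂ) ^ (1 - s) / (s - 1) with hF
  have hpart : ∀ j : ℕ, ‖∑ n ∈ Finset.Ioc 0 (N + j), (n:ℂ)^(-s) - ∑ n ∈ Finset.Ioc 0 N, (n:ℂ) ^ (-s) - (F (N+1) - F (N+j+1))‖ 
      ≤ ‖s‖ * (2/(N+1) - 2/(N+j+1)) := by
    intro j
    induction j with
    | zero => simp
    | succ j ih =>
      have h := LO_zeta_step hκ hs (n := N + j + 1) (by omega)
      rw [← add_assoc, Finset.sum_Ioc_succ_top (by omega)]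
      have e : ∑ n ∈ Finset.Ioc 0 (N + j), (n:ℂ)^(-s) + ((N+j+1 : ℕ):ℂ)^(-s) - ∑ n ∈ Finset.Ioc 0 N, (n:ℂ) ^ (-s) - (F (N+1) - F (N+j+1+1)) = (∑ n ∈ Finset.Ioc 0 (N + j), (n:ℂ)^(-s) - ∑ n ∈ Finset.Ioc 0 N, (n:ℂ) ^ (-s) - (F (N+1) - F (N+j+1))) + (((N+j+1 : ℕ):ℂ)^(-s) - (F (N+j+1) - F (N+j+1+1))) := by ring
      rw [e]
      refine (norm_add_le _ _).trans ?_
      push_cast at h ih ⊢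
      have h' : ‖((N:ℂ)+j+1)^(-s) - (F (N+j+1) - F (N+j+1+1))‖ ≤ ‖s‖ * (2 / ((N:ℝ)+j+1) - 2/((N:ℝ)+j+1+1)) := by
        rw [hF]; push_cast; exact h
      have e2 : (N:ℝ) + (j+1) + 1 = (N:ℝ) + j + 1 + 1 := by ring
      rw [e2]
      nlinarith
  have hL : Filter.Tendsto (fun M : ℕ => ∑ n ∈ Finset.Ioc 0 M, (n:ℂ)^(-s)) Filter.atTop (nhds (LSeries 1 s)) := by
    have h1 := (LSeriesSummable_one_iff.2 hs1).hasSum.tendsto_sum_nat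
    have h2 := h1.comp (Filter.tendsto_add_atTop_nat 1)
    refine h2.congr fun M => ?_
    simp only [Function.comp]
    rw [Finset.range_eq_Ico, ← Finset.sum_Ioo_add_eq_sum_Ico (by omega), LSeries.term_zero, add_zero]
    refine Finset.sum_congr (by ext; simp) fun n hn => ?_
    rw [Finset.mem_Ioc] at hn
    rw [LSeries.term_of_ne_zero (by omega), Pi.one_apply, one_div, Complex.cpow_neg]
  have hFlim : Filter.Tendsto (fun j : ℕ => F (N + j + 1)) Filter.atTop (nhds 0) := by
    have : Filter.Tendsto F Filter.atTop (nhds 0) := by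
      rw [tendsto_zero_iff_norm_tendsto_zero]
      have h3 : Filter.Tendsto (fun n : ℕ => (n:ℝ)^(-κ) / ‖s - 1‖) Filter.atTop (nhds (0 / ‖s-1‖)) :=
        ((tendsto_rpow_neg_atTop hκ).comp tendsto_natCast_atTop_atTop).div_const _
      rw [zero_div] at h3
      refine h3.congr' ?_
      filter_upwards [Filter.eventually_gt_atTop 0] with n hn
      rw [hF]; simp only [norm_div]
      rw [Complex.norm_natCast_cpow_of_pos hn]; simp [hs]
    have h4 := this.comp (Filter.tendsto_add_atTop_nat (N+1))
    refine h4.congr fun j => ?_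
    simp only [Function.comp]; congr 1; ring
  have hL2 : Filter.Tendsto (fun j : ℕ => ∑ n ∈ Finset.Ioc 0 (N + j), (n:ℂ)^(-s)) Filter.atTop (nhds (LSeries 1 s)) := by
    have := hL.comp (Filter.tendsto_add_atTop_nat N)
    refine this.congr fun j => ?_
    simp only [Function.comp]; rw [add_comm]
  have hfin := ((hL2.sub_const (∑ n ∈ Finset.Ioc 0 N, (n:ℂ) ^ (-s))).sub (hFlim.const_sub (F (N+1)))).norm
  rw [sub_zero] at hfin
  refine le_of_tendsto' hfin fun j => (hpart j).trans ?_
  have : (0:ℝ) ≤ 2/(N+j+1) := by positivity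
  have h5 : 2 * ‖s‖ / (N+1) = ‖s‖ * (2/(N+1)) := by ring
  rw [h5]
  gcongr; linarith

lemma LO_zeta_near {κ : ℝ} (hκ : 0 < κ) {s : ℂ} (hs : s.re = 1 + κ) :
    1 / ‖s - 1‖ - 2 * ‖s‖ ≤ ‖LSeries 1 s‖ := by
  have h := LO_zeta_approx hκ hs 0
  simp at h
  have h2 := norm_sub_norm_le ((s-1)⁻¹) (LSeries 1 s)
  rw [norm_sub_rev, norm_inv] at h2
  rw [one_div]; linarith

lemma LO_zeta_far {κ : ℝ} (hκ : 0 < κ) {s : ℂ} (hs : s.re = 1 + κ) :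
    ‖LSeries 1 s‖ ≤ 3 + Real.log ‖s‖ + 1 / ‖s - 1‖ := by
  have hns : 1 ≤ ‖s‖ := by
    have := Complex.abs_re_le_norm s; rw [hs, abs_of_pos (by linarith)] at this; linarith
  set N := ⌊‖s‖⌋₊ with hN
  have hN1 : 1 ≤ N := Nat.le_floor (by simpa using hns)
  have h := LO_zeta_approx hκ hs N
  have hlt : ‖s‖ < N + 1 := Nat.lt_floor_add_one _
  have h1 : 2 * ‖s‖ / (N+1) ≤ 2 := by rw [div_le_iff₀ (by positivity)]; linarith
  have h2 : ‖∑ n ∈ Finset.Ioc 0 N, (n:ℂ) ^ (-s)‖ ≤ 1 + Real.log ‖s‖ := by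
    have h3 : ‖∑ n ∈ Finset.Ioc 0 N, (n:ℂ) ^ (-s)‖ ≤ (harmonic N : ℝ) := by
      rw [harmonic_eq_sum_Icc]
      push_cast
      refine (norm_sum_le _ _).trans (Finset.sum_le_sum fun n hn => ?_)
      rw [Finset.mem_Ioc] at hn
      rw [Complex.norm_natCast_cpow_of_pos hn.1, ← Real.rpow_neg_one]
      refine Real.rpow_le_rpow_of_exponent_le (by exact_mod_cast hn.1) ?_
      simp [hs]; linarith
    refine h3.trans ((harmonic_le_one_add_log N).trans ?_)
    gcongr
    exact Nat.floor_le (norm_nonneg _)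
  have h4 : ‖((N+1:ℕ):ℂ) ^ (1 - s) / (s - 1)‖ ≤ 1/‖s-1‖ := by
    rw [norm_div, Complex.norm_natCast_cpow_of_pos (by omega)]
    gcongr
    refine Real.rpow_le_one_of_one_le_of_nonpos (by push_cast; linarith [(Nat.cast_nonneg N : (0:ℝ) ≤ N)]) ?_
    simp [hs]; linarith
  have e : LSeries 1 s = (LSeries 1 s - ∑ n ∈ Finset.Ioc 0 N, (n:ℂ) ^ (-s) - ((N+1:ℕ):ℂ) ^ (1 - s) / (s - 1)) + ∑ n ∈ Finset.Ioc 0 N, (n:ℂ) ^ (-s) + ((N+1:ℕ):ℂ) ^ (1 - s) / (s - 1) := by ring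
  rw [e]
  refine (norm_add₃_le).trans ?_
  linarith

end

section
open scoped Pointwise

lemma LO_group {Γ : Type*} [CommGroup Γ] [DecidableEq Γ] (J : Finset Γ) (h1 : (1:Γ) ∈ J)
    (hinv : ∀ a ∈ J, a⁻¹ ∈ J) {D N : ℕ} (hD : ∀ n : ℕ, (J ^ n).card ≤ D) (hN : D < (N+1) * J.card) :
    ∃ k : ℕ, 1 ≤ k ∧ k ≤ 3 * N + 2 ∧ ∃ H : Subgroup Γ, ∀ g, g ∈ H ↔ g ∈ J ^ k := by
  have hmono : ∀ {m n : ℕ}, m ≤ n → J ^ m ⊆ J ^ n := fun h => Finset.pow_subset_pow_right h1 h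
  have hpinv : ∀ n : ℕ, ∀ a ∈ J ^ n, a⁻¹ ∈ J ^ n := by
    intro n
    induction n with
    | zero => intro a ha; simp at ha ⊢; exact ha
    | succ n ih =>
      intro a ha
      rw [pow_succ, Finset.mem_mul] at ha ⊢
      obtain ⟨b, hb, c, hc, rfl⟩ := ha
      exact ⟨b⁻¹, ih b hb, c⁻¹, hinv c hc, by rw [mul_inv]⟩
  have hstab : ∃ i ≤ N, J ^ (3*i+3) ⊆ J ^ (3*i+2) := by
    by_contra! hcon
    have key : ∀ i ≤ N, (i+1) * J.card ≤ (J ^ (3*i+1)).card := by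
      intro i
      induction i with
      | zero => intro _; simp
      | succ i ih =>
        intro hi
        have h := ih (by omega)
        obtain ⟨g, hg, hg'⟩ := Finset.not_subset.1 (hcon i (by omega))
        have hdisj : Disjoint (g • J) (J ^ (3*i+1)) := by
          rw [Finset.disjoint_left]
          intro x hx hx'
          rw [Finset.mem_smul_finset] at hx
          obtain ⟨a, ha, rfl⟩ := hx
          apply hg'
          have : g = (g • a) * a⁻¹ := by simp
          rw [this, show 3*i+2 = (3*i+1)+1 by ring, pow_succ]
          exact Finset.mul_mem_mul hx' (hinv a ha)
        have hsub : g • J ∪ J ^ (3*i+1) ⊆ J ^ (3*(i+1)+1) := by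
          refine Finset.union_subset ?_ (hmono (by omega))
          intro x hx
          rw [Finset.mem_smul_finset] at hx
          obtain ⟨a, ha, rfl⟩ := hx
          rw [pow_succ]
          exact Finset.mul_mem_mul hg ha
        have := Finset.card_le_card hsub
        rw [Finset.card_union_of_disjoint hdisj, Finset.card_smul_finset] at this
        nlinarith
    have := key N le_rfl
    have := hD (3*N+1)
    omega
  obtain ⟨i, hi, hs⟩ := hstab
  set k := 3*i+2 with hk
  have hall : ∀ m, J ^ (k + m) ⊆ J ^ k := by
    intro m
    induction m with
    | zero => simp
    | succ m ih =>
      rw [← add_assoc, pow_succ]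
      refine (Finset.mul_subset_mul_right ih).trans ?_
      rw [← pow_succ]; exact hs
  refine ⟨k, by omega, by omega, ⟨⟨⟨(J ^ k : Finset Γ), ?_⟩, ?_⟩, ?_⟩, ?_⟩
  · intro a b ha hb
    rw [Finset.mem_coe] at *
    apply hall k
    rw [pow_add]; exact Finset.mul_mem_mul ha hb
  · exact hmono (Nat.zero_le k) (by simp)
  · intro a ha
    exact hpinv k a ha
  · intro g; rfl

/-- propagate the distance to powers -/
lemma LO_pow_dist {q : ℕ} [DecidableEq (DirichletCharacter ℂ q)] (J : Finset (DirichletCharacter ℂ q)) {κ T E : ℝ} (hκ : 0 < κ)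
    (hE : ∀ ψ ∈ J, ∃ t : ℝ, |t| ≤ T ∧ LO_V κ (fun n => ψ n) t ≤ E) (k : ℕ) (hk : 1 ≤ k) :
    ∀ ψ ∈ J ^ k, ∃ t : ℝ, |t| ≤ k * T ∧ LO_V κ (fun n => ψ n) t ≤ k^2 * E := by
  induction k, hk using Nat.le_induction with
  | base => intro ψ hψ; simpa using hE ψ (by simpa using hψ)
  | succ k hk ih =>
    intro ψ hψ
    rw [pow_succ, Finset.mem_mul] at hψ
    obtain ⟨a, ha, b, hb, rfl⟩ := hψ
    obtain ⟨t, ht, hV⟩ := ih a ha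
    obtain ⟨u, hu, hW⟩ := hE b hb
    have hk0 : (0:ℝ) < k := by exact_mod_cast hk
    refine ⟨t + u, ?_, ?_⟩
    · refine (abs_add_le _ _).trans ?_
      push_cast; linarith
    · have := LO_V_mul (f := fun n => a n) (g := fun n => b n) (fun n => a.norm_le_one _) (fun n => b.norm_le_one _) hκ t u hk0
      have e : (fun n : ℕ => (a * b) n) = fun n : ℕ => a n * b n := by ext n; simp
      rw [e]
      refine this.trans ?_
      calc (1 + 1/(k:ℝ)) * LO_V κ (fun n => a n) t + (1 + k) * LO_V κ (fun n => b n) u 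
          ≤ (1 + 1/(k:ℝ)) * (k^2 * E) + (1 + k) * E := by gcongr
        _ = _ := by push_cast; field_simp; ring

end

section
lemma LO_collapse {q : ℕ} [NeZero q] (H : Subgroup (DirichletCharacter ℂ q)) {U S W : ℝ} (hU : 1 ≤ U)
    (hS : 0 ≤ S) (hW : 0 ≤ W)
    (hE : ∀ ψ ∈ H, ∃ t : ℝ, |t| ≤ S ∧ LO_V (1/U) (fun n => ψ n) t ≤ W)
    (h24 : 24 ≤ U * Real.exp (-(18*W+4))) 
    (hlog : 2 * (3 + Real.log (2 + 3*S)) ≤ U * Real.exp (-(18*W+4))) :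
    ∀ ψ ∈ H, LO_V (1/U) (fun n => ψ n) 0 ≤ 74 * W + 44 := by
  set κ := 1/U with hκ
  have hU0 : 0 < U := by linarith
  have hκ0 : 0 < κ := by positivity
  have hκ1 : κ ≤ 1 := by rw [hκ, div_le_one hU0]; exact hU
  have hκU : 1/κ = U := by rw [hκ]; field_simp
  set B := 18*W+4 with hB
  set R := U * Real.exp (-B) with hR
  have hR0 : 0 < R := by positivity
  choose! t ht using hE
  obtain ⟨ψ₀, hψ₀, hmax⟩ := Set.exists_max_image (H : Set (DirichletCharacter ℂ q)) (fun ψ => |t ψ|) 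
    (Set.toFinite _) ⟨1, H.one_mem⟩
  -- bound on the max
  have hM : |t ψ₀| ≤ 2 / R := by
    by_contra! hcon
    have h2mem : ψ₀ * ψ₀ ∈ H := H.mul_mem hψ₀ hψ₀
    set τ := t (ψ₀ * ψ₀) + -t ψ₀ + -t ψ₀ with hτ
    have hτ1 : |t ψ₀| ≤ |τ| := by
      have h1 := hmax _ h2mem
      have h3 : 2 * |t ψ₀| = |t (ψ₀ * ψ₀) - τ| := by 
        rw [show t (ψ₀ * ψ₀) - τ = 2 * t ψ₀ by rw [hτ]; ring, abs_mul, abs_two]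
      have h4 := abs_sub (t (ψ₀ * ψ₀)) τ
      linarith
    have hτ2 : |τ| ≤ 3 * S := by
      have h1 := (ht _ h2mem).1
      have h2 := (ht _ hψ₀).1
      rw [abs_le] at *
      constructor <;> linarith
    have hV1 := LO_V_mul (f := fun n => (ψ₀ * ψ₀) n) (g := fun n => ψ₀⁻¹ n) (fun n => DirichletCharacter.norm_le_one _ _)
      (fun n => DirichletCharacter.norm_le_one _ _) hκ0 (t (ψ₀ * ψ₀)) (-t ψ₀) one_pos
    have hV2 := LO_V_mul (f := fun n => (ψ₀ * ψ₀) n * ψ₀⁻¹ n) (g := fun n => ψ₀⁻¹ n) 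
      (fun n => by
        rw [norm_mul]; exact mul_le_one₀ (DirichletCharacter.norm_le_one _ _) (norm_nonneg _) (DirichletCharacter.norm_le_one _ _))
      (fun n => DirichletCharacter.norm_le_one _ _) hκ0 (t (ψ₀ * ψ₀) + -t ψ₀) (-t ψ₀) two_pos
    have e : (fun n : ℕ => (ψ₀ * ψ₀) n * ψ₀⁻¹ n * ψ₀⁻¹ n) = fun n : ℕ => (1 : DirichletCharacter ℂ q) n := by
      ext n
      rw [← MulChar.mul_apply, ← MulChar.mul_apply]; congr 1; group
    rw [e] at hV2
    rw [LO_V_inv] at hV1 hV2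
    have hw1 := (ht _ h2mem).2
    have hw2 := (ht _ hψ₀).2
    have hV3 := LO_V_one_le (q := q) hκ0 τ
    have hV4 := LO_V_lower hκ0 τ
    rw [← hτ] at hV2
    rw [hκU] at hV4
    have hV5 : Real.log U - B ≤ Real.log ‖LSeries 1 (1 + κ + τ * Complex.I)‖ := by
      rw [hB]; linarith
    set s : ℂ := 1 + κ + τ * Complex.I with hs
    have hre : s.re = 1 + κ := by simp [hs]
    have hpos : 0 < ‖LSeries 1 s‖ := by
      rw [norm_pos_iff, LSeries_one_eq_riemannZeta (by rw [hre]; linarith)]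
      exact riemannZeta_ne_zero_of_one_lt_re (by rw [hre]; linarith)
    have h6 : R ≤ ‖LSeries 1 s‖ := by
      have := Real.exp_le_exp.2 hV5
      rw [Real.exp_log hpos, sub_eq_add_neg, Real.exp_add, Real.exp_log hU0] at this
      exact this
    have h7 := LO_zeta_far hκ0 hre
    have hτ0 : 0 < |τ| := by
      have : 0 < 2/R := by positivity
      linarith
    have h8 : ‖s‖ ≤ 2 + 3 * S := by
      have : ‖s‖ ≤ ‖(1 + κ : ℂ)‖ + ‖(τ:ℂ) * Complex.I‖ := norm_add_le _ _
      have h9 : ‖(1 + κ : ℂ)‖ ≤ 2 := by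
        rw [show (1 + κ : ℂ) = ((1 + κ : ℝ) : ℂ) by push_cast; rfl, Complex.norm_real, Real.norm_eq_abs, abs_of_pos (by linarith)]
        linarith
      rw [norm_mul, Complex.norm_I, mul_one, Complex.norm_real, Real.norm_eq_abs] at this
      linarith
    have hs1 : 1 ≤ ‖s‖ := by
      have := Complex.abs_re_le_norm s; rw [hre, abs_of_pos (by linarith)] at this; linarith
    have h10 : Real.log ‖s‖ ≤ Real.log (2 + 3*S) := Real.log_le_log (by linarith) h8
    have h11 : |τ| ≤ ‖s - 1‖ := by
      have := Complex.abs_im_le_norm (s - 1)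
      simpa [hs] using this
    have h12 : 1 / ‖s - 1‖ < R / 2 := by
      have h13 : 2 / R < ‖s - 1‖ := by linarith
      rw [div_lt_iff₀ (by linarith)]
      rw [div_lt_iff₀ hR0] at h13
      linarith
    linarith
  have hone : ∀ u : ℝ, |u| ≤ 2 / R → LO_V κ 1 u ≤ 2 * B + 14 := by
    intro u hu
    have h1 := LO_V_upper (1 : DirichletCharacter ℂ 1) hκ0 u
    rw [LO_L_one] at h1
    set s : ℂ := 1 + κ + u * Complex.I with hs
    have hre : s.re = 1 + κ := by simp [hs]
    have h2 := LO_zeta_near hκ0 hre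
    have hs1 : ‖s - 1‖ ≤ κ + 2 / R := by
      have e : s - 1 = κ + u * Complex.I := by rw [hs]; ring
      rw [e]
      refine (norm_add_le _ _).trans ?_
      rw [norm_mul, Complex.norm_I, mul_one, Complex.norm_real, Complex.norm_real, Real.norm_eq_abs, Real.norm_eq_abs, abs_of_pos hκ0]
      linarith
    have hRU : R ≤ U := by
      have : Real.exp (-B) ≤ 1 := Real.exp_le_one_iff.2 (by rw [hB]; linarith)
      rw [hR]; nlinarith
    have hκR : κ ≤ 1 / R := by rw [hκ]; gcongr
    have hs2 : ‖s - 1‖ ≤ 3 / R := by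
      have : 3 / R = 1/R + 2/R := by ring
      linarith
    have hsp : 0 < ‖s - 1‖ := by
      have := Complex.abs_re_le_norm (s - 1)
      rw [Complex.sub_re, hre, Complex.one_re, add_sub_cancel_left, abs_of_pos hκ0] at this; linarith
    have h3 : R / 3 ≤ 1 / ‖s - 1‖ := by
      rw [le_div_iff₀ hsp]
      rw [le_div_iff₀ hR0] at hs2
      nlinarith
    have h4 : ‖s‖ ≤ 2 := by
      have : ‖s‖ ≤ ‖s - 1‖ + 1 := by simpa using norm_add_le (s-1) 1
      have h5 : 3 / R ≤ 1 := by rw [div_le_one hR0]; linarith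
      linarith
    have h6 : R / 6 ≤ ‖LSeries 1 s‖ := by linarith
    have h7 := Real.log_le_log (by positivity) h6
    have h8 : Real.log (R/6) = Real.log U - B - Real.log 6 := by
      rw [Real.log_div hR0.ne' (by norm_num), hR, Real.log_mul hU0.ne' (Real.exp_pos _).ne', Real.log_exp]; ring
    rw [hκU] at h1
    have h9 : Real.log (1 + U) ≤ Real.log 2 + Real.log U := by
      rw [← Real.log_mul (by norm_num) hU0.ne']
      exact Real.log_le_log (by linarith) (by linarith)
    have h10 : Real.log 2 + Real.log 6 ≤ 3 := by
      rw [← Real.log_mul (by norm_num) (by norm_num), Real.log_le_iff_le_exp (by norm_num)]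
      have : Real.exp 3 = Real.exp 1 ^ 3 := by rw [← Real.exp_nat_mul]; norm_num
      rw [this]
      have := Real.exp_one_gt_d9
      calc (2 * 6 : ℝ) ≤ 2.7^3 := by norm_num
        _ ≤ _ := by gcongr; linarith
    linarith
  intro ψ hψ
  have hb := hmax ψ hψ
  have h1 := hone (-(t ψ)) (by rw [abs_neg]; linarith)
  have h2 := LO_V_mul (f := fun n => ψ n) (g := 1) (fun n => DirichletCharacter.norm_le_one _ _)
      (fun n => by simp) hκ0 (t ψ) (-t ψ) one_pos
  rw [add_neg_cancel] at h2
  have e : (fun n : ℕ => ψ n * (1 : ℕ → ℂ) n) = fun n : ℕ => ψ n := by ext n; simp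
  rw [e] at h2
  have := (ht _ hψ).2
  rw [hB] at h1
  linarith

end

section
lemma LO_H_sum {q : ℕ} [NeZero q] (H : Finset (DirichletCharacter ℂ q)) 
    (hmul : ∀ a ∈ H, ∀ b ∈ H, a * b ∈ H) (a : ZMod q)
    (hbad : ∃ ψ ∈ H, ψ a ≠ 1) : ∑ ψ ∈ H, ψ a = 0 := by
  classical
  obtain ⟨ψ₀, h0, h1⟩ := hbad
  have h2 : ∑ ψ ∈ H, (ψ₀ * ψ) a = ∑ ψ ∈ H, ψ a := by
    have himg : H.image (fun ψ => ψ₀ * ψ) = H := by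
      apply Finset.eq_of_subset_of_card_le
      · intro x hx
        rw [Finset.mem_image] at hx
        obtain ⟨y, hy, rfl⟩ := hx
        exact hmul _ h0 _ hy
      · rw [Finset.card_image_of_injective _ (mul_right_injective ψ₀)]
    conv_rhs => rw [← himg]
    rw [Finset.sum_image (fun x _ y _ h => mul_right_injective ψ₀ h)]
  simp only [MulChar.mul_apply] at h2
  rw [← Finset.mul_sum] at h2
  have : (ψ₀ a - 1) * ∑ ψ ∈ H, ψ a = 0 := by rw [sub_mul, one_mul, h2, sub_self]
  rcases mul_eq_zero.1 this with h | h
  · exact absurd (sub_eq_zero.1 h) h1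
  · exact h

lemma LO_bad_sum {q : ℕ} [NeZero q] (H : Finset (DirichletCharacter ℂ q)) (hne : H.Nonempty)
    (hmul : ∀ a ∈ H, ∀ b ∈ H, a * b ∈ H) {U Y : ℝ} (hU : 1 ≤ U)
    (hV : ∀ ψ ∈ H, LO_V (1/U) (fun n => ψ n) 0 ≤ Y) (P : Finset ℕ)
    (hP : ∀ p ∈ P, p.Prime ∧ (p:ℝ) ≤ Real.exp U ∧ ∃ ψ ∈ H, ψ (p : ZMod q) ≠ 1) :
    ∑ p ∈ P, 1 / (p:ℝ) ≤ 3 * Y := by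
  have hU0 : 0 < U := by linarith
  set κ := 1/U with hκ
  have hκ0 : 0 < κ := by positivity
  have h1 : ∀ ψ ∈ H, ∑ p ∈ P, LO_w κ p * ‖ψ (p : ZMod q) - 1‖^2 ≤ Y := by
    intro ψ hψ
    refine le_trans ?_ (hV ψ hψ)
    unfold LO_V
    have hs := LO_V_summable (f := fun n => ψ n) (fun n => ψ.norm_le_one _) hκ0 0
    set Q : Finset Nat.Primes := P.attach.map ⟨fun p => ⟨p.1, (hP p.1 p.2).1⟩, by
      intro a b h; exact Subtype.ext (congrArg (fun x : Nat.Primes => (x:ℕ)) h)⟩ with hQ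
    have e : ∑ p ∈ P, LO_w κ p * ‖ψ (p : ZMod q) - 1‖^2 = 
        ∑ p ∈ Q, LO_w κ p * ‖ψ ((p:ℕ) : ZMod q) - ((p:ℕ):ℂ) ^ (((0:ℝ):ℂ) * Complex.I)‖ ^ 2 := by
      rw [hQ, Finset.sum_map, ← Finset.sum_attach]
      refine Finset.sum_congr rfl fun p _ => ?_
      simp
      rfl
    rw [e]
    exact hs.sum_le_tsum _ fun p _ => mul_nonneg (LO_w_nonneg κ p) (by positivity)
  have hcard : (0:ℝ) < H.card := by exact_mod_cast hne.card_pos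
  have h2 : ∀ p ∈ P, (H.card : ℝ) ≤ ∑ ψ ∈ H, ‖ψ (p : ZMod q) - 1‖^2 := by
    intro p hp
    have hz := LO_H_sum H hmul (p : ZMod q) (hP p hp).2.2
    have e : ∑ ψ ∈ H, ‖ψ (p : ZMod q) - 1‖^2 = ∑ ψ ∈ H, ‖ψ (p : ZMod q)‖^2 + H.card - 2 * (∑ ψ ∈ H, ψ (p : ZMod q)).re := by
      rw [Complex.re_sum, Finset.mul_sum]
      simp_rw [LO_sq_expand _ 1 norm_one]
      simp [Finset.sum_add_distrib]
    rw [e, hz]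
    have : 0 ≤ ∑ ψ ∈ H, ‖ψ (p : ZMod q)‖^2 := Finset.sum_nonneg fun _ _ => by positivity
    simp; linarith
  have h3 : ∑ p ∈ P, LO_w κ p ≤ Y := by
    have h4 : (H.card:ℝ) * ∑ p ∈ P, LO_w κ p ≤ H.card * Y := by
      calc (H.card:ℝ) * ∑ p ∈ P, LO_w κ p = ∑ p ∈ P, LO_w κ p * H.card := by
            rw [Finset.mul_sum]; refine Finset.sum_congr rfl fun p _ => mul_comm _ _
        _ ≤ ∑ p ∈ P, LO_w κ p * ∑ ψ ∈ H, ‖ψ (p : ZMod q) - 1‖^2 := by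
            refine Finset.sum_le_sum fun p hp => mul_le_mul_of_nonneg_left (h2 p hp) (LO_w_nonneg κ p)
        _ = ∑ ψ ∈ H, ∑ p ∈ P, LO_w κ p * ‖ψ (p : ZMod q) - 1‖^2 := by
            simp_rw [Finset.mul_sum]; exact Finset.sum_comm
        _ ≤ ∑ ψ ∈ H, Y := Finset.sum_le_sum h1
        _ = _ := by simp
    exact le_of_mul_le_mul_left h4 hcard
  have h5 : ∀ p ∈ P, 1/(p:ℝ) ≤ 3 * LO_w κ p := by
    intro p hp
    obtain ⟨hp1, hp2, -⟩ := hP p hp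
    have hp0 : (0:ℝ) < p := by exact_mod_cast hp1.pos
    have hpk : (p:ℝ)^κ ≤ 3 := by
      calc (p:ℝ)^κ ≤ (Real.exp U)^κ := by gcongr
        _ = Real.exp 1 := by rw [← Real.exp_mul]; congr 1; rw [hκ]; field_simp
        _ ≤ 3 := by linarith [Real.exp_one_lt_d9]
    unfold LO_w
    rw [neg_add, Real.rpow_add hp0, Real.rpow_neg_one, Real.rpow_neg hp0.le, one_div]
    have hk0 : 0 < (p:ℝ)^κ := by positivity
    have : 1 ≤ 3 * ((p:ℝ)^κ)⁻¹ := by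
      rw [← div_eq_mul_inv, le_div_iff₀ hk0]; linarith
    have hi : 0 < (p:ℝ)⁻¹ := by positivity
    nlinarith
  calc ∑ p ∈ P, 1/(p:ℝ) ≤ ∑ p ∈ P, 3 * LO_w κ p := Finset.sum_le_sum h5
    _ = 3 * ∑ p ∈ P, LO_w κ p := by rw [Finset.mul_sum]
    _ ≤ _ := by linarith

open scoped Classical in
lemma LO_good_card {q : ℕ} [NeZero q] (H : Finset (DirichletCharacter ℂ q)) (h1 : 1 ∈ H)
    (hmul : ∀ a ∈ H, ∀ b ∈ H, a * b ∈ H) :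
    (((Finset.univ : Finset (ZMod q)).filter (fun a => ∀ ψ ∈ H, ψ a = 1)).card : ℝ) * H.card ≤ q := by
  set G := (Finset.univ : Finset (ZMod q)).filter (fun a => ∀ ψ ∈ H, ψ a = 1) with hG
  have e1 : ∑ a : ZMod q, ∑ ψ ∈ H, ψ a = (G.card : ℂ) * H.card := by
    have : ∀ a : ZMod q, ∑ ψ ∈ H, ψ a = if a ∈ G then (H.card : ℂ) else 0 := by
      intro a
      split_ifs with h
      · rw [hG, Finset.mem_filter] at h
        rw [Finset.sum_congr rfl h.2]; simp
      · apply LO_H_sum H hmul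
        rw [hG, Finset.mem_filter] at h
        push Not at h
        exact h (Finset.mem_univ _)
    simp_rw [this]
    rw [Finset.sum_ite_mem]; simp
  have e2 : ∑ a : ZMod q, ∑ ψ ∈ H, ψ a = ∑ a : ZMod q, (1 : DirichletCharacter ℂ q) a := by
    rw [Finset.sum_comm, ← Finset.sum_erase_add _ _ h1, Finset.sum_eq_zero, zero_add]
    intro ψ hψ
    exact MulChar.sum_eq_zero_of_ne_one (Finset.ne_of_mem_erase hψ)
  have e3 : ‖(G.card : ℂ) * H.card‖ ≤ q := by
    rw [← e1, e2]
    refine (norm_sum_le _ _).trans ?_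
    calc ∑ a : ZMod q, ‖(1 : DirichletCharacter ℂ q) a‖ ≤ ∑ a : ZMod q, (1:ℝ) := 
          Finset.sum_le_sum fun a _ => DirichletCharacter.norm_le_one _ _
      _ = q := by simp [ZMod.card]
  rw [norm_mul, Complex.norm_natCast, Complex.norm_natCast] at e3
  exact e3

open scoped Classical in
/-- upper bound on the log-sum of residues in `G` -/
lemma LO_res_sum {q : ℕ} [NeZero q] (G : Finset (ZMod q)) (L : ℕ) (hL : 1 ≤ L) :
    ∑ n ∈ (Finset.Ico q (q * L)).filter (fun n : ℕ => (n : ZMod q) ∈ G), 1/(n:ℝ) ≤ 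
      (G.card : ℝ) / q * (1 + Real.log L) := by
  have hq0 : (0:ℝ) < q := by exact_mod_cast (NeZero.pos q)
  have hqn := NeZero.pos q
  have h : ∀ M : ℕ, 1 ≤ M → ∑ n ∈ (Finset.Ico q (q * M)).filter (fun n : ℕ => (n : ZMod q) ∈ G), 1/(n:ℝ) ≤ 
      (G.card : ℝ) / q * (harmonic (M-1) : ℝ) := by
    intro M hM
    induction M, hM using Nat.le_induction with
    | base => simp
    | succ M hM ih =>
      have hsplit : (Finset.Ico q (q * (M+1))).filter (fun n : ℕ => (n : ZMod q) ∈ G) = 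
        (Finset.Ico q (q * M)).filter (fun n : ℕ => (n : ZMod q) ∈ G) ∪ (Finset.Ico (q*M) (q * M + q)).filter (fun n : ℕ => (n : ZMod q) ∈ G) := by
        rw [← Finset.filter_union, Finset.Ico_union_Ico_eq_Ico (by nlinarith) (by omega), mul_add, mul_one]
      rw [hsplit]
      have hdisj : Disjoint ((Finset.Ico q (q * M)).filter (fun n : ℕ => (n : ZMod q) ∈ G)) ((Finset.Ico (q*M) (q * M + q)).filter (fun n : ℕ => (n : ZMod q) ∈ G)) :=
        Finset.disjoint_filter_filter (Finset.Ico_disjoint_Ico_consecutive _ _ _)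
      rw [Finset.sum_union hdisj]
      have hM0 : (0:ℝ) < M := by exact_mod_cast hM
      have hc : ((Finset.Ico (q*M) (q * M + q)).filter (fun n : ℕ => (n : ZMod q) ∈ G)).card ≤ G.card := by
        refine Finset.card_le_card_of_injOn (fun n : ℕ => (n : ZMod q)) ?_ ?_
        · intro n hn
          rw [Finset.mem_coe, Finset.mem_filter] at hn
          exact hn.2
        · intro a ha b hb hab
          rw [Finset.mem_coe, Finset.mem_filter, Finset.mem_Ico] at ha hb
          simp only at hab
          rw [ZMod.natCast_eq_natCast_iff] at hab
          obtain ⟨⟨a1, a2⟩, -⟩ := ha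
          obtain ⟨⟨b1, b2⟩, -⟩ := hb
          obtain ⟨a', rfl⟩ := Nat.exists_eq_add_of_le a1
          obtain ⟨b', rfl⟩ := Nat.exists_eq_add_of_le b1
          have hab' : a' ≡ b' [MOD q] := Nat.ModEq.add_left_cancel' _ hab
          rw [Nat.ModEq, Nat.mod_eq_of_lt (by omega), Nat.mod_eq_of_lt (by omega)] at hab'
          rw [hab']
      have h2 : ∑ n ∈ (Finset.Ico (q*M) (q * M + q)).filter (fun n : ℕ => (n : ZMod q) ∈ G), 1/(n:ℝ) ≤ 
          (G.card : ℝ) / q * (M:ℝ)⁻¹ := by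
        calc _ ≤ ∑ n ∈ (Finset.Ico (q*M) (q * M + q)).filter (fun n : ℕ => (n : ZMod q) ∈ G), 1/((q:ℝ) * M) := by
              refine Finset.sum_le_sum fun n hn => ?_
              rw [Finset.mem_filter, Finset.mem_Ico] at hn
              have : (q:ℝ) * M ≤ n := by exact_mod_cast hn.1.1
              gcongr
          _ ≤ (G.card : ℝ) * (1/((q:ℝ) * M)) := by
              rw [Finset.sum_const, nsmul_eq_mul]; gcongr
          _ = _ := by field_simp
      have h3 : (harmonic (M + 1 - 1) : ℝ) = (harmonic (M-1) : ℝ) + (M:ℝ)⁻¹ := by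
        obtain ⟨m, rfl⟩ := Nat.exists_eq_add_of_le' hM
        rw [Nat.add_sub_cancel, Nat.add_sub_cancel, harmonic_succ]; push_cast; rfl
      rw [h3, mul_add]
      linarith
  refine (h L hL).trans ?_
  gcongr
  refine (harmonic_le_one_add_log (L-1)).trans ?_
  rcases Nat.lt_or_ge 1 L with h1 | h1
  · gcongr
    · exact_mod_cast (by omega : 0 < L - 1)
    · omega
  · have : L = 1 := by omega
    subst this; simp

end

section
open scoped Pointwise

open scoped Classical in
lemma LO_fourier {q : ℕ} (χ : DirichletCharacter ℂ q) {d : ℕ} (hd : 1 ≤ d) (hχ : orderOf χ = d)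
    {α : ℂ} (hα : α ^ d = 1) (x : ℝ) :
    (d:ℝ) * (((Finset.Icc 1 ⌊x⌋₊).filter (fun n : ℕ => χ (n : ZMod q) = α)).card : ℝ) ≤
      ∑ j ∈ Finset.range d, ‖LO_A (fun n => (χ ^ j) n) x‖ := by
  have hα0 : α ≠ 0 := by rintro rfl; rw [zero_pow (by omega)] at hα; exact zero_ne_one hα
  have hχd : χ ^ d = 1 := by rw [← hχ]; exact pow_orderOf_eq_one χ
  have hpt : ∀ n : ℕ, ∑ j ∈ Finset.range d, (α⁻¹)^j * (χ^j) (n : ZMod q) = if χ (n : ZMod q) = α then (d:ℂ) else 0 := by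
    intro n
    by_cases hu : IsUnit (n : ZMod q)
    · obtain ⟨u, hu⟩ := hu
      rw [← hu]
      simp_rw [MulChar.pow_apply_coe, ← mul_pow]
      have hz : (α⁻¹ * χ u)^d = 1 := by
        rw [mul_pow, inv_pow, hα, ← MulChar.pow_apply_coe, hχd, MulChar.one_apply_coe]; simp
      split_ifs with h
      · rw [h, inv_mul_cancel₀ hα0]; simp
      · have hz1 : α⁻¹ * χ u ≠ 1 := by
          intro h1; apply h; field_simp at h1; exact h1
        have := mul_neg_geom_sum (α⁻¹ * χ u) d
        rw [hz, sub_self] at this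
        rcases mul_eq_zero.1 this with h2 | h2
        · exact absurd (sub_eq_zero.1 h2).symm hz1
        · exact h2
    · rw [Finset.sum_eq_zero (fun j _ => by rw [MulChar.map_nonunit _ hu, mul_zero]), MulChar.map_nonunit _ hu,
        if_neg (Ne.symm hα0)]
  have hα1 : ‖α‖ = 1 := Complex.norm_eq_one_of_pow_eq_one hα (by omega)
  have e : ((d:ℂ) * (((Finset.Icc 1 ⌊x⌋₊).filter (fun n : ℕ => χ (n : ZMod q) = α)).card : ℂ)) = 
      ∑ j ∈ Finset.range d, (α⁻¹)^j * LO_A (fun n => (χ ^ j) n) x := by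
    unfold LO_A
    simp_rw [Finset.mul_sum]
    rw [Finset.sum_comm]
    simp_rw [hpt]
    rw [← Finset.sum_filter, Finset.sum_const, nsmul_eq_mul, mul_comm]
    rfl
  have h2 : ‖((d:ℂ) * (((Finset.Icc 1 ⌊x⌋₊).filter (fun n : ℕ => χ (n : ZMod q) = α)).card : ℂ))‖ ≤ 
     ∑ j ∈ Finset.range d, ‖LO_A (fun n => (χ ^ j) n) x‖ := by
    rw [e]
    refine (norm_sum_le _ _).trans (Finset.sum_le_sum fun j _ => ?_)
    rw [norm_mul, norm_pow, norm_inv, hα1]; simp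
  rw [norm_mul, Complex.norm_natCast, Complex.norm_natCast] at h2
  exact h2

lemma LO_A_inv {q : ℕ} [NeZero q] (χ : DirichletCharacter ℂ q) (x : ℝ) :
    ‖LO_A (fun n => χ⁻¹ n) x‖ = ‖LO_A (fun n => χ n) x‖ := by
  have : LO_A (fun n => χ⁻¹ n) x = (starRingEnd ℂ) (LO_A (fun n => χ n) x) := by
    unfold LO_A
    rw [map_sum]
    refine Finset.sum_congr rfl fun n _ => ?_
    show χ⁻¹ (n : ZMod q) = _
    rw [← MulChar.star_apply']; rfl
  rw [this, Complex.norm_conj]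

/-- the large-sum set -/
lemma LO_J_exists {q : ℕ} [NeZero q] (χ : DirichletCharacter ℂ q) {d : ℕ} (hd : 1 ≤ d) (hχ : orderOf χ = d)
    {x σ : ℝ} (hx : 0 < x) (hσ : 0 < σ) 
    (hbig : 2 * σ * x * d < ∑ j ∈ Finset.range d, ‖LO_A (fun n => (χ ^ j) n) x‖) :
    ∃ J : Finset (DirichletCharacter ℂ q), σ * d ≤ J.card ∧ J.Nonempty ∧ (∀ a ∈ J, a⁻¹ ∈ J) ∧
      (∀ a ∈ J, a ∈ Subgroup.zpowers χ) ∧ ∀ a ∈ J, σ * x ≤ ‖LO_A (fun n => a n) x‖ := by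
  classical
  have hinj : Set.InjOn (fun j : ℕ => χ ^ j) (Finset.range d : Set ℕ) := by
    intro a ha b hb hab
    rw [Finset.coe_range, Set.mem_Iio, ← hχ] at ha hb
    exact pow_injOn_Iio_orderOf ha hb hab
  set J : Finset (DirichletCharacter ℂ q) := Finset.univ.filter (fun a => a ∈ Subgroup.zpowers χ ∧ σ * x ≤ ‖LO_A (fun n => a n) x‖) with hJ
  set I := (Finset.range d).filter (fun j => σ * x ≤ ‖LO_A (fun n => (χ^j) n) x‖) with hI
  have hIJ : I.card ≤ J.card := by
    refine Finset.card_le_card_of_injOn (fun j : ℕ => χ ^ j) ?_ ?_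
    · intro j hj
      rw [Finset.mem_coe, hI, Finset.mem_filter] at hj
      rw [Finset.mem_coe, hJ, Finset.mem_filter]
      exact ⟨Finset.mem_univ _, Subgroup.npow_mem_zpowers χ j, hj.2⟩
    · refine hinj.mono ?_
      rw [Finset.coe_subset]; exact Finset.filter_subset _ _
  have hAle : ∀ j, ‖LO_A (fun n => (χ ^ j) n) x‖ ≤ x := by
    intro j
    unfold LO_A
    refine (norm_sum_le _ _).trans ?_
    calc _ ≤ ∑ n ∈ Finset.Ioc 0 ⌊x⌋₊, (1:ℝ) := Finset.sum_le_sum fun n _ => DirichletCharacter.norm_le_one _ _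
      _ = (⌊x⌋₊ : ℝ) := by simp
      _ ≤ x := Nat.floor_le hx.le
  have hsum : ∑ j ∈ Finset.range d, ‖LO_A (fun n => (χ ^ j) n) x‖ ≤ I.card * x + d * (σ * x) := by
    rw [← Finset.sum_filter_add_sum_filter_not (Finset.range d) (fun j => σ * x ≤ ‖LO_A (fun n => (χ^j) n) x‖)]
    gcongr
    · calc _ ≤ ∑ j ∈ I, x := Finset.sum_le_sum fun j _ => hAle j
        _ = _ := by simp
    · calc _ ≤ ∑ j ∈ (Finset.range d).filter (fun j => ¬ (σ * x ≤ ‖LO_A (fun n => (χ^j) n) x‖)), σ * x := by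
            refine Finset.sum_le_sum fun j hj => ?_
            rw [Finset.mem_filter] at hj
            exact (not_le.1 hj.2).le
        _ ≤ _ := by
            rw [Finset.sum_const, nsmul_eq_mul]
            gcongr
            calc _ ≤ (Finset.range d).card := Finset.card_filter_le _ _
              _ = d := Finset.card_range d
  have h3 : σ * d < I.card := by
    have : σ * d * x < I.card * x := by linarith
    exact lt_of_mul_lt_mul_right this hx.le
  have hIJ' : (I.card : ℝ) ≤ J.card := by exact_mod_cast hIJ
  refine ⟨J, by linarith, ?_, ?_, ?_, ?_⟩
  · rw [← Finset.card_pos]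
    have : 0 < σ * d := by have : (0:ℝ) < d := by exact_mod_cast hd
                           positivity
    exact_mod_cast (by linarith : (0:ℝ) < J.card)
  · intro a ha
    rw [hJ, Finset.mem_filter] at ha ⊢
    exact ⟨Finset.mem_univ _, Subgroup.inv_mem _ ha.2.1, by rw [LO_A_inv]; exact ha.2.2⟩
  · intro a ha; rw [hJ, Finset.mem_filter] at ha; exact ha.2.1
  · intro a ha; rw [hJ, Finset.mem_filter] at ha; exact ha.2.2

noncomputable def LO_E (σ : ℝ) : ℝ := 16 * Real.log (1/σ) + 250
noncomputable def LO_W (σ : ℝ) : ℝ := 25/σ^2 * LO_E σ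

lemma LO_structure {q : ℕ} [NeZero q] (χ : DirichletCharacter ℂ q) {d : ℕ} (hd : 1 ≤ d) (hχ : orderOf χ = d)
    {U σ : ℝ} (hσ : 0 < σ) (hσ1 : σ ≤ 1) (hU : 10 ^ 7 / σ ^ 3 ≤ U)
    (hbig : 2 * σ * Real.exp U * d < ∑ j ∈ Finset.range d, ‖LO_A (fun n => (χ ^ j) n) (Real.exp U)‖)
    (h24 : 24 ≤ U * Real.exp (-(18*LO_W σ+4))) 
    (hlog : 2 * (3 + Real.log (2 + 3*(5 * 10^17 * U / σ^5))) ≤ U * Real.exp (-(18*LO_W σ+4))) :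
    ∃ H : Finset (DirichletCharacter ℂ q), 1 ∈ H ∧ (∀ a ∈ H, ∀ b ∈ H, a * b ∈ H) ∧ σ * d ≤ H.card ∧
      ∀ ψ ∈ H, LO_V (1/U) (fun n => ψ n) 0 ≤ 74 * LO_W σ + 44 := by
  classical
  obtain ⟨J, hJc, hJn, hJi, hJz, hJb⟩ := LO_J_exists χ hd hχ (Real.exp_pos U) hσ hbig
  have hU1 : 10^7 ≤ U := by
    refine le_trans ?_ hU
    rw [le_div_iff₀ (by positivity)]
    have : σ^3 ≤ 1 := pow_le_one₀ hσ.le hσ1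
    nlinarith
  have hU0 : 0 < U := by linarith
  have hκ0 : 0 < 1/U := by positivity
  set T := 10^17 * U / σ^4 with hT
  have hT0 : 0 < T := by positivity
  have hJV : ∀ ψ ∈ J, ∃ t : ℝ, |t| ≤ T ∧ LO_V (1/U) (fun n => ψ n) t ≤ LO_E σ / 4 := by
    intro ψ hψ
    obtain ⟨t, ht, hL⟩ := LO_halasz ψ hσ hσ1 hU (hJb ψ hψ)
    refine ⟨t, ht, ?_⟩
    have h1 := LO_V_upper ψ hκ0 t
    have h2 := Real.log_le_log (by positivity) hL
    have h3 : Real.log (σ^2 * U / 10^9) = Real.log U - 2 * Real.log (1/σ) - 9 * Real.log 10 := by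
      rw [Real.log_div (by positivity) (by norm_num), Real.log_mul (by positivity) (by positivity), Real.log_pow,
        Real.log_pow, one_div, Real.log_inv]; push_cast; ring
    have h4 : Real.log (1 + 1/(1/U)) ≤ Real.log 2 + Real.log U := by
      rw [← Real.log_mul (by norm_num) hU0.ne', one_div_one_div]
      exact Real.log_le_log (by linarith) (by linarith)
    have h5 : Real.log 10 ≤ 2.5 := by
      rw [Real.log_le_iff_le_exp (by norm_num)]
      have : Real.exp 2.5 = Real.exp 0.5 ^ 5 := by rw [← Real.exp_nat_mul]; norm_num
      rw [this]
      have h6 : (1.625:ℝ) ≤ Real.exp 0.5 := by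
        have := Real.quadratic_le_exp_of_nonneg (x := 0.5) (by norm_num)
        norm_num at this ⊢; linarith
      calc (10:ℝ) ≤ 1.625^5 := by norm_num
        _ ≤ _ := by gcongr
    have h6 := Real.log_two_lt_d9
    have h7 : 0 ≤ Real.log (1/σ) := Real.log_nonneg (by rw [le_div_iff₀ hσ]; linarith)
    unfold LO_E
    rw [h3] at h2
    linarith
  set J' := insert 1 J with hJ'
  have hE0 : 0 ≤ LO_E σ := by
    have h7 : 0 ≤ Real.log (1/σ) := Real.log_nonneg (by rw [le_div_iff₀ hσ]; linarith)
    unfold LO_E; linarith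
  have hJ'V : ∀ ψ ∈ J', ∃ t : ℝ, |t| ≤ T ∧ LO_V (1/U) (fun n => ψ n) t ≤ LO_E σ := by
    intro ψ hψ
    rw [hJ', Finset.mem_insert] at hψ
    rcases hψ with rfl | hψ
    · obtain ⟨ψ, hψ⟩ := hJn
      obtain ⟨t, ht, hV⟩ := hJV ψ hψ
      refine ⟨0, by simpa using hT0.le, ?_⟩
      have h := LO_V_mul (f := fun n => ψ n) (g := fun n => ψ⁻¹ n) (fun n => DirichletCharacter.norm_le_one _ _)
        (fun n => DirichletCharacter.norm_le_one _ _) hκ0 t (-t) one_pos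
      rw [LO_V_inv, add_neg_cancel] at h
      have e : (fun n : ℕ => ψ n * ψ⁻¹ n) = fun n : ℕ => (1 : DirichletCharacter ℂ q) n := by
        ext n
        rw [← MulChar.mul_apply]; congr 1; group
      rw [e] at h
      linarith
    · obtain ⟨t, ht, hV⟩ := hJV ψ hψ
      exact ⟨t, ht, by linarith⟩
  have hd0 : (0:ℝ) < d := by exact_mod_cast hd
  obtain ⟨k, hk1, hk2, H, hH⟩ := LO_group J' (Finset.mem_insert_self _ _) 
    (by
      intro a ha
      rw [hJ', Finset.mem_insert] at ha ⊢
      rcases ha with rfl | ha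
      · left; simp
      · right; exact hJi a ha) (D := d) (N := ⌊1/σ⌋₊) 
    (by
      intro n
      have hsub : ∀ m : ℕ, ∀ a ∈ J' ^ m, a ∈ Subgroup.zpowers χ := by
        intro m
        induction m with
        | zero => intro a ha; simp at ha; rw [ha]; exact Subgroup.one_mem _
        | succ m ih =>
          intro a ha
          rw [pow_succ, Finset.mem_mul] at ha
          obtain ⟨b, hb, c, hc, rfl⟩ := ha
          refine Subgroup.mul_mem _ (ih b hb) ?_
          rw [hJ', Finset.mem_insert] at hc
          rcases hc with rfl | hc
          · exact Subgroup.one_mem _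
          · exact hJz c hc
      rw [← hχ, ← Nat.card_zpowers, ← Set.ncard_coe_finset (J' ^ n)]
      have h := Set.ncard_le_ncard (s := ((J' ^ n : Finset (DirichletCharacter ℂ q)) : Set (DirichletCharacter ℂ q)))
        (t := (Subgroup.zpowers χ : Set (DirichletCharacter ℂ q))) (fun a ha => hsub n a ha) (Set.toFinite _)
      exact h)
    (by
      have h1 : (J.card : ℝ) ≤ J'.card := by exact_mod_cast Finset.card_le_card (Finset.subset_insert _ _)
      have h2 := Nat.lt_floor_add_one (1/σ)
      have h3 : (d:ℝ) < (⌊1/σ⌋₊ + 1) * J'.card := by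
        rw [div_lt_iff₀ hσ] at h2
        have hJp : σ * d ≤ (J'.card : ℝ) := by linarith
        have : (0:ℝ) ≤ (⌊1/σ⌋₊ : ℝ) + 1 := by positivity
        nlinarith
      exact_mod_cast h3)
  have hk5 : (k:ℝ) ≤ 5/σ := by
    have h1 : (k:ℝ) ≤ 3 * ⌊1/σ⌋₊ + 2 := by exact_mod_cast hk2
    have h2 : (⌊1/σ⌋₊:ℝ) ≤ 1/σ := Nat.floor_le (by positivity)
    have h3 : 1 ≤ 1/σ := by rw [le_div_iff₀ hσ]; linarith
    have : 5/σ = 5 * (1/σ) := by ring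
    rw [this]; linarith
  have hcol := LO_collapse H (U := U) (S := 5 * 10^17 * U / σ^5) (W := LO_W σ) (by linarith) (by positivity) 
    (by unfold LO_W; positivity) (by
      intro ψ hψ
      obtain ⟨t, ht, hV⟩ := LO_pow_dist J' hκ0 hJ'V k hk1 ψ ((hH ψ).1 hψ)
      refine ⟨t, ht.trans ?_, hV.trans ?_⟩
      · calc (k:ℝ) * T ≤ 5/σ * T := by gcongr
          _ = _ := by rw [hT]; field_simp
      · unfold LO_W
        have : (k:ℝ)^2 ≤ 25/σ^2 := by
          calc (k:ℝ)^2 ≤ (5/σ)^2 := by gcongr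
            _ = _ := by rw [div_pow]; norm_num
        gcongr) h24 hlog
  refine ⟨J' ^ k, (hH 1).1 H.one_mem, ?_, ?_, ?_⟩
  · intro a ha b hb
    exact (hH _).1 (H.mul_mem ((hH a).2 ha) ((hH b).2 hb))
  · have h1 : J ⊆ J' ^ k := by
      refine (Finset.subset_insert 1 J).trans ?_
      have := Finset.pow_subset_pow_right (s := J') (Finset.mem_insert_self _ _) hk1
      rwa [pow_one] at this
    have h2 : (J.card : ℝ) ≤ (J' ^ k).card := by exact_mod_cast Finset.card_le_card h1
    linarith
  · intro ψ hψ
    exact hcol ψ ((hH ψ).2 hψ)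

end

section
/-- the sifted harmonic sum -/
noncomputable def LO_sift (B : Finset ℕ) (Z : ℕ) : ℝ :=
  ∑ r ∈ (Finset.Icc 1 Z).filter (fun r : ℕ => ∀ p ∈ B, ¬ p ∣ r), 1 / (r:ℝ)

lemma LO_sift_insert (B : Finset ℕ) (hB : ∀ p ∈ B, p.Prime) (p : ℕ) (hp : p.Prime) (hpB : p ∉ B) (Z : ℕ) :
    (1 - 1/(p:ℝ)) * LO_sift B Z ≤ LO_sift (insert p B) Z := by
  classical
  have hp0 : (0:ℝ) < p := by exact_mod_cast hp.pos
  set A := (Finset.Icc 1 Z).filter (fun r : ℕ => ∀ p ∈ B, ¬ p ∣ r) with hA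
  have h1 : LO_sift B Z = ∑ r ∈ A.filter (fun r => ¬ p ∣ r), 1/(r:ℝ) + ∑ r ∈ A.filter (fun r => p ∣ r), 1/(r:ℝ) := by
    unfold LO_sift
    rw [add_comm, Finset.sum_filter_add_sum_filter_not]
  have h2 : LO_sift (insert p B) Z = ∑ r ∈ A.filter (fun r => ¬ p ∣ r), 1/(r:ℝ) := by
    unfold LO_sift
    rw [hA, Finset.filter_filter]
    refine Finset.sum_congr (Finset.filter_congr fun r _ => ?_) fun _ _ => rfl
    rw [Finset.forall_mem_insert, and_comm]
  have h3 : ∑ r ∈ A.filter (fun r => p ∣ r), 1/(r:ℝ) ≤ 1/p * LO_sift B Z := by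
    have himg : A.filter (fun r => p ∣ r) ⊆ A.image (fun m => p * m) := by
      intro r hr
      rw [Finset.mem_filter, hA, Finset.mem_filter, Finset.mem_Icc] at hr
      obtain ⟨⟨⟨r1, r2⟩, r3⟩, m, rfl⟩ := hr
      rw [Finset.mem_image]
      refine ⟨m, ?_, rfl⟩
      rw [hA, Finset.mem_filter, Finset.mem_Icc]
      refine ⟨⟨?_, ?_⟩, fun p' hp' hd => r3 p' hp' (hd.mul_left p)⟩
      · rcases Nat.eq_zero_or_pos m with h | h
        · subst h; omega
        · exact h
      · exact (Nat.le_mul_of_pos_left m hp.pos).trans r2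
    calc ∑ r ∈ A.filter (fun r => p ∣ r), 1/(r:ℝ) ≤ ∑ r ∈ A.image (fun m => p * m), 1/(r:ℝ) :=
          Finset.sum_le_sum_of_subset_of_nonneg himg fun _ _ _ => by positivity
      _ = ∑ m ∈ A, 1/((p * m : ℕ):ℝ) := by
          rw [Finset.sum_image]
          intro a _ b _ h
          exact Nat.eq_of_mul_eq_mul_left hp.pos h
      _ = 1/p * LO_sift B Z := by
          unfold LO_sift
          rw [Finset.mul_sum]
          refine Finset.sum_congr rfl fun m _ => ?_
          push_cast
          rw [one_div_mul_one_div]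
  have h4 : (1 - 1/(p:ℝ)) * LO_sift B Z = LO_sift B Z - 1/p * LO_sift B Z := by ring
  rw [h4, h2]
  linarith

lemma LO_sift_lower (B : Finset ℕ) (hB : ∀ p ∈ B, p.Prime) (Z : ℕ) :
    (∏ p ∈ B, (1 - 1/(p:ℝ))) * Real.log (Z + 1) ≤ LO_sift B Z := by
  classical
  induction B using Finset.induction_on with
  | empty =>
    unfold LO_sift
    have := log_add_one_le_harmonic Z
    rw [harmonic_eq_sum_Icc] at this
    simpa using this
  | insert p B hpB ih =>
    rw [Finset.prod_insert hpB, mul_assoc]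
    have hp := hB p (Finset.mem_insert_self _ _)
    have hB' : ∀ p ∈ B, p.Prime := fun p h => hB p (Finset.mem_insert_of_mem h)
    refine le_trans ?_ (LO_sift_insert B hB' p hp hpB Z)
    refine mul_le_mul_of_nonneg_left (ih hB') ?_
    have : (1:ℝ) ≤ p := by exact_mod_cast hp.one_lt.le
    rw [sub_nonneg, div_le_one (by linarith)]; exact this

lemma LO_sift_lower' (B : Finset ℕ) (hB : ∀ p ∈ B, p.Prime) (Z : ℕ) {K : ℝ} (hK : ∑ p ∈ B, 1/(p:ℝ) ≤ K) :
    Real.exp (-(2*K)) * Real.log (Z + 1) ≤ LO_sift B Z := by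
  refine le_trans ?_ (LO_sift_lower B hB Z)
  have hl : 0 ≤ Real.log (Z+1) := Real.log_nonneg (by linarith [Nat.cast_nonneg (α := ℝ) Z])
  refine mul_le_mul_of_nonneg_right ?_ hl
  calc Real.exp (-(2*K)) ≤ Real.exp (∑ p ∈ B, -(2 * (1/(p:ℝ)))) := by
        rw [Finset.sum_neg_distrib, ← Finset.mul_sum]; gcongr
    _ = ∏ p ∈ B, Real.exp (-(2 * (1/(p:ℝ)))) := Real.exp_sum _ _
    _ ≤ _ := by
      refine Finset.prod_le_prod (fun _ _ => (Real.exp_pos _).le) fun p hp => ?_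
      have h2 : (2:ℝ) ≤ p := by exact_mod_cast (hB p hp).two_le
      set t := 1/(p:ℝ) with ht
      have ht0 : 0 < t := by positivity
      have ht1 : t ≤ 1/2 := by rw [ht]; gcongr
      rw [Real.exp_neg, inv_le_comm₀ (Real.exp_pos _) (by linarith)]
      have h3 := Real.add_one_le_exp (2*t)
      refine le_trans ?_ h3
      rw [inv_le_iff_one_le_mul₀ (by linarith)]
      nlinarith

lemma LO_mertens_lower (Z : ℕ) (hZ : 1 ≤ Z) :
    Real.log (Real.log (Z + 1)) - 1 ≤ ∑ p ∈ (Finset.Icc 1 Z).filter Nat.Prime, 1/(p:ℝ) := by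
  set B := (Finset.Icc 1 Z).filter Nat.Prime with hBdef
  have hB : ∀ p ∈ B, p.Prime := fun p hp => (Finset.mem_filter.1 hp).2
  have h1 := LO_sift_lower B hB Z
  have h2 : LO_sift B Z = 1 := by
    unfold LO_sift
    have : (Finset.Icc 1 Z).filter (fun r : ℕ => ∀ p ∈ B, ¬ p ∣ r) = {1} := by
      ext r
      rw [Finset.mem_filter, Finset.mem_Icc, Finset.mem_singleton]
      constructor
      · rintro ⟨⟨h1, h2⟩, h3⟩
        by_contra hr
        have hm := Nat.minFac_prime hr
        have hd := Nat.minFac_dvd r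
        refine h3 _ ?_ hd
        rw [hBdef, Finset.mem_filter, Finset.mem_Icc]
        exact ⟨⟨hm.one_lt.le, (Nat.le_of_dvd (by omega) hd).trans h2⟩, hm⟩
      · rintro rfl
        exact ⟨⟨le_rfl, hZ⟩, fun p hp hd => (hB p hp).one_lt.ne' (Nat.dvd_one.1 hd)⟩
    rw [this]; simp
  rw [h2] at h1
  have hpos : ∀ p ∈ B, 0 < 1 - 1/(p:ℝ) := by
    intro p hp
    have h2 : (1:ℝ) < p := by exact_mod_cast (hB p hp).one_lt
    rw [sub_pos, div_lt_one (by linarith)]; exact h2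
  have hprod : 0 < ∏ p ∈ B, (1 - 1/(p:ℝ)) := Finset.prod_pos hpos
  have hL : 0 < Real.log (Z+1) := Real.log_pos (by have : (1:ℝ) ≤ Z := by exact_mod_cast hZ
                                                   linarith)
  have h3 : Real.log (Real.log (Z+1)) ≤ ∑ p ∈ B, - Real.log (1 - 1/(p:ℝ)) := by
    rw [Finset.sum_neg_distrib, ← Real.log_prod (fun p hp => (hpos p hp).ne')]
    have := Real.log_le_log (by positivity) h1
    rw [Real.log_one, Real.log_mul hprod.ne' hL.ne'] at this
    linarith
  have h4 : ∀ p ∈ B, - Real.log (1 - 1/(p:ℝ)) ≤ 1/(p:ℝ) + (1/((p:ℝ)-1) - 1/(p:ℝ)) := by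
    intro p hp
    have h2 : (1:ℝ) < p := by exact_mod_cast (hB p hp).one_lt
    have h5 := Real.log_le_sub_one_of_pos (inv_pos.2 (hpos p hp))
    rw [Real.log_inv] at h5
    have : (1 - 1/(p:ℝ))⁻¹ - 1 = 1/((p:ℝ)-1) := by
      have : (p:ℝ) - 1 ≠ 0 := by linarith
      field_simp
      ring
    linarith
  have h5 : ∑ p ∈ B, (1/((p:ℝ)-1) - 1/(p:ℝ)) ≤ 1 := by
    have h6 : B ⊆ Finset.Ico 2 (Z+1) := by
      intro p hp
      have := (hB p hp).two_le
      rw [hBdef, Finset.mem_filter, Finset.mem_Icc] at hp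
      rw [Finset.mem_Ico]; omega
    calc _ ≤ ∑ p ∈ Finset.Ico 2 (Z+1), (1/((p:ℝ)-1) - 1/(p:ℝ)) := by
          refine Finset.sum_le_sum_of_subset_of_nonneg h6 fun p hp _ => ?_
          rw [Finset.mem_Ico] at hp
          have : (2:ℝ) ≤ p := by exact_mod_cast hp.1
          rw [sub_nonneg]
          exact one_div_le_one_div_of_le (by linarith) (by linarith)
      _ = 1 - 1/(Z:ℝ) := by
          clear * - hZ
          induction Z, hZ using Nat.le_induction with
          | base => simp
          | succ n hn ih =>
            rw [Finset.sum_Ico_succ_top (by omega), ih]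
            push_cast; ring
      _ ≤ 1 := by have : (0:ℝ) ≤ 1/(Z:ℝ) := by positivity
                  linarith
  have h6 := Finset.sum_le_sum h4
  rw [Finset.sum_add_distrib] at h6
  linarith

lemma LO_mertens_upper {z : ℝ} (hz : Real.exp 1 ≤ z) :
    ∑ p ∈ (Finset.Icc 1 ⌊z⌋₊).filter Nat.Prime, 1/(p:ℝ) ≤ Real.log (Real.log z) + 13 := by
  set B := (Finset.Icc 1 ⌊z⌋₊).filter Nat.Prime with hBdef
  have hB : ∀ p ∈ B, p.Prime := fun p hp => (Finset.mem_filter.1 hp).2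
  have hz0 : 0 < z := (Real.exp_pos 1).trans_le hz
  have hl : 1 ≤ Real.log z := by rwa [Real.le_log_iff_exp_le hz0]
  set κ := 1/Real.log z with hκ
  have hκ0 : 0 < κ := by positivity
  have h1 : ∀ p ∈ B, 1/(p:ℝ) ≤ LO_w κ p + κ * (ArithmeticFunction.vonMangoldt p / p) := by
    intro p hp
    have hp0 : (0:ℝ) < p := by exact_mod_cast (hB p hp).pos
    rw [ArithmeticFunction.vonMangoldt_apply_prime (hB p hp)]
    unfold LO_w
    rw [neg_add, Real.rpow_add hp0, Real.rpow_neg_one, Real.rpow_def_of_pos hp0]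
    have := Real.add_one_le_exp (Real.log p * -κ)
    have hi : 0 < (p:ℝ)⁻¹ := by positivity
    rw [one_div, div_eq_mul_inv]
    nlinarith
  have h2 : ∑ p ∈ B, ArithmeticFunction.vonMangoldt p / (p:ℝ) ≤ Real.log z + 9 := by
    have hm := LO_mertens1 (x := z) (by linarith [Real.add_one_le_exp (1:ℝ)])
    have hm2 := (abs_le.1 hm).2
    refine le_trans (b := ∑ n ∈ Finset.Ioc 0 ⌊z⌋₊, ArithmeticFunction.vonMangoldt n / (n:ℝ)) ?_ (by linarith)
    refine Finset.sum_le_sum_of_subset_of_nonneg (fun p hp => ?_) 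
      fun n _ _ => div_nonneg ArithmeticFunction.vonMangoldt_nonneg (Nat.cast_nonneg _)
    rw [hBdef, Finset.mem_filter, Finset.mem_Icc] at hp
    rw [Finset.mem_Ioc]; exact ⟨hp.1.1, hp.1.2⟩
  have h3 : ∑ p ∈ B, LO_w κ p ≤ Real.log (1 + 1/κ) + 2 := by
    refine le_trans ?_ (LO_wsum hκ0).1
    set Q : Finset Nat.Primes := B.attach.map ⟨fun p => ⟨p.1, hB p.1 p.2⟩, by
      intro a b h; exact Subtype.ext (congrArg (fun x : Nat.Primes => (x:ℕ)) h)⟩ with hQ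
    have e : ∑ p ∈ B, LO_w κ p = ∑ p ∈ Q, LO_w κ p := by
      rw [hQ, Finset.sum_map, ← Finset.sum_attach]
      rfl
    rw [e]
    exact (LO_w_summable hκ0).sum_le_tsum _ fun p _ => LO_w_nonneg κ p
  have h4 : Real.log (1 + 1/κ) ≤ Real.log 2 + Real.log (Real.log z) := by
    rw [hκ, one_div_one_div, ← Real.log_mul (by norm_num) (by linarith)]
    exact Real.log_le_log (by linarith) (by linarith)
  have h5 : κ * (Real.log z + 9) ≤ 10 := by
    rw [hκ, one_div, inv_mul_le_iff₀ (by linarith)]; linarith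
  have h6 := Finset.sum_le_sum h1
  rw [Finset.sum_add_distrib, ← Finset.mul_sum] at h6
  have h7 := mul_le_mul_of_nonneg_left h2 hκ0.le
  have := Real.log_two_lt_d9
  linarith

end

section
/-- products of an element of `R` with `j` elements of `P` -/
def LO_T (R P : Finset ℕ) : ℕ → Finset ℕ
  | 0 => R
  | j+1 => ((LO_T R P j) ×ˢ P).image (fun a => a.1 * a.2)

lemma LO_T_ind {R P : Finset ℕ} (Q : ℕ → ℕ → Prop) (h0 : ∀ r ∈ R, Q 0 r)
    (hs : ∀ j n p, n ∈ LO_T R P j → p ∈ P → Q j n → Q (j+1) (n*p)) (j : ℕ) : ∀ n ∈ LO_T R P j, Q j n := by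
  induction j with
  | zero => exact h0
  | succ j ih =>
    intro n hn
    rw [LO_T, Finset.mem_image] at hn
    obtain ⟨⟨a, b⟩, hab, rfl⟩ := hn
    rw [Finset.mem_product] at hab
    exact hs j a b hab.1 hab.2 (ih a hab.1)

lemma LO_T_divs {R P : Finset ℕ} (hP : ∀ p ∈ P, p.Prime) (hR : ∀ r ∈ R, ∀ p ∈ P, ¬ p ∣ r) (j : ℕ) :
    ∀ n ∈ LO_T R P j, (P.filter (fun p => p ∣ n)).card ≤ j := by
  refine LO_T_ind (fun j n => (P.filter (fun p => p ∣ n)).card ≤ j) ?_ ?_ j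
  · intro r hr
    rw [Finset.filter_false_of_mem (hR r hr)]; simp
  · intro j n p _ hp ih
    have : P.filter (fun p' => p' ∣ n * p) ⊆ insert p (P.filter (fun p' => p' ∣ n)) := by
      intro p' hp'
      rw [Finset.mem_filter] at hp'
      rw [Finset.mem_insert, Finset.mem_filter]
      rcases ((hP p' hp'.1).dvd_mul).1 hp'.2 with h | h
      · right; exact ⟨hp'.1, h⟩
      · left; exact (Nat.prime_dvd_prime_iff_eq (hP p' hp'.1) (hP p hp)).1 h
    exact (Finset.card_le_card this).trans ((Finset.card_insert_le _ _).trans (by omega))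

lemma LO_T_step {R P : Finset ℕ} (hP : ∀ p ∈ P, p.Prime) (hR : ∀ r ∈ R, ∀ p ∈ P, ¬ p ∣ r) (j : ℕ) :
    (∑ n ∈ LO_T R P j, 1/(n:ℝ)) * ∑ p ∈ P, 1/(p:ℝ) ≤ (j+1) * ∑ n ∈ LO_T R P (j+1), 1/(n:ℝ) := by
  rw [Finset.sum_mul_sum, ← Finset.sum_product']
  rw [← Finset.sum_fiberwise_of_maps_to (t := LO_T R P (j+1)) (g := fun a : ℕ × ℕ => a.1 * a.2) 
    (fun a ha => by rw [LO_T]; exact Finset.mem_image_of_mem _ ha), Finset.mul_sum]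
  refine Finset.sum_le_sum fun n hn => ?_
  calc _ = ∑ a ∈ (LO_T R P j ×ˢ P).filter (fun a => a.1 * a.2 = n), 1/(n:ℝ) := by
        refine Finset.sum_congr rfl fun a ha => ?_
        rw [Finset.mem_filter] at ha
        rw [← ha.2, Nat.cast_mul, one_div_mul_one_div]
    _ ≤ _ := by
      rw [Finset.sum_const, nsmul_eq_mul]
      refine mul_le_mul_of_nonneg_right ?_ (by positivity)
      have h1 := LO_T_divs hP hR (j+1) n hn
      have h2 : ((LO_T R P j ×ˢ P).filter (fun a => a.1 * a.2 = n)).card ≤ (P.filter (fun p => p ∣ n)).card := by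
        refine Finset.card_le_card_of_injOn Prod.snd ?_ ?_
        · intro a ha
          rw [Finset.mem_coe, Finset.mem_filter, Finset.mem_product] at ha
          rw [Finset.mem_coe, Finset.mem_filter]
          exact ⟨ha.1.2, ⟨a.1, by rw [← ha.2, mul_comm]⟩⟩
        · intro a ha b hb hab
          rw [Finset.mem_coe, Finset.mem_filter, Finset.mem_product] at ha hb
          refine Prod.ext ?_ hab
          have hb2 := (hP _ hb.1.2).pos
          have := ha.2.trans hb.2.symm
          rw [hab] at this
          exact Nat.eq_of_mul_eq_mul_right hb2 this
      exact_mod_cast h2.trans h1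

lemma LO_T_lower {R P : Finset ℕ} (hP : ∀ p ∈ P, p.Prime) (hR : ∀ r ∈ R, ∀ p ∈ P, ¬ p ∣ r) 
    (h1 : 1 ≤ ∑ p ∈ P, 1/(p:ℝ)) (j : ℕ) :
    ∑ r ∈ R, 1/(r:ℝ) ≤ j.factorial * ∑ n ∈ LO_T R P j, 1/(n:ℝ) := by
  induction j with
  | zero => simp [LO_T]
  | succ j ih =>
    have hs := LO_T_step hP hR j
    have hn : 0 ≤ ∑ n ∈ LO_T R P j, 1/(n:ℝ) := Finset.sum_nonneg fun _ _ => by positivity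
    have h2 : ∑ n ∈ LO_T R P j, 1/(n:ℝ) ≤ (j+1) * ∑ n ∈ LO_T R P (j+1), 1/(n:ℝ) := by nlinarith
    rw [Nat.factorial_succ]
    push_cast
    calc _ ≤ _ := ih
      _ ≤ (j.factorial:ℝ) * ((j+1) * ∑ n ∈ LO_T R P (j+1), 1/(n:ℝ)) := by gcongr
      _ = _ := by ring

lemma LO_good_mul {q : ℕ} (ψ : DirichletCharacter ℂ q) (r : ℕ) (hr : r ≠ 0) 
    (h : ∀ p : ℕ, p.Prime → p ∣ r → ψ (p : ZMod q) = 1) : ψ (r : ZMod q) = 1 := by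
  induction r using Nat.recOnMul with
  | zero => exact absurd rfl hr
  | one => simp
  | prime p hp => exact h p hp dvd_rfl
  | mul a b iha ihb =>
    push_cast
    rw [map_mul, iha (left_ne_zero_of_mul hr) (fun p hp hd => h p hp (hd.mul_right b)), 
      ihb (right_ne_zero_of_mul hr) (fun p hp hd => h p hp (hd.mul_left a)), one_mul]

lemma LO_count {q : ℕ} [NeZero q] (H : Finset (DirichletCharacter ℂ q)) (h1H : 1 ∈ H)
    (hmul : ∀ a ∈ H, ∀ b ∈ H, a * b ∈ H) {U K σ : ℝ} {d k : ℕ} (hK : 0 ≤ K) 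
    (hU : Real.exp (K + 15) ≤ U) (hcard : σ * d ≤ H.card) 
    (hV : ∀ ψ ∈ H, LO_V (1/U) (fun n => ψ n) 0 ≤ K / 3)
    (hk : Real.log q ≤ k * (U * Real.exp (-(K+15)))) :
    σ * d ≤ k.factorial * (k + 3) * Real.exp (3 * K + 15) := by
  classical
  have hU1 : 1 ≤ U := le_trans (Real.one_le_exp (by linarith)) hU
  set G := (Finset.univ : Finset (ZMod q)).filter (fun a => ∀ ψ ∈ H, ψ a = 1) with hG
  set lz := U * Real.exp (-(K+15)) with hlz
  have hlz1 : 1 ≤ lz := by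
    have := mul_le_mul_of_nonneg_right hU (Real.exp_pos (-(K+15))).le
    rwa [← Real.exp_add, add_neg_cancel, Real.exp_zero] at this
  set Z := ⌊Real.exp lz⌋₊ with hZ
  set X := ⌊Real.exp U⌋₊ with hX
  have hlzU : lz ≤ U := by
    rw [hlz]
    exact mul_le_of_le_one_right (by linarith) (Real.exp_le_one_iff.2 (by linarith))
  have hZX : Z ≤ X := Nat.floor_mono (Real.exp_le_exp.2 hlzU)
  have hZ1 : 1 ≤ Z := by
    rw [hZ, Nat.one_le_floor_iff]; exact Real.one_le_exp (by linarith)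
  have hX1 : 1 ≤ X := hZ1.trans hZX
  have hXe : (X:ℝ) ≤ Real.exp U := Nat.floor_le (Real.exp_pos _).le
  have hZe : (Z:ℝ) ≤ Real.exp U := le_trans (by exact_mod_cast hZX) hXe
  have hZlt : Real.exp lz < Z + 1 := Nat.lt_floor_add_one _
  have hXlt : Real.exp U < X + 1 := Nat.lt_floor_add_one _
  -- bad primes
  set BX := ((Finset.Icc 1 X).filter Nat.Prime).filter (fun p : ℕ => ∃ ψ ∈ H, ψ (p : ZMod q) ≠ 1) with hBX
  have hbadX : ∑ p ∈ BX, 1/(p:ℝ) ≤ K := by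
    have := LO_bad_sum H ⟨1, h1H⟩ hmul hU1 hV BX (by
      intro p hp
      rw [hBX, Finset.mem_filter, Finset.mem_filter, Finset.mem_Icc] at hp
      exact ⟨hp.1.2, le_trans (by exact_mod_cast hp.1.1.2) hXe, hp.2⟩)
    linarith
  set B := BX.filter (fun p => p ≤ Z) with hB
  have hbadZ : ∑ p ∈ B, 1/(p:ℝ) ≤ K := 
    (Finset.sum_le_sum_of_subset_of_nonneg (Finset.filter_subset _ _) fun _ _ _ => by positivity).trans hbadX
  set P := ((Finset.Ioc Z X).filter Nat.Prime).filter (fun p : ℕ => ¬ ∃ ψ ∈ H, ψ (p : ZMod q) ≠ 1) with hP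
  have hPp : ∀ p ∈ P, p.Prime := fun p hp => by
    rw [hP, Finset.mem_filter, Finset.mem_filter] at hp; exact hp.1.2
  have hPb : ∀ p ∈ P, Z < p ∧ p ≤ X := fun p hp => by
    rw [hP, Finset.mem_filter, Finset.mem_filter, Finset.mem_Ioc] at hp; exact hp.1.1
  have hPg : ∀ p ∈ P, (p : ZMod q) ∈ G := fun p hp => by
    rw [hP, Finset.mem_filter] at hp
    rw [hG, Finset.mem_filter]
    have := hp.2
    push Not at this
    exact ⟨Finset.mem_univ _, this⟩
  have hP1 : 1 ≤ ∑ p ∈ P, 1/(p:ℝ) := by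
    have hlow := LO_mertens_lower X hX1
    have hup := LO_mertens_upper (z := Real.exp lz) (Real.exp_le_exp.2 hlz1)
    rw [Real.log_exp, ← hZ] at hup
    have e : Real.log lz = Real.log U - (K + 15) := by
      rw [hlz, Real.log_mul (by linarith) (Real.exp_pos _).ne', Real.log_exp]; ring
    have hUX : Real.log U ≤ Real.log (Real.log (X+1)) := by
      apply Real.log_le_log (by linarith)
      rw [Real.le_log_iff_exp_le (by positivity)]
      exact hXlt.le
    have hsub : (Finset.Icc 1 X).filter Nat.Prime ⊆ ((Finset.Icc 1 Z).filter Nat.Prime ∪ BX) ∪ P := by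
      intro p hp
      rw [Finset.mem_union, Finset.mem_union]
      by_cases hpZ : p ≤ Z
      · left; left
        rw [Finset.mem_filter, Finset.mem_Icc] at hp ⊢
        exact ⟨⟨hp.1.1, hpZ⟩, hp.2⟩
      · by_cases hb : ∃ ψ ∈ H, ψ (p : ZMod q) ≠ 1
        · left; right
          rw [hBX, Finset.mem_filter]; exact ⟨hp, hb⟩
        · right
          rw [Finset.mem_filter, Finset.mem_Icc] at hp
          rw [hP, Finset.mem_filter, Finset.mem_filter, Finset.mem_Ioc]
          exact ⟨⟨⟨by omega, hp.1.2⟩, hp.2⟩, hb⟩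
    have hun : ∀ s t : Finset ℕ, ∑ p ∈ s ∪ t, 1/(p:ℝ) ≤ ∑ p ∈ s, 1/(p:ℝ) + ∑ p ∈ t, 1/(p:ℝ) := by
      intro s t
      rw [← Finset.sum_union_inter]
      have : 0 ≤ ∑ p ∈ s ∩ t, 1/(p:ℝ) := Finset.sum_nonneg fun _ _ => by positivity
      linarith
    have h3 : ∑ p ∈ (Finset.Icc 1 X).filter Nat.Prime, 1/(p:ℝ) ≤ ∑ p ∈ ((Finset.Icc 1 Z).filter Nat.Prime ∪ BX) ∪ P, 1/(p:ℝ) :=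
      Finset.sum_le_sum_of_subset_of_nonneg hsub fun _ _ _ => by positivity
    have h4 := hun ((Finset.Icc 1 Z).filter Nat.Prime ∪ BX) P
    have h5 := hun ((Finset.Icc 1 Z).filter Nat.Prime) BX
    linarith
  set R := (Finset.Icc 1 Z).filter (fun r : ℕ => ∀ p ∈ B, ¬ p ∣ r) with hR
  have hBp : ∀ p ∈ B, p.Prime := fun p hp => by
    rw [hB, Finset.mem_filter, hBX, Finset.mem_filter, Finset.mem_filter] at hp; exact hp.1.1.2
  have hRP : ∀ r ∈ R, ∀ p ∈ P, ¬ p ∣ r := by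
    intro r hr p hp hd
    rw [hR, Finset.mem_filter, Finset.mem_Icc] at hr
    have := Nat.le_of_dvd (by omega) hd
    have := (hPb p hp).1
    omega
  have hRlow : Real.exp (-(2*K)) * lz ≤ ∑ r ∈ R, 1/(r:ℝ) := by
    refine le_trans ?_ (LO_sift_lower' B hBp Z hbadZ)
    gcongr
    rw [Real.le_log_iff_exp_le (by positivity)]
    exact hZlt.le
  have hTlow := LO_T_lower hPp hRP hP1 k
  -- membership
  have hTmem : ∀ n ∈ LO_T R P k, ((Z+1)^k ≤ n ∧ n ≤ Z * X^k) ∧ (n : ZMod q) ∈ G := by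
    refine LO_T_ind (fun j n => ((Z+1)^j ≤ n ∧ n ≤ Z * X^j) ∧ (n : ZMod q) ∈ G) ?_ ?_ k
    · intro r hr
      rw [hR, Finset.mem_filter, Finset.mem_Icc] at hr
      refine ⟨⟨by simpa using hr.1.1, by simpa using hr.1.2⟩, ?_⟩
      rw [hG, Finset.mem_filter]
      refine ⟨Finset.mem_univ _, fun ψ hψ => LO_good_mul ψ r (by omega) fun p hp hd => ?_⟩
      by_contra hne
      have hpr := Nat.le_of_dvd (by omega) hd
      refine hr.2 p ?_ hd
      rw [hB, Finset.mem_filter, hBX, Finset.mem_filter, Finset.mem_filter, Finset.mem_Icc]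
      exact ⟨⟨⟨⟨hp.one_lt.le, by omega⟩, hp⟩, ψ, hψ, hne⟩, by omega⟩
    · intro j n p _ hp ih
      obtain ⟨⟨i1, i2⟩, i3⟩ := ih
      have hb := hPb p hp
      refine ⟨⟨?_, ?_⟩, ?_⟩
      · rw [pow_succ]; exact Nat.mul_le_mul i1 hb.1
      · rw [pow_succ, ← mul_assoc]; exact Nat.mul_le_mul i2 hb.2
      · have hg := hPg p hp
        rw [hG, Finset.mem_filter] at i3 hg ⊢
        refine ⟨Finset.mem_univ _, fun ψ hψ => ?_⟩
        push_cast
        rw [map_mul, i3.2 ψ hψ, hg.2 ψ hψ, one_mul]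
  have hq0 : (0:ℝ) < q := by exact_mod_cast (NeZero.pos q)
  have hqZ : q ≤ (Z+1)^k := by
    have : (q:ℝ) ≤ ((Z:ℝ)+1)^k := by
      calc (q:ℝ) = Real.exp (Real.log q) := (Real.exp_log hq0).symm
        _ ≤ Real.exp (k * lz) := Real.exp_le_exp.2 hk
        _ = (Real.exp lz)^k := Real.exp_nat_mul _ _
        _ ≤ _ := by gcongr
    exact_mod_cast this
  set L := Z * X^k + 1 with hL
  have hsum : ∑ n ∈ LO_T R P k, 1/(n:ℝ) ≤ (G.card:ℝ)/q * (1 + Real.log L) := by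
    refine le_trans ?_ (LO_res_sum G L (by omega))
    refine Finset.sum_le_sum_of_subset_of_nonneg (fun n hn => ?_) fun _ _ _ => by positivity
    obtain ⟨⟨t1, t2⟩, t3⟩ := hTmem n hn
    rw [Finset.mem_filter, Finset.mem_Ico]
    refine ⟨⟨hqZ.trans t1, ?_⟩, t3⟩
    calc n < L := by omega
      _ ≤ q * L := Nat.le_mul_of_pos_left _ (NeZero.pos q)
  have hLlog : 1 + Real.log L ≤ (k + 3) * U := by
    have h1 : (L:ℝ) ≤ 2 * (Real.exp U)^(k+1) := by
      rw [hL]; push_cast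
      have h2 : (Z:ℝ) * X^k ≤ (Real.exp U)^(k+1) := by
        rw [pow_succ, mul_comm]; gcongr
      have h3 : (1:ℝ) ≤ (Real.exp U)^(k+1) := one_le_pow₀ (Real.one_le_exp (by linarith))
      linarith
    have h2 := Real.log_le_log (by rw [hL]; positivity) h1
    rw [Real.log_mul (by norm_num) (by positivity), Real.log_pow, Real.log_exp] at h2
    push_cast at h2
    have := Real.log_two_lt_d9
    nlinarith
  have hGH := LO_good_card H h1H hmul
  rw [← hG] at hGH
  have hHc : (0:ℝ) < H.card := by exact_mod_cast Finset.card_pos.2 ⟨1, h1H⟩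
  have hGq : (G.card:ℝ)/q ≤ 1/H.card := by
    rw [div_le_div_iff₀ hq0 hHc]; linarith
  have hLn : 0 ≤ 1 + Real.log L := by
    have : 0 ≤ Real.log L := Real.log_natCast_nonneg L
    linarith
  have hfin : Real.exp (-(2*K)) * lz ≤ k.factorial * (1/H.card * ((k+3)*U)) := by
    calc _ ≤ _ := hRlow
      _ ≤ _ := hTlow
      _ ≤ k.factorial * ((G.card:ℝ)/q * (1 + Real.log L)) := by gcongr
      _ ≤ _ := by gcongr
  have hU0 : 0 < U := by linarith
  refine hcard.trans ?_
  have e1 : Real.exp (-(2*K)) * lz = U * (Real.exp (3*K+15))⁻¹ := by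
    rw [hlz, ← Real.exp_neg, show -(3*K+15) = -(2*K) + -(K+15) by ring, Real.exp_add]; ring
  rw [e1] at hfin
  have e2 : (k.factorial:ℝ) * (1/H.card * ((k+3)*U)) = U * (k.factorial * (k+3) / H.card) := by ring
  rw [e2] at hfin
  have h5 := le_of_mul_le_mul_left hfin hU0
  rw [inv_eq_one_div, div_le_div_iff₀ (Real.exp_pos _) hHc] at h5
  linarith

end

section
open Filter

/-- all the asymptotic conditions on `ℓ = log log d` -/
def LO_cond (l : ℝ) : Prop :=
  1 ≤ l ∧ 5550 * 266 * (l ^ ((1:ℝ)/25))^3 + 147 ≤ l/10 ∧ 10^7 * l ≤ Real.exp (l/2) ∧ 24 ≤ Real.exp (2*l/5) ∧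
    2*l + (Real.exp (3*l/5) + 2) * l < Real.exp l ∧ Real.exp (3*l/5) + 4 ≤ Real.exp l ∧
    ∀ U : ℝ, Real.exp (l/2) ≤ U → 2 * (3 + Real.log (2 + 15 * 10^17 * U^2)) ≤ U ^ ((4:ℝ)/5)

lemma LO_lin_exp {b : ℝ} (hb : 0 < b) (c : ℝ) : ∀ᶠ l : ℝ in atTop, c ≤ Real.exp (b*l) ∧ c * l ≤ Real.exp (b * l) := by
  have h1 : Tendsto (fun l : ℝ => b * l) atTop atTop := tendsto_id.const_mul_atTop hb
  have h2 := (Real.tendsto_exp_atTop.comp h1).eventually_ge_atTop c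
  have h3 := ((Real.tendsto_exp_div_pow_atTop 1).comp h1).eventually_ge_atTop (c/b)
  filter_upwards [h2, h3, eventually_gt_atTop 0] with l h2 h3 h4
  refine ⟨h2, ?_⟩
  simp only [Function.comp, pow_one] at h3
  rw [div_le_div_iff₀ hb (by positivity)] at h3
  nlinarith

lemma LO_cond_ev : ∀ᶠ l : ℝ in atTop, LO_cond l := by
  have e1 : ∀ᶠ l : ℝ in atTop, 5550 * 266 * (l ^ ((1:ℝ)/25))^3 + 147 ≤ l/10 := by
    have h := (tendsto_rpow_atTop (y := (22:ℝ)/25) (by norm_num)).eventually_ge_atTop (10 * (5550*266 + 147))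
    filter_upwards [h, eventually_ge_atTop 1] with l h hl
    have h1 : (l ^ ((1:ℝ)/25))^3 = l ^ ((3:ℝ)/25) := by
      rw [← Real.rpow_natCast, ← Real.rpow_mul (by linarith)]; norm_num
    have h2 : l ^ ((3:ℝ)/25) * l ^ ((22:ℝ)/25) = l := by
      rw [← Real.rpow_add (by linarith)]; norm_num
    have h3 : 1 ≤ l ^ ((3:ℝ)/25) := Real.one_le_rpow hl (by norm_num)
    rw [h1]
    have h4 := mul_le_mul_of_nonneg_left h (by linarith : 0 ≤ l ^ ((3:ℝ)/25))
    rw [h2] at h4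
    linarith
  have e2 : ∀ᶠ U : ℝ in atTop, 2 * (3 + Real.log (2 + 15 * 10^17 * U^2)) ≤ U ^ ((4:ℝ)/5) := by
    have h1 := (isLittleO_log_rpow_atTop (r := (4:ℝ)/5) (by norm_num)).bound (c := 1/8) (by norm_num)
    have h2 := (tendsto_rpow_atTop (y := (4:ℝ)/5) (by norm_num)).eventually_ge_atTop (2 * (2 * (3 + Real.log (16*10^17))))
    filter_upwards [h1, h2, eventually_ge_atTop 2] with U h1 h2 hU
    have hU0 : 0 < U := by linarith
    rw [Real.norm_of_nonneg (Real.log_nonneg (by linarith)), Real.norm_of_nonneg (by positivity)] at h1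
    have h3 : Real.log (2 + 15 * 10^17 * U^2) ≤ Real.log (16*10^17) + 2 * Real.log U := by
      have : Real.log (16*10^17) + 2 * Real.log U = Real.log (16*10^17 * U^2) := by
        rw [Real.log_mul (x := 16*10^17) (y := U^2) (by norm_num) (by positivity), Real.log_pow U, Nat.cast_ofNat]
      rw [this]
      apply Real.log_le_log (by positivity)
      nlinarith
    generalize Real.log (16*10^17) = M at h2 h3
    generalize Real.log (2 + 15 * 10^17 * U^2) = N at h3 ⊢
    linarith
  have e3 : ∀ᶠ l : ℝ in atTop, ∀ U : ℝ, Real.exp (l/2) ≤ U → 2 * (3 + Real.log (2 + 15 * 10^17 * U^2)) ≤ U ^ ((4:ℝ)/5) := by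
    obtain ⟨U0, hU0⟩ := eventually_atTop.1 e2
    filter_upwards [LO_lin_exp (b := 1/2) (by norm_num) U0] with l hl U hU
    apply hU0
    refine hl.1.trans (le_trans (le_of_eq ?_) hU)
    congr 1; ring
  filter_upwards [eventually_ge_atTop 1, e1, e3, LO_lin_exp (b := 1/2) (by norm_num) (10^7), 
    LO_lin_exp (b := 2/5) (by norm_num) 24] with l h1 h2 h3 h4 h5
  have h4' : 10^7 * l ≤ Real.exp (l/2) := by 
    have := h4.2; rwa [show (1:ℝ)/2 * l = l/2 by ring] at this
  rw [show (2:ℝ)/5 * l = 2*l/5 by ring] at h5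
  have hs : Real.exp l = Real.exp (3*l/5) * Real.exp (2*l/5) := by rw [← Real.exp_add]; congr 1; ring
  have hA : 1 ≤ Real.exp (3*l/5) := Real.one_le_exp (by linarith)
  refine ⟨h1, h2, h4', h5.1, ?_, ?_, h3⟩
  · rw [hs]; nlinarith [h5.2]
  · rw [hs]; nlinarith [h5.1]

set_option maxHeartbeats 1000000 in
open scoped Classical in
lemma LO_main {q : ℕ} [NeZero q] {d : ℕ} (hd : 2 ≤ d) (hdq : d ≤ q) 
    (χ : DirichletCharacter ℂ q) (hχ : orderOf χ = d) (hc : LO_cond (Real.log (Real.log d)))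
    {x : ℝ} (hx : (q:ℝ) ^ (Real.sqrt (Real.log (Real.log (Real.exp 1 * d)) / (1 * Real.log d))) < x) 
    {α : ℂ} (hα : α ^ d = 1) :
    (((Finset.Icc 1 ⌊x⌋₊).filter (fun n : ℕ => χ (n : ZMod q) = α)).card : ℝ) ≤
        2 * x / (Real.log (Real.log d)) ^ ((1 : ℝ) / 25) := by
  set l := Real.log (Real.log d) with hl
  obtain ⟨c1, c2, c3, c4, c5, c6, c7⟩ := hc
  set v := l ^ ((1:ℝ)/25) with hv
  have hv1 : 1 ≤ v := Real.one_le_rpow c1 (by norm_num)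
  have hv0 : 0 < v := by linarith
  have hvl : v ^ 25 = l := by
    rw [hv, ← Real.rpow_natCast, ← Real.rpow_mul (by linarith)]; norm_num
  have hd0 : (0:ℝ) < d := by positivity
  have hd1 : (1:ℝ) < d := by exact_mod_cast hd
  have hm0 : 0 < Real.log d := Real.log_pos hd1
  have hm : Real.log d = Real.exp l := by rw [hl, Real.exp_log hm0]
  have hq0 : (0:ℝ) < q := by exact_mod_cast (NeZero.pos q)
  have hdqr : (d:ℝ) ≤ q := by exact_mod_cast hdq
  have hlq : Real.exp l ≤ Real.log q := by rw [← hm]; exact Real.log_le_log hd0 hdqr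
  set δ := Real.sqrt (Real.log (Real.log (Real.exp 1 * d)) / (1 * Real.log d)) with hδ
  have hδ1 : Real.exp (-(l/2)) ≤ δ := by
    apply Real.le_sqrt_of_sq_le
    rw [← Real.exp_nat_mul, one_mul, hm, le_div_iff₀ (Real.exp_pos _), ← Real.exp_add]
    have : ((2:ℕ):ℝ) * (-(l/2)) + l = 0 := by push_cast; ring
    rw [this, Real.exp_zero, Real.log_mul (Real.exp_pos 1).ne' hd0.ne', Real.log_exp]
    rw [Real.le_log_iff_exp_le (by linarith), hm]
    have := Real.exp_le_exp.2 c1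
    linarith
  have hx0 : 0 < x := lt_trans (by positivity) hx
  set U := Real.log x with hUdef
  have hxU : x = Real.exp U := (Real.exp_log hx0).symm
  have hUq : Real.log q * Real.exp (-(l/2)) ≤ U := by
    have h1 := Real.log_le_log (by positivity) hx.le
    rw [Real.log_rpow hq0] at h1
    have h2 : 0 ≤ Real.log q := le_trans (Real.exp_pos _).le hlq
    nlinarith
  have hUl : Real.exp (l/2) ≤ U := by
    refine le_trans ?_ hUq
    have := mul_le_mul_of_nonneg_right hlq (Real.exp_pos (-(l/2))).le
    rw [← Real.exp_add] at this
    refine le_trans (le_of_eq ?_) this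
    congr 1; ring
  have hU0 : 0 < U := lt_of_lt_of_le (Real.exp_pos _) hUl
  have hqU : Real.log q ≤ U * Real.exp (l/2) := by
    have := mul_le_mul_of_nonneg_right hUq (Real.exp_pos (l/2)).le
    rwa [mul_assoc, ← Real.exp_add, neg_add_cancel, Real.exp_zero, mul_one] at this
  by_contra hcon
  rw [not_le] at hcon
  set σ := 1/v with hσdef
  have hσ : 0 < σ := by positivity
  have hσ1 : σ ≤ 1 := by rw [hσdef, div_le_one hv0]; exact hv1
  have h1σ : 1/σ = v := by rw [hσdef, one_div_one_div]
  have hbig : 2 * σ * Real.exp U * d < ∑ j ∈ Finset.range d, ‖LO_A (fun n => (χ ^ j) n) (Real.exp U)‖ := by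
    have h := LO_fourier χ (by omega) hχ hα x
    rw [← hxU]
    refine lt_of_lt_of_le ?_ h
    have h2 := mul_lt_mul_of_pos_left hcon hd0
    refine lt_of_eq_of_lt ?_ h2
    rw [hσdef]; ring
  have hW : LO_W σ = 25 * v^2 * (16 * Real.log v + 250) := by
    unfold LO_W LO_E
    rw [h1σ, hσdef]; field_simp
  have hlogv0 : 0 ≤ Real.log v := Real.log_nonneg hv1
  have hlogv : Real.log v ≤ v := (Real.log_le_sub_one_of_pos hv0).trans (by linarith)
  have hW0 : 0 ≤ LO_W σ := by rw [hW]; positivity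
  have hWb : 222 * LO_W σ + 147 ≤ l/10 := by
    refine le_trans ?_ c2
    rw [hW]
    have : 16 * Real.log v + 250 ≤ 266 * v := by linarith
    have h2 := mul_le_mul_of_nonneg_left this (by positivity : 0 ≤ 222 * (25 * v^2))
    nlinarith
  have hexpW : Real.exp (-(l/10)) ≤ Real.exp (-(18*LO_W σ+4)) := Real.exp_le_exp.2 (by linarith)
  have hvl2 : ∀ n ≤ 25, v^n ≤ l := fun n hn => by rw [← hvl]; exact pow_le_pow_right₀ hv1 hn
  have hlU : 10^7 * l ≤ U := c3.trans hUl
  obtain ⟨H, hH1, hHm, hHc, hHV⟩ := LO_structure χ (by omega) hχ hσ hσ1 (U := U) (by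
      have : 10^7/σ^3 = 10^7 * v^3 := by rw [hσdef]; field_simp
      rw [this]
      have := hvl2 3 (by norm_num)
      linarith) hbig (by
      calc (24:ℝ) ≤ Real.exp (2*l/5) := c4
        _ = Real.exp (l/2) * Real.exp (-(l/10)) := by rw [← Real.exp_add]; congr 1; ring
        _ ≤ _ := by gcongr) (by
      have h1 : 5 * 10^17 * U / σ^5 = 5 * 10^17 * U * v^5 := by rw [hσdef]; field_simp
      rw [h1]
      have h5 := hvl2 5 (by norm_num)
      have h5' : v^5 ≤ U := by linarith
      calc 2 * (3 + Real.log (2 + 3*(5 * 10^17 * U * v^5))) ≤ 2 * (3 + Real.log (2 + 15 * 10^17 * U^2)) := by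
            have h6 : 2 + 3*(5 * 10^17 * U * v^5) ≤ 2 + 15 * 10^17 * U^2 := by
              have := mul_le_mul_of_nonneg_left h5' hU0.le
              linarith
            have := Real.log_le_log (by positivity) h6
            linarith
        _ ≤ U ^ ((4:ℝ)/5) := c7 U hUl
        _ ≤ U * Real.exp (-(l/10)) := by
            have : (Real.exp (l/2))^(-((1:ℝ)/5)) = Real.exp (-(l/10)) := by
              rw [← Real.exp_mul]; congr 1; ring
            rw [← this]
            have h2 : U ^ (-((1:ℝ)/5)) ≤ (Real.exp (l/2))^(-((1:ℝ)/5)) := 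
              Real.rpow_le_rpow_of_nonpos (Real.exp_pos _) hUl (by norm_num)
            calc U ^ ((4:ℝ)/5) = U * U ^ (-((1:ℝ)/5)) := by
                  nth_rewrite 2 [← Real.rpow_one U]
                  rw [← Real.rpow_add hU0]; norm_num
              _ ≤ _ := by gcongr
        _ ≤ _ := by gcongr)
  set K := 222 * LO_W σ + 132 with hK
  have hK0 : 0 ≤ K := by positivity
  have hKl : K + 15 ≤ l/10 := by rw [hK]; linarith
  set y := Real.log q / (U * Real.exp (-(K+15))) with hy
  set k := ⌈y⌉₊ with hk
  have hden : 0 < U * Real.exp (-(K+15)) := by positivity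
  have hcount := LO_count H hH1 hHm (U := U) (K := K) (σ := σ) (d := d) (k := k) hK0 
    (le_trans (Real.exp_le_exp.2 (by linarith)) hUl) hHc 
    (fun ψ hψ => (hHV ψ hψ).trans (by rw [hK]; linarith))
    (by rw [← div_le_iff₀ hden]; exact Nat.le_ceil y)
  have hy0 : 0 ≤ y := div_nonneg (le_trans (Real.exp_pos _).le hlq) hden.le
  have hyb : y ≤ Real.exp (3*l/5) := by
    rw [hy, div_le_iff₀ hden]
    calc Real.log q ≤ U * Real.exp (l/2) := hqU
      _ = Real.exp (3*l/5) * (U * Real.exp (-(l/10))) := by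
          rw [mul_comm (Real.exp (3*l/5)), mul_assoc, ← Real.exp_add]; congr 2; ring
      _ ≤ _ := by gcongr
  have hkb : (k:ℝ) ≤ Real.exp (3*l/5) + 1 := by
    have := Nat.ceil_lt_add_one hy0
    linarith
  have hfac : (k.factorial : ℝ) ≤ (k + 3)^k := by
    calc (k.factorial : ℝ) ≤ (k:ℝ)^k := by exact_mod_cast Nat.factorial_le_pow k
      _ ≤ _ := by gcongr; linarith
  have hk3 : Real.log (k+3) ≤ l := by
    rw [Real.log_le_iff_le_exp (by positivity)]; linarith
  have hlog := Real.log_le_log (by positivity) hcount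
  rw [Real.log_mul hσ.ne' hd0.ne', Real.log_mul (by positivity) (by positivity), Real.log_exp,
    Real.log_mul (by positivity) (by positivity), hm, hσdef, one_div, Real.log_inv] at hlog
  have hlf : Real.log k.factorial ≤ k * l := by
    have := Real.log_le_log (by positivity) hfac
    rw [Real.log_pow] at this
    refine this.trans ?_
    gcongr
  have hvl1 : v ≤ l := by simpa using hvl2 1 (by norm_num)
  have hkl : (k:ℝ) * l ≤ (Real.exp (3*l/5) + 1) * l := mul_le_mul_of_nonneg_right hkb (by linarith)
  linarith

open scoped Classical in
/-- the result for integers `n ≤ x` -/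
theorem LO_integers :
    ∃ c₁ C : ℝ, 0 < c₁ ∧ 0 < C ∧ ∃ Q : ℕ, ∀ q : ℕ, q.Prime → Q ≤ q →
      ∀ d : ℕ, 2 ≤ d → Squarefree d → d ∣ (q - 1) →
      ∀ χ : DirichletCharacter ℂ q, χ.IsPrimitive → orderOf χ = d →
      ∀ x : ℝ,
        x > (q : ℝ) ^
          (max (Real.sqrt (Real.log (Real.log (Real.exp 1 * d)) / (c₁ * Real.log d)))
               ((Real.log q) ^ (-c₁))) →
      ∀ α : ℂ, α ^ d = 1 →
      (((Finset.Icc 1 ⌊x⌋₊).filter (fun n : ℕ => χ (n : ZMod q) = α)).card : ℝ) ≤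
        C * x / (Real.log (Real.log d)) ^ ((1 : ℝ) / 25) := by
  have hev : ∀ᶠ d : ℕ in atTop, LO_cond (Real.log (Real.log d)) :=
    (Real.tendsto_log_atTop.comp (Real.tendsto_log_atTop.comp tendsto_natCast_atTop_atTop)).eventually LO_cond_ev
  obtain ⟨D, hD⟩ := eventually_atTop.1 hev
  set F : ℕ → ℝ := fun d => |(Real.log (Real.log d)) ^ ((1 : ℝ) / 25)| with hF
  have hFn : ∀ d, 0 ≤ F d := fun d => abs_nonneg _
  refine ⟨1, 2 + ∑ d ∈ Finset.range D, F d, one_pos, ?_, 0, ?_⟩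
  · have := Finset.sum_nonneg fun d (_ : d ∈ Finset.range D) => hFn d
    linarith
  intro q hq _ d hd _ hdq χ _ hχ x hx α hα
  have : NeZero q := ⟨hq.ne_zero⟩
  have hq1 : (1:ℝ) ≤ q := by exact_mod_cast hq.one_lt.le
  have hx0 : 0 < x := lt_trans (Real.rpow_pos_of_pos (by linarith) _) hx
  have hpos : 0 < (Real.log (Real.log d)) ^ ((1 : ℝ) / 25) := by
    rcases Nat.lt_or_ge d 3 with h | h
    · have h2 : d = 2 := by omega
      subst h2
      have hneg : Real.log (Real.log ((2:ℕ):ℝ)) < 0 := by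
        apply Real.log_neg
        · exact Real.log_pos (by norm_num)
        · have := Real.log_two_lt_d9
          push_cast; linarith
      rw [Real.rpow_def_of_neg hneg]
      refine mul_pos (Real.exp_pos _) (Real.cos_pos_of_mem_Ioo ⟨?_, ?_⟩) <;> linarith [Real.pi_pos]
    · apply Real.rpow_pos_of_pos
      apply Real.log_pos
      rw [Real.lt_log_iff_exp_lt (by positivity)]
      have : (3:ℝ) ≤ d := by exact_mod_cast h
      linarith [Real.exp_one_lt_d9]
  rcases Nat.lt_or_ge d D with h | h
  · have hcard : (((Finset.Icc 1 ⌊x⌋₊).filter (fun n : ℕ => χ (n : ZMod q) = α)).card : ℝ) ≤ x := by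
      calc _ ≤ (((Finset.Icc 1 ⌊x⌋₊)).card : ℝ) := by exact_mod_cast Finset.card_filter_le _ _
        _ = (⌊x⌋₊ : ℝ) := by simp
        _ ≤ x := Nat.floor_le hx0.le
    refine hcard.trans ?_
    rw [le_div_iff₀ hpos, mul_comm]
    refine mul_le_mul_of_nonneg_right ?_ hx0.le
    have h1 : F d ≤ ∑ d ∈ Finset.range D, F d := 
      Finset.single_le_sum (fun d _ => hFn d) (Finset.mem_range.2 h)
    have h2 : (Real.log (Real.log d)) ^ ((1 : ℝ) / 25) ≤ F d := le_abs_self _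
    linarith
  · have hdq' : d ≤ q := by
      have := Nat.le_of_dvd (by have := hq.two_le; omega) hdq
      omega
    have hm := LO_main hd hdq' χ hχ (hD d h) (x := x) (lt_of_le_of_lt 
      (Real.rpow_le_rpow_of_exponent_le hq1 (le_max_left _ _)) hx) hα
    refine hm.trans ?_
    have := Finset.sum_nonneg fun d (_ : d ∈ Finset.range D) => hFn d
    gcongr
    linarith

end

open Finset
open scoped Classical

theorem large_order_level_sets_sparse :
    ∃ c₁ C : ℝ, 0 < c₁ ∧ 0 < C ∧ ∃ Q : ℕ, ∀ q : ℕ, q.Prime → Q ≤ q →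
      ∀ d : ℕ, 2 ≤ d → Squarefree d → d ∣ (q - 1) →
      ∀ χ : DirichletCharacter ℂ q, χ.IsPrimitive → orderOf χ = d →
      ∀ x : ℝ,
        x > (q : ℝ) ^
          (max (Real.sqrt (Real.log (Real.log (Real.exp 1 * d)) / (c₁ * Real.log d)))
               ((Real.log q) ^ (-c₁))) →
      ∀ α : ℂ, α ^ d = 1 →
      (((Finset.Icc 1 ⌊x⌋₊).filter (fun n => χ (n : ZMod q) = α)).card : ℝ) ≤
        C * x / (Real.log (Real.log d)) ^ ((1 : ℝ) / 25) := by
  -- In the frozen statement the filter runs over the image of `Icc 1 ⌊x⌋₊` in `ZMod q`;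
  -- its cardinality is at most the number of integers counted in `LO_integers`.
  obtain ⟨c₁, C, hc, hC, Q, h⟩ := LO_integers
  refine ⟨c₁, C, hc, hC, Q, ?_⟩
  intro q hq hQ d hd hsq hdq χ hprim hord x hx α hα
  refine le_trans ?_ (h q hq hQ d hd hsq hdq χ hprim hord x hx α hα)
  have hsub : ((Finset.Icc 1 ⌊x⌋₊).filter (fun n => χ (n : ZMod q) = α)) ⊆
      ((Finset.Icc 1 ⌊x⌋₊).filter (fun n : ℕ => χ (n : ZMod q) = α)).image
        (fun n : ℕ => (n : ZMod q)) := by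
    intro a ha
    rw [Finset.mem_filter] at ha
    obtain ⟨ha1, ha2⟩ := ha
    simp only [Finset.bind_def, Finset.pure_def, Finset.mem_sup, Finset.mem_singleton] at ha1
    obtain ⟨n, hn, rfl⟩ := ha1
    exact Finset.mem_image.2 ⟨n, Finset.mem_filter.2 ⟨hn, ha2⟩, rfl⟩
  exact_mod_cast (Finset.card_le_card hsub).trans Finset.card_image_le
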